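/- For every positive integer q, the integral group homology of PSL_2(O_{-5}) with trivial ℤ-coefficients is given, as an abelian group, by: H_q(PSL_2(O_{-5}); ℤ) ≅ ℤ² ⊕ ℤ/3 ⊕ (ℤ/2)² for q = 1; H_q ≅ ℤ ⊕ ℤ/4 ⊕ ℤ/3 ⊕ ℤ/2 for q = 2; and H_q ≅ ℤ/3 ⊕ (ℤ/2)^q for all q ≥ 3. -/

import Mathlib

/-!
Group homology via the inhomogeneous bar complex (trivial coefficients).
-/

namespace BarHomology

/-- The `n`-th term of the inhomogeneous bar complex of `G` with trivial coefficients in `A`. -/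
abbrev chains (G : Type) (A : Type) [AddCommGroup A] (n : ℕ) : Type := (Fin n → G) →₀ A

/-- The differential of the inhomogeneous bar complex with trivial coefficients:
`d (g₁, …, g_{n+1}) = (g₂, …, g_{n+1}) + ∑_{j=1}^{n} (-1)^j (g₁, …, g_j g_{j+1}, …, g_{n+1})
  + (-1)^{n+1} (g₁, …, g_n)`. -/
noncomputable def d (k : Type) [CommRing k] (G : Type) [Group G] (A : Type) [AddCommGroup A]
    [Module k A] (n : ℕ) : chains G A (n + 1) →ₗ[k] chains G A n :=
  Finsupp.lsum k fun g =>
    (Finsupp.lsingle (fun i => g i.succ) : A →ₗ[k] chains G A n)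
      + ∑ j : Fin (n + 1),
          ((-1 : k) ^ ((j : ℕ) + 1)) • (Finsupp.lsingle (Fin.contractNth j (· * ·) g))

/-- The cycles: everything in degree `0`, the kernel of the differential in positive degrees. -/
noncomputable def cycles (k : Type) [CommRing k] (G : Type) [Group G] (A : Type) [AddCommGroup A]
    [Module k A] : (n : ℕ) → Submodule k (chains G A n)
  | 0 => ⊤
  | (n + 1) => LinearMap.ker (d k G A n)

/-- The boundaries, viewed as a submodule of the cycles. -/
noncomputable def boundariesIn (k : Type) [CommRing k] (G : Type) [Group G] (A : Type)
    [AddCommGroup A] [Module k A] (n : ℕ) : Submodule k (cycles k G A n) :=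
  (LinearMap.range (d k G A n)).comap (cycles k G A n).subtype

/-- Group homology of `G` in degree `n` with trivial coefficients in the `k`-module `A`,
defined as cycles modulo boundaries in the inhomogeneous bar complex. -/
abbrev GroupHomology (k : Type) [CommRing k] (G : Type) [Group G] (A : Type) [AddCommGroup A]
    [Module k A] (n : ℕ) : Type :=
  ↥(cycles k G A n) ⧸ boundariesIn k G A n

section Maps

variable {k : Type} [CommRing k] {G G' : Type} [Group G] [Group G'] {A : Type} [AddCommGroup A]
  [Module k A]

/-- The chain map induced by a group homomorphism. -/
noncomputable def chainsMap (k : Type) [CommRing k] (A : Type) [AddCommGroup A] [Module k A]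
    (φ : G →* G') (n : ℕ) : chains G A n →ₗ[k] chains G' A n :=
  Finsupp.lmapDomain A k (fun f => φ ∘ f)

lemma comp_contractNth (φ : G →* G') {n : ℕ} (j : Fin (n + 1)) (g : Fin (n + 1) → G) :
    φ ∘ Fin.contractNth j (· * ·) g = Fin.contractNth j (· * ·) (φ ∘ g) := by
  funext i
  rcases lt_trichotomy (i : ℕ) (j : ℕ) with h | h | h
  · simp [Function.comp_apply, Fin.contractNth_apply_of_lt _ _ _ _ h]
  · simp [Function.comp_apply, Fin.contractNth_apply_of_eq _ _ _ _ h, map_mul]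
  · simp [Function.comp_apply, Fin.contractNth_apply_of_gt _ _ _ _ h]

lemma chainsMap_comm (φ : G →* G') (n : ℕ) :
    (d k G' A n).comp (chainsMap k A φ (n + 1))
      = (chainsMap k A φ n).comp (d k G A n) := by
  apply Finsupp.lhom_ext
  intro g a
  simp only [LinearMap.comp_apply, chainsMap, Finsupp.lmapDomain_apply, Finsupp.mapDomain_single,
    d, Finsupp.lsum_single, LinearMap.add_apply, LinearMap.sum_apply, LinearMap.smul_apply,
    Finsupp.lsingle_apply, map_add, map_sum, map_smul]
  congr 1
  refine Finset.sum_congr rfl fun j _ => ?_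
  rw [comp_contractNth]

lemma chainsMap_mem_cycles (φ : G →* G') {n : ℕ} {x : chains G A n}
    (hx : x ∈ cycles k G A n) : chainsMap k A φ n x ∈ cycles k G' A n := by
  cases n with
  | zero => trivial
  | succ n =>
    simp only [cycles, LinearMap.mem_ker] at hx ⊢
    have := LinearMap.congr_fun (chainsMap_comm (k := k) (A := A) φ n) x
    simp only [LinearMap.comp_apply] at this
    rw [this, hx, map_zero]

/-- The map induced by a group homomorphism on cycles. -/
noncomputable def cyclesMap (k : Type) [CommRing k] (A : Type) [AddCommGroup A] [Module k A]
    (φ : G →* G') (n : ℕ) : ↥(cycles k G A n) →ₗ[k] ↥(cycles k G' A n) :=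
  (chainsMap k A φ n).restrict fun _ hx => chainsMap_mem_cycles φ hx

/-- The map induced by a group homomorphism on group homology with trivial coefficients. -/
noncomputable def inducedMap (k : Type) [CommRing k] (A : Type) [AddCommGroup A] [Module k A]
    (φ : G →* G') (n : ℕ) :
    GroupHomology k G A n →ₗ[k] GroupHomology k G' A n :=
  Submodule.mapQ (boundariesIn k G A n) (boundariesIn k G' A n) (cyclesMap k A φ n) (by
    rintro ⟨x, hx⟩ hb
    simp only [boundariesIn, Submodule.mem_comap, Submodule.subtype_apply,
      LinearMap.mem_range] at hb ⊢
    obtain ⟨w, hw⟩ := hb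
    refine ⟨chainsMap k A φ (n + 1) w, ?_⟩
    have := LinearMap.congr_fun (chainsMap_comm (k := k) (A := A) φ n) w
    simp only [LinearMap.comp_apply] at this
    rw [this, hw]
    rfl)

end Maps

end BarHomology

open BarHomology

/-- The projective special linear group `PSL₂(R)`, i.e. `SL₂(R)` modulo its center. -/
abbrev PSL2 (R : Type) [CommRing R] : Type :=
  Matrix.ProjectiveSpecialLinearGroup (Fin 2) R

/-- A set of frames with the moves `t, u, s, e`, together with the light-cone vector
`(A, P, Q, C)` of each frame. -/
structure FrameSystem (X : Type*) where
  t : Equiv.Perm X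
  u : Equiv.Perm X
  s : X → X
  e : X → X
  base : X
  A : X → ℤ
  P : X → ℤ
  Q : X → ℤ
  C : X → ℤ
  s_s : ∀ x, s (s x) = x
  e_e : ∀ x, e (e x) = x
  t_u : ∀ x, t (u x) = u (t x)
  triangle : ∀ x, s (t (s (t (s (t x))))) = x
  square_et : ∀ x, e (t (e (t x))) = t.symm (e (t.symm (e x)))
  square_se : ∀ x, s (t (e (s x))) = e (t.symm x)
  square_sue : ∀ x, s (t (u (e (u.symm (s x))))) = u (e (u.symm (t.symm x)))
  cone : ∀ x, A x * C x = P x ^ 2 + 5 * Q x ^ 2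
  A_nonneg : ∀ x, 0 ≤ A x
  A_t : ∀ x, A (t x) = A x
  P_t : ∀ x, P (t x) = P x + A x
  Q_t : ∀ x, Q (t x) = Q x
  C_t : ∀ x, C (t x) = C x + 2 * P x + A x
  A_u : ∀ x, A (u x) = A x
  P_u : ∀ x, P (u x) = P x
  Q_u : ∀ x, Q (u x) = Q x + A x
  C_u : ∀ x, C (u x) = C x + 10 * Q x + 5 * A x
  A_s : ∀ x, A (s x) = C x
  P_s : ∀ x, P (s x) = - P x
  Q_s : ∀ x, Q (s x) = Q x
  C_s : ∀ x, C (s x) = A x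
  A_e : ∀ x, A (e x) = 3 * A x + 2 * C x + 2 * P x + 10 * Q x
  P_e : ∀ x, P (e x) = -2 * A x - 2 * P x - 5 * Q x - C x
  Q_e : ∀ x, Q (e x) = - A x - P x - 4 * Q x - C x
  C_e : ∀ x, C (e x) = 3 * A x + 3 * C x + 4 * P x + 10 * Q x
  A_base : A base = 0
  C_base : C base = 1

namespace FrameSystem

variable {X : Type*} (F : FrameSystem X)

/-- Every frame is obtained from the base frame by moves. -/
def Connected : Prop :=
  ∀ p : X → Prop, p F.base → (∀ x, p x ↔ p (F.t x)) → (∀ x, p x ↔ p (F.u x)) →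
    (∀ x, p x → p (F.s x)) → (∀ x, p x → p (F.e x)) → ∀ x, p x

/-- Translate a frame by `a + bω`. -/
def shift (a b : ℤ) (x : X) : X := (F.t ^ a) ((F.u ^ b) x)

lemma t_commute_u : Commute F.t F.u := by
  ext x; exact F.t_u x

lemma A_t_zpow (a : ℤ) (x : X) : F.A ((F.t ^ a) x) = F.A x ∧ F.P ((F.t ^ a) x) = F.P x + a * F.A x
    ∧ F.Q ((F.t ^ a) x) = F.Q x ∧
    F.C ((F.t ^ a) x) = F.C x + 2 * a * F.P x + a ^ 2 * F.A x := by
  induction a using Int.induction_on with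
  | zero => simp
  | succ i ih =>
    rw [zpow_add, zpow_one, (Commute.zpow_self F.t i).eq, Equiv.Perm.mul_apply]
    rw [F.A_t, F.P_t, F.Q_t, F.C_t]
    obtain ⟨h1, h2, h3, h4⟩ := ih
    rw [h1, h2, h3, h4]
    refine ⟨rfl, by ring, rfl, by ring⟩
  | pred i ih =>
    have e : (F.t ^ (-(i:ℤ))) x = F.t ((F.t ^ (-(i:ℤ) - 1)) x) := by
      rw [← Equiv.Perm.mul_apply, ← zpow_one_add]; congr 2; ring
    rw [e, F.A_t, F.P_t, F.Q_t, F.C_t] at ih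
    obtain ⟨h1, h2, h3, h4⟩ := ih
    refine ⟨h1, by rw [h1] at h2; linarith, h3, ?_⟩
    rw [h1] at h2 h4
    linear_combination h4 - 2 * h2

lemma A_u_zpow (b : ℤ) (x : X) : F.A ((F.u ^ b) x) = F.A x ∧ F.P ((F.u ^ b) x) = F.P x
    ∧ F.Q ((F.u ^ b) x) = F.Q x + b * F.A x ∧
    F.C ((F.u ^ b) x) = F.C x + 10 * b * F.Q x + 5 * b ^ 2 * F.A x := by
  induction b using Int.induction_on with
  | zero => simp
  | succ i ih =>
    rw [zpow_add, zpow_one, (Commute.zpow_self F.u i).eq, Equiv.Perm.mul_apply]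
    rw [F.A_u, F.P_u, F.Q_u, F.C_u]
    obtain ⟨h1, h2, h3, h4⟩ := ih
    rw [h1, h2, h3, h4]
    refine ⟨rfl, rfl, by ring, by ring⟩
  | pred i ih =>
    have e : (F.u ^ (-(i:ℤ))) x = F.u ((F.u ^ (-(i:ℤ) - 1)) x) := by
      rw [← Equiv.Perm.mul_apply, ← zpow_one_add]; congr 2; ring
    rw [e, F.A_u, F.P_u, F.Q_u, F.C_u] at ih
    obtain ⟨h1, h2, h3, h4⟩ := ih
    refine ⟨h1, h2, by rw [h1] at h3; linarith, ?_⟩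
    rw [h1] at h3 h4
    linear_combination h4 - 10 * h3

lemma A_shift (a b : ℤ) (x : X) : F.A (F.shift a b x) = F.A x := by
  rw [shift, (F.A_t_zpow _ _).1, (F.A_u_zpow _ _).1]

lemma P_shift (a b : ℤ) (x : X) : F.P (F.shift a b x) = F.P x + a * F.A x := by
  rw [shift, (F.A_t_zpow _ _).2.1, (F.A_u_zpow _ _).1, (F.A_u_zpow _ _).2.1]

lemma Q_shift (a b : ℤ) (x : X) : F.Q (F.shift a b x) = F.Q x + b * F.A x := by
  rw [shift, (F.A_t_zpow _ _).2.2.1, (F.A_u_zpow _ _).2.2.1]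

lemma shift_shift (a b a' b' : ℤ) (x : X) :
    F.shift a b (F.shift a' b' x) = F.shift (a + a') (b + b') x := by
  have := (F.t_commute_u.zpow_zpow a' b).eq
  simp only [shift, ← Equiv.Perm.mul_apply]
  congr 1
  calc F.t ^ a * F.u ^ b * F.t ^ a' * F.u ^ b' = F.t ^ a * (F.u ^ b * F.t ^ a') * F.u ^ b' := by
        simp only [mul_assoc]
    _ = _ := by rw [← this, zpow_add, zpow_add]; simp only [mul_assoc]

lemma shift_zero (x : X) : F.shift 0 0 x = x := by simp [shift]

lemma t_eq_shift (x : X) : F.t x = F.shift 1 0 x := by simp [shift]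
lemma u_eq_shift (x : X) : F.u x = F.shift 0 1 x := by simp [shift]
lemma t_symm_eq_shift (x : X) : F.t.symm x = F.shift (-1) 0 x := by
  simp [shift]
lemma u_symm_eq_shift (x : X) : F.u.symm x = F.shift 0 (-1) x := by
  simp [shift]

/-- Frames whose cusp is joined to the base cusp by a path of strictly increasing height. -/
inductive Reach : X → Prop
  | base : Reach F.base
  | shift (a b : ℤ) (x : X) : Reach x → Reach (F.shift a b x)
  | up_s (x : X) : Reach x → F.A x < F.A (F.s x) → Reach (F.s x)
  | up_e (x : X) : Reach x → F.A x < F.A (F.e x) → Reach (F.e x)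

variable {F}

lemma reach_shift_iff (a b : ℤ) (x : X) : F.Reach (F.shift a b x) ↔ F.Reach x := by
  refine ⟨fun h => ?_, .shift a b x⟩
  have := Reach.shift (-a) (-b) _ h
  rwa [shift_shift, neg_add_cancel, neg_add_cancel, shift_zero] at this

lemma reach_t (x : X) : F.Reach (F.t x) ↔ F.Reach x := by rw [t_eq_shift, reach_shift_iff]
lemma reach_u (x : X) : F.Reach (F.u x) ↔ F.Reach x := by rw [u_eq_shift, reach_shift_iff]

lemma A_t_symm (x : X) : F.A (F.t.symm x) = F.A x := by rw [t_symm_eq_shift, A_shift]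
lemma A_u_symm (x : X) : F.A (F.u.symm x) = F.A x := by rw [u_symm_eq_shift, A_shift]
lemma P_t_symm (x : X) : F.P (F.t.symm x) = F.P x - F.A x := by
  rw [t_symm_eq_shift, P_shift]; ring
lemma P_u_symm (x : X) : F.P (F.u.symm x) = F.P x := by rw [u_symm_eq_shift, P_shift]; ring
lemma Q_t_symm (x : X) : F.Q (F.t.symm x) = F.Q x := by rw [t_symm_eq_shift, Q_shift]; ring
lemma Q_u_symm (x : X) : F.Q (F.u.symm x) = F.Q x - F.A x := by
  rw [u_symm_eq_shift, Q_shift]; ring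
lemma C_t_symm (x : X) : F.C (F.t.symm x) = F.C x - 2 * F.P x + F.A x := by
  have h := F.C_t (F.t.symm x)
  rw [Equiv.apply_symm_apply, P_t_symm, A_t_symm] at h
  linarith
lemma C_u_symm (x : X) : F.C (F.u.symm x) = F.C x - 10 * F.Q x + 5 * F.A x := by
  have h := F.C_u (F.u.symm x)
  rw [Equiv.apply_symm_apply, Q_u_symm, A_u_symm] at h
  linarith

lemma reach_cases {x : X} (h : F.Reach x) : (∃ a b, x = F.shift a b F.base) ∨
    (∃ a b, F.A (F.s (F.shift a b x)) < F.A x ∧ F.Reach (F.s (F.shift a b x))) ∨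
    ∃ a b, F.A (F.e (F.shift a b x)) < F.A x ∧ F.Reach (F.e (F.shift a b x)) := by
  induction h with
  | base => exact .inl ⟨0, 0, (F.shift_zero _).symm⟩
  | shift a b x _ ih =>
    rcases ih with ⟨a', b', h⟩ | ⟨a', b', h⟩ | ⟨a', b', h⟩
    · exact .inl ⟨a + a', b + b', by rw [h, shift_shift]⟩
    · refine .inr (.inl ⟨a' - a, b' - b, ?_⟩)
      simpa [shift_shift, A_shift] using h
    · refine .inr (.inr ⟨a' - a, b' - b, ?_⟩)
      simpa [shift_shift, A_shift] using h
  | up_s x hx hlt _ =>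
    refine .inr (.inl ⟨0, 0, ?_⟩)
    rw [shift_zero, F.s_s]
    exact ⟨hlt, hx⟩
  | up_e x hx hlt _ =>
    refine .inr (.inr ⟨0, 0, ?_⟩)
    rw [shift_zero, F.e_e]
    exact ⟨hlt, hx⟩

/-- Two frames whose cusps are joined by an edge. -/
def Nb (F : FrameSystem X) (y z : X) : Prop :=
  ∃ a b a' b', F.shift a' b' z = F.s (F.shift a b y) ∨ F.shift a' b' z = F.e (F.shift a b y)

lemma Nb.symm {y z : X} (h : F.Nb y z) : F.Nb z y := by
  obtain ⟨a, b, a', b', h | h⟩ := h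
  · exact ⟨a', b', a, b, .inl (by rw [h, F.s_s])⟩
  · exact ⟨a', b', a, b, .inr (by rw [h, F.e_e])⟩

lemma nb_s (y : X) : F.Nb y (F.s y) := ⟨0, 0, 0, 0, .inl (by simp only [shift_zero])⟩
lemma nb_e (y : X) : F.Nb y (F.e y) := ⟨0, 0, 0, 0, .inr (by simp only [shift_zero])⟩

lemma nb_shift_left (a b : ℤ) {y z : X} : F.Nb (F.shift a b y) z ↔ F.Nb y z := by
  constructor
  · rintro ⟨c, d, c', d', h⟩
    exact ⟨c + a, d + b, c', d', by rwa [shift_shift] at h⟩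
  · rintro ⟨c, d, c', d', h⟩
    exact ⟨c - a, d - b, c', d', by rwa [shift_shift, sub_add_cancel, sub_add_cancel]⟩

lemma nb_shift_right (a b : ℤ) {y z : X} : F.Nb y (F.shift a b z) ↔ F.Nb y z := by
  rw [show F.Nb y (F.shift a b z) ↔ F.Nb (F.shift a b z) y from ⟨.symm, .symm⟩, nb_shift_left]
  exact ⟨.symm, .symm⟩

lemma Reach.up {y z : X} (hy : F.Reach y) (h : F.Nb y z) (hlt : F.A y < F.A z) : F.Reach z := by
  obtain ⟨a, b, a', b', h | h⟩ := h
  · rw [← reach_shift_iff a' b', h]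
    refine .up_s _ (.shift _ _ _ hy) ?_
    rwa [← h, A_shift, A_shift]
  · rw [← reach_shift_iff a' b', h]
    refine .up_e _ (.shift _ _ _ hy) ?_
    rwa [← h, A_shift, A_shift]

/-- Two neighbours `y`, `z` of `x` that span with `x` a triangle or a square. -/
def Span (F : FrameSystem X) (x y z : X) : Prop :=
  F.Nb y z ∨ ∃ v, F.Nb y v ∧ F.Nb z v ∧ F.A v + F.A x = F.A y + F.A z

lemma Span.symm {x y z : X} (h : F.Span x y z) : F.Span x z y := by
  rcases h with h | ⟨v, h1, h2, h3⟩
  · exact .inl h.symm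
  · exact .inr ⟨v, h2, h1, by linarith⟩

lemma span_tri (x : X) : F.Span x (F.s x) (F.s (F.t x)) := by
  left
  have key : F.s (F.t.symm (F.s x)) = F.t (F.s (F.t x)) := by
    have := F.triangle x
    rw [← this, F.s_s, Equiv.symm_apply_apply, F.s_s, this]
  have := F.nb_s (F.t.symm (F.s x))
  rwa [key, t_symm_eq_shift, t_eq_shift, nb_shift_left, nb_shift_right] at this

lemma nb_t_left {y z : X} : F.Nb (F.t y) z ↔ F.Nb y z := by rw [t_eq_shift, nb_shift_left]
lemma nb_u_left {y z : X} : F.Nb (F.u y) z ↔ F.Nb y z := by rw [u_eq_shift, nb_shift_left]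
lemma nb_t_symm_left {y z : X} : F.Nb (F.t.symm y) z ↔ F.Nb y z := by
  rw [t_symm_eq_shift, nb_shift_left]
lemma nb_u_symm_left {y z : X} : F.Nb (F.u.symm y) z ↔ F.Nb y z := by
  rw [u_symm_eq_shift, nb_shift_left]
lemma nb_t_right {y z : X} : F.Nb y (F.t z) ↔ F.Nb y z := by rw [t_eq_shift, nb_shift_right]
lemma nb_u_right {y z : X} : F.Nb y (F.u z) ↔ F.Nb y z := by rw [u_eq_shift, nb_shift_right]
lemma nb_t_symm_right {y z : X} : F.Nb y (F.t.symm z) ↔ F.Nb y z := by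
  rw [t_symm_eq_shift, nb_shift_right]

lemma span_et (x : X) : F.Span x (F.e x) (F.e (F.t.symm x)) := by
  refine .inr ⟨F.e (F.t (F.e x)), ?_, ?_, ?_⟩
  · rw [← nb_t_left]
    exact nb_e _
  · have h := F.square_et (F.t.symm x)
    rw [Equiv.apply_symm_apply] at h
    rw [h, nb_t_symm_right, ← nb_t_symm_left]
    exact nb_e _
  · simp only [F.A_e, F.A_t, F.P_e, F.P_t, F.Q_e, F.Q_t, F.C_e, F.C_t, A_t_symm, P_t_symm,
      Q_t_symm, C_t_symm]
    ring

lemma span_se (x : X) : F.Span x (F.s x) (F.e x) := by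
  refine .inr ⟨F.e (F.t.symm (F.s x)), ?_, ?_, ?_⟩
  · rw [← nb_t_symm_left]
    exact nb_e _
  · have h := F.square_se (F.s x)
    rw [F.s_s] at h
    rw [← h, ← nb_t_left]
    exact nb_s _
  · simp only [F.A_e, F.A_s, F.P_s, F.Q_s, F.C_s, A_t_symm, P_t_symm, Q_t_symm, C_t_symm]
    ring

lemma span_ste (x : X) : F.Span x (F.s x) (F.e (F.t.symm x)) := by
  refine .inr ⟨F.e (F.s x), nb_e _, ?_, ?_⟩
  · have h := F.square_se x
    rw [← h, ← nb_t_right]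
    exact (nb_s _).symm
  · simp only [F.A_e, F.A_s, F.P_s, F.Q_s, F.C_s, A_t_symm, P_t_symm, Q_t_symm, C_t_symm]
    ring

lemma span_sute (x : X) : F.Span x (F.s x) (F.e (F.u.symm (F.t.symm x))) := by
  refine .inr ⟨F.e (F.u.symm (F.s x)), ?_, ?_, ?_⟩
  · rw [← nb_u_symm_left]
    exact nb_e _
  · have h := F.square_sue x
    rw [← nb_u_left, ← h, ← nb_u_right, ← nb_t_right]
    exact (nb_s _).symm
  · simp only [F.A_e, F.A_s, F.P_s, F.Q_s, F.C_s, A_t_symm, P_t_symm, Q_t_symm, C_t_symm,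
      A_u_symm, P_u_symm, Q_u_symm, C_u_symm]
    ring

lemma span_sue (x : X) : F.Span x (F.s x) (F.e (F.u.symm x)) := by
  refine .inr ⟨F.e (F.u.symm (F.t.symm (F.s x))), ?_, ?_, ?_⟩
  · rw [← nb_t_symm_left, ← nb_u_symm_left]
    exact nb_e _
  · have h := F.square_sue (F.s x)
    rw [F.s_s] at h
    rw [← nb_u_right, ← h, ← nb_u_left, ← nb_t_left]
    exact nb_s _
  · simp only [F.A_e, F.A_s, F.P_s, F.Q_s, F.C_s, A_t_symm, P_t_symm, Q_t_symm, C_t_symm,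
      A_u_symm, P_u_symm, Q_u_symm, C_u_symm]
    ring

lemma span_shift (a b : ℤ) {x y z : X} : F.Span (F.shift a b x) y z ↔ F.Span x y z := by
  simp only [Span, A_shift]

/-- Reachability is constant along edges of height below `n`. -/
def EdgeInv (F : FrameSystem X) (n : ℤ) : Prop :=
  ∀ y z, F.Nb y z → F.A y < n → F.A z < n → (F.Reach y ↔ F.Reach z)

lemma Span.reach_iff {x y z : X} (h : F.Span x y z) (hE : F.EdgeInv (F.A x))
    (hy : F.A y < F.A x) (hz : F.A z < F.A x) : F.Reach y ↔ F.Reach z := by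
  rcases h with h | ⟨v, h1, h2, h3⟩
  · exact hE _ _ h hy hz
  · rw [hE y v h1 hy (by linarith), hE z v h2 hz (by linarith)]

lemma Span.reach_of_tie {x y z : X} (h : F.Span x y z) (hE : F.EdgeInv (F.A x))
    (hy : F.A y < F.A x) (hz : F.A z = F.A x) (hr : F.Reach y) : F.Reach z := by
  rcases h with h | ⟨v, h1, h2, h3⟩
  · exact hr.up h (by linarith)
  · exact ((hE y v h1 hy (by linarith)).1 hr).up h2.symm (by linarith)

lemma A_mul_A_s (a b : ℤ) (x : X) : F.A x * F.A (F.s (F.shift a b x)) =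
    (F.P x + a * F.A x) ^ 2 + 5 * (F.Q x + b * F.A x) ^ 2 := by
  have h := F.cone (F.shift a b x)
  rwa [A_shift, P_shift, Q_shift, ← F.A_s] at h

lemma A_mul_A_e (a b : ℤ) (x : X) : 2 * (F.A x * F.A (F.e (F.shift a b x))) =
    (2 * (F.P x + a * F.A x) + F.A x) ^ 2 + 5 * (2 * (F.Q x + b * F.A x) + F.A x) ^ 2 := by
  have h := F.cone (F.shift a b x)
  rw [F.A_e]
  rw [A_shift, P_shift, Q_shift] at *
  linear_combination 4 * h

lemma row_connected {L R : ℤ → Prop} {c : ℤ} (step : ∀ a, L a → L (a + 1) → (R a ↔ R (a + 1)))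
    (right : ∀ a, c ≤ a → L (a + 1) → L a) (left : ∀ a, a < c → L a → L (a + 1)) (a : ℤ)
    (ha : L a) : L c ∧ (R a ↔ R c) := by
  rcases le_total c a with h | h
  · obtain ⟨k, rfl⟩ := Int.le.dest h
    clear h
    induction k with
    | zero => simpa using ha
    | succ k ih =>
      have h1 : c + ((k + 1 : ℕ) : ℤ) = c + k + 1 := by push_cast; ring
      rw [h1] at ha ⊢
      have h2 := right _ (by omega) ha
      rw [← step _ h2 ha]
      exact ih h2
  · obtain ⟨k, hk⟩ := Int.le.dest h
    obtain rfl : a = c - k := by omega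
    clear h hk
    induction k with
    | zero => simpa using ha
    | succ k ih =>
      have h1 : c - (k : ℤ) = c - ((k + 1 : ℕ) : ℤ) + 1 := by push_cast; ring
      have h2 := left _ (by push_cast; omega) ha
      rw [step _ ha h2]
      rw [← h1] at h2 ⊢
      exact ih h2

lemma span_s_s (a b : ℤ) (x : X) :
    F.Span x (F.s (F.shift a b x)) (F.s (F.shift (a + 1) b x)) := by
  have := span_tri (F := F) (F.shift a b x)
  rwa [t_eq_shift, shift_shift, span_shift, zero_add, add_comm 1 a] at this

lemma span_e_e (a b : ℤ) (x : X) :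
    F.Span x (F.e (F.shift a b x)) (F.e (F.shift (a + 1) b x)) := by
  have := (span_et (F := F) (F.shift (a + 1) b x)).symm
  rw [t_symm_eq_shift, shift_shift, span_shift, zero_add] at this
  simpa using this

lemma span_s_e {a b a' b' : ℤ} (x : X) (ha : a' = a ∨ a' = a - 1) (hb : b' = b ∨ b' = b - 1) :
    F.Span x (F.s (F.shift a b x)) (F.e (F.shift a' b' x)) := by
  rw [← span_shift a b]
  rcases ha with rfl | rfl <;> rcases hb with rfl | rfl
  · exact span_se _
  · have := span_sue (F := F) (F.shift a' b x)
    rwa [u_symm_eq_shift, shift_shift, zero_add, neg_add_eq_sub] at this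
  · have := span_ste (F := F) (F.shift a b' x)
    rwa [t_symm_eq_shift, shift_shift, zero_add, neg_add_eq_sub] at this
  · have := span_sute (F := F) (F.shift a b x)
    rwa [t_symm_eq_shift, u_symm_eq_shift, shift_shift, shift_shift, zero_add, add_zero,
      neg_add_eq_sub, neg_add_eq_sub] at this

lemma exists_center (P : ℤ) {N : ℤ} (hN : 0 < N) : ∃ c : ℤ, -N ≤ 2 * (P + c * N) ∧
    2 * (P + c * N) < N := by
  refine ⟨-((2 * P + N) / (2 * N)), ?_, ?_⟩
  · have := Int.ediv_mul_le (2 * P + N) (b := 2 * N) (by omega)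
    linarith
  · have := Int.lt_ediv_add_one_mul_self (2 * P + N) (b := 2 * N) (by omega)
    linarith

section Link

variable {x : X}

lemma s_row (hx : 0 < F.A x) (hE : F.EdgeInv (F.A x)) {c : ℤ} (h1 : -F.A x ≤ 2 * (F.P x + c * F.A x))
    (h2 : 2 * (F.P x + c * F.A x) < F.A x) (a b : ℤ) (ha : F.A (F.s (F.shift a b x)) < F.A x) :
    F.A (F.s (F.shift c b x)) < F.A x ∧
      (F.Reach (F.s (F.shift a b x)) ↔ F.Reach (F.s (F.shift c b x))) := by
  refine row_connected (L := fun a => F.A (F.s (F.shift a b x)) < F.A x)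
    (R := fun a => F.Reach (F.s (F.shift a b x)))
    (fun a h h' => (span_s_s a b x).reach_iff hE h h') (fun a hc h => ?_) (fun a hc h => ?_) a ha
  · refine lt_of_le_of_lt ?_ h
    refine le_of_mul_le_mul_left ?_ hx
    rw [A_mul_A_s, A_mul_A_s]
    have : c * F.A x ≤ a * F.A x := by gcongr
    nlinarith
  · refine lt_of_le_of_lt ?_ h
    refine le_of_mul_le_mul_left ?_ hx
    rw [A_mul_A_s, A_mul_A_s]
    have : (a + 1) * F.A x ≤ c * F.A x := by gcongr; omega
    nlinarith

lemma e_row (hx : 0 < F.A x) (hE : F.EdgeInv (F.A x)) {c : ℤ}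
    (h1 : -F.A x ≤ 2 * (F.P x + c * F.A x) + F.A x)
    (h2 : 2 * (F.P x + c * F.A x) + F.A x ≤ F.A x) (a b : ℤ)
    (ha : F.A (F.e (F.shift a b x)) < F.A x) :
    F.A (F.e (F.shift c b x)) < F.A x ∧
      (F.Reach (F.e (F.shift a b x)) ↔ F.Reach (F.e (F.shift c b x))) := by
  refine row_connected (L := fun a => F.A (F.e (F.shift a b x)) < F.A x)
    (R := fun a => F.Reach (F.e (F.shift a b x)))
    (fun a h h' => (span_e_e a b x).reach_iff hE h h') (fun a hc h => ?_) (fun a hc h => ?_) a ha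
  · refine lt_of_le_of_lt ?_ h
    refine le_of_mul_le_mul_left (a := 2 * F.A x) ?_ (by omega)
    rw [mul_assoc, mul_assoc, A_mul_A_e, A_mul_A_e]
    have : c * F.A x ≤ a * F.A x := by gcongr
    nlinarith
  · refine lt_of_le_of_lt ?_ h
    refine le_of_mul_le_mul_left (a := 2 * F.A x) ?_ (by omega)
    rw [mul_assoc, mul_assoc, A_mul_A_e, A_mul_A_e]
    have : (a + 1) * F.A x ≤ c * F.A x := by gcongr; omega
    nlinarith

lemma s_lower_bound (hx : 0 < F.A x) {a b : ℤ} (h : F.A (F.s (F.shift a b x)) < F.A x) :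
    |20 * (F.Q x + b * F.A x)| < 9 * F.A x := by
  have := A_mul_A_s (F := F) a b x
  have h' := mul_lt_mul_of_pos_left h hx
  apply abs_lt_of_sq_lt_sq _ (by omega)
  nlinarith [sq_nonneg (F.P x + a * F.A x), sq_nonneg (F.Q x + b * F.A x)]

lemma e_lower_bound (hx : 0 < F.A x) {a b : ℤ} (h : F.A (F.e (F.shift a b x)) < F.A x) :
    |3 * (2 * (F.Q x + b * F.A x) + F.A x)| < 2 * F.A x := by
  have := A_mul_A_e (F := F) a b x
  have h' := mul_lt_mul_of_pos_left h hx
  apply abs_lt_of_sq_lt_sq _ (by omega)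
  nlinarith [sq_nonneg (2 * (F.P x + a * F.A x) + F.A x),
    sq_nonneg (2 * (F.Q x + b * F.A x) + F.A x)]

lemma eq_of_mul_lt {N d : ℤ} (hN : 0 < N) {k l : ℤ} (h1 : k * N < d * N) (h2 : d * N < l * N) :
    k < d ∧ d < l :=
  ⟨lt_of_mul_lt_mul_right h1 hN.le, lt_of_mul_lt_mul_right h2 hN.le⟩

lemma s_s_iff (hx : 0 < F.A x) (hE : F.EdgeInv (F.A x)) {a b a' b' : ℤ}
    (h : F.A (F.s (F.shift a b x)) < F.A x) (h' : F.A (F.s (F.shift a' b' x)) < F.A x) :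
    F.Reach (F.s (F.shift a b x)) ↔ F.Reach (F.s (F.shift a' b' x)) := by
  have hb := abs_lt.1 (s_lower_bound hx h)
  have hb' := abs_lt.1 (s_lower_bound hx h')
  obtain ⟨h1, h2⟩ := eq_of_mul_lt hx (k := -1) (d := b - b') (l := 1) (by linarith) (by linarith)
  obtain rfl : b = b' := by omega
  obtain ⟨c, hc1, hc2⟩ := exists_center (F.P x) hx
  rw [(s_row hx hE hc1 hc2 _ _ h).2, (s_row hx hE hc1 hc2 _ _ h').2]

lemma e_e_iff (hx : 0 < F.A x) (hE : F.EdgeInv (F.A x)) {a b a' b' : ℤ}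
    (h : F.A (F.e (F.shift a b x)) < F.A x) (h' : F.A (F.e (F.shift a' b' x)) < F.A x) :
    F.Reach (F.e (F.shift a b x)) ↔ F.Reach (F.e (F.shift a' b' x)) := by
  have hb := abs_lt.1 (e_lower_bound hx h)
  have hb' := abs_lt.1 (e_lower_bound hx h')
  obtain ⟨h1, h2⟩ := eq_of_mul_lt hx (k := -1) (d := b - b') (l := 1) (by linarith) (by linarith)
  obtain rfl : b = b' := by omega
  obtain ⟨c, hc1, hc2⟩ := exists_center (F.P x + F.P x + F.A x) (N := 2 * F.A x) (by omega)
  rw [(e_row hx hE (by linarith) (by linarith) _ _ h).2,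
    (e_row hx hE (c := c) (by linarith) (by linarith) _ _ h').2]

lemma s_e_iff (hx : 0 < F.A x) (hE : F.EdgeInv (F.A x)) {a b a' b' : ℤ}
    (h : F.A (F.s (F.shift a b x)) < F.A x) (h' : F.A (F.e (F.shift a' b' x)) < F.A x) :
    F.Reach (F.s (F.shift a b x)) ↔ F.Reach (F.e (F.shift a' b' x)) := by
  have hb := abs_lt.1 (s_lower_bound hx h)
  have hb' := abs_lt.1 (e_lower_bound hx h')
  obtain ⟨h1, h2⟩ := eq_of_mul_lt hx (k := -3) (d := 2 * (b' - b) + 1) (l := 3)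
    (by linarith) (by linarith)
  obtain ⟨c, hc1, hc2⟩ := exists_center (F.P x) hx
  obtain ⟨c', hc, hc1', hc2'⟩ : ∃ c', (c' = c ∨ c' = c - 1) ∧
      -F.A x ≤ 2 * (F.P x + c' * F.A x) + F.A x ∧ 2 * (F.P x + c' * F.A x) + F.A x ≤ F.A x := by
    rcases le_total (F.P x + c * F.A x) 0 with h | h
    · exact ⟨c, .inl rfl, by linarith, by linarith⟩
    · exact ⟨c - 1, .inr rfl, by linarith, by linarith⟩
  have hs := s_row hx hE hc1 hc2 _ _ h
  have he := e_row hx hE hc1' hc2' _ _ h'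
  rw [hs.2, he.2]
  exact (span_s_e x hc (by omega)).reach_iff hE hs.1 he.1

/-- The frame `y` is a standard representative of a neighbour of `x`. -/
def IsNb (F : FrameSystem X) (x y : X) : Prop :=
  ∃ a b, y = F.s (F.shift a b x) ∨ y = F.e (F.shift a b x)

lemma lower_iff (hx : 0 < F.A x) (hE : F.EdgeInv (F.A x)) {y z : X} (hy : F.IsNb x y)
    (hz : F.IsNb x z) (h : F.A y < F.A x) (h' : F.A z < F.A x) : F.Reach y ↔ F.Reach z := by
  obtain ⟨a, b, rfl | rfl⟩ := hy <;> obtain ⟨a', b', rfl | rfl⟩ := hz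
  · exact s_s_iff hx hE h h'
  · exact s_e_iff hx hE h h'
  · exact (s_e_iff hx hE h' h).symm
  · exact e_e_iff hx hE h h'

lemma tie_span (hx : 0 < F.A x) {z : X} (hz : F.IsNb x z) (h : F.A z = F.A x) :
    ∃ y, F.IsNb x y ∧ F.A y < F.A x ∧ F.Span x y z := by
  obtain ⟨a, b, rfl | rfl⟩ := hz
  · have key := A_mul_A_s (F := F) a b x
    rw [h] at key
    by_cases h1 : F.A x < 2 * (F.P x + a * F.A x)
    · refine ⟨_, ⟨a - 1, b, .inl rfl⟩, ?_, ?_⟩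
      · refine lt_of_mul_lt_mul_left ?_ hx.le
        rw [A_mul_A_s]
        nlinarith
      · simpa using (span_s_s (F := F) (a - 1) b x)
    by_cases h2 : 2 * (F.P x + a * F.A x) < -F.A x
    · refine ⟨_, ⟨a + 1, b, .inl rfl⟩, ?_, ?_⟩
      · refine lt_of_mul_lt_mul_left ?_ hx.le
        rw [A_mul_A_s]
        nlinarith
      · exact (span_s_s (F := F) a b x).symm
    obtain ⟨a', ha, ha1⟩ : ∃ a', (a' = a ∨ a' = a - 1) ∧
        (2 * (F.P x + a' * F.A x) + F.A x) ^ 2 ≤ F.A x ^ 2 := by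
      rcases le_total (F.P x + a * F.A x) 0 with h | h
      · refine ⟨a, .inl rfl, ?_⟩
        apply sq_le_sq'  <;> linarith
      · refine ⟨a - 1, .inr rfl, ?_⟩
        apply sq_le_sq'  <;> linarith
    obtain ⟨b', hb, hb1⟩ : ∃ b', (b' = b ∨ b' = b - 1) ∧
        16 * (2 * (F.Q x + b' * F.A x) + F.A x) ^ 2 ≤ F.A x ^ 2 := by
      have h3 : (2 * (F.P x + a * F.A x)) ^ 2 ≤ F.A x ^ 2 := by
        apply sq_le_sq' <;> linarith
      have h4 : (3 * F.A x) ^ 2 ≤ (8 * (F.Q x + b * F.A x)) ^ 2 := by nlinarith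
      have h5 : (20 * (F.Q x + b * F.A x)) ^ 2 ≤ (9 * F.A x) ^ 2 := by nlinarith
      obtain ⟨h6, h7⟩ := abs_le.1 (abs_le_of_sq_le_sq h5 (by omega))
      rcases le_total (F.Q x + b * F.A x) 0 with h | h
      · have h4 := (abs_le.1 (abs_le_of_sq_le_sq (h4.trans_eq (neg_sq _).symm) (by omega))).2
        refine ⟨b, .inl rfl, ?_⟩
        rw [show (16 : ℤ) = 4 ^ 2 by norm_num, ← mul_pow]
        apply sq_le_sq' <;> linarith
      · have h4 := (abs_le.1 (abs_le_of_sq_le_sq h4 (by omega))).2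
        refine ⟨b - 1, .inr rfl, ?_⟩
        rw [show (16 : ℤ) = 4 ^ 2 by norm_num, ← mul_pow]
        apply sq_le_sq' <;> linarith
    refine ⟨_, ⟨a', b', .inr rfl⟩, ?_, (span_s_e x ha hb).symm⟩
    refine lt_of_mul_lt_mul_left (a := 2 * F.A x) ?_ (by omega)
    rw [mul_assoc, A_mul_A_e]
    nlinarith
  · have key := A_mul_A_e (F := F) a b x
    rw [h] at key
    by_cases h1 : F.A x < 2 * (F.P x + a * F.A x) + F.A x
    · refine ⟨_, ⟨a - 1, b, .inr rfl⟩, ?_, ?_⟩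
      · refine lt_of_mul_lt_mul_left (a := 2 * F.A x) ?_ (by omega)
        rw [mul_assoc, A_mul_A_e]
        nlinarith
      · simpa using (span_e_e (F := F) (a - 1) b x)
    by_cases h2 : 2 * (F.P x + a * F.A x) + F.A x < -F.A x
    · refine ⟨_, ⟨a + 1, b, .inr rfl⟩, ?_, ?_⟩
      · refine lt_of_mul_lt_mul_left (a := 2 * F.A x) ?_ (by omega)
        rw [mul_assoc, A_mul_A_e]
        nlinarith
      · exact (span_e_e (F := F) a b x).symm
    obtain ⟨a', ha, ha1⟩ : ∃ a', (a = a' ∨ a = a' - 1) ∧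
        (2 * (F.P x + a' * F.A x)) ^ 2 ≤ F.A x ^ 2 := by
      rcases le_total (2 * (F.P x + a * F.A x) + F.A x) 0 with h | h
      · refine ⟨a + 1, .inr (by omega), ?_⟩
        apply sq_le_sq'  <;> linarith
      · refine ⟨a, .inl rfl, ?_⟩
        apply sq_le_sq'  <;> linarith
    obtain ⟨b', hb, hb1⟩ : ∃ b', (b = b' ∨ b = b' - 1) ∧
        100 * (F.Q x + b' * F.A x) ^ 2 ≤ 9 * F.A x ^ 2 := by
      have h3 : (2 * (F.P x + a * F.A x) + F.A x) ^ 2 ≤ F.A x ^ 2 := by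
        apply sq_le_sq' <;> linarith
      have h4 : (2 * F.A x) ^ 2 ≤ (5 * (2 * (F.Q x + b * F.A x) + F.A x)) ^ 2 := by nlinarith
      have h5 : (3 * (2 * (F.Q x + b * F.A x) + F.A x)) ^ 2 ≤ (2 * F.A x) ^ 2 := by nlinarith
      obtain ⟨h6, h7⟩ := abs_le.1 (abs_le_of_sq_le_sq h5 (by omega))
      rcases le_total (2 * (F.Q x + b * F.A x) + F.A x) 0 with h | h
      · have h4 := (abs_le.1 (abs_le_of_sq_le_sq (h4.trans_eq (neg_sq _).symm) (by omega))).2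
        refine ⟨b + 1, .inr (by omega), ?_⟩
        rw [show (100 : ℤ) = 10 ^ 2 by norm_num, show (9 : ℤ) = 3 ^ 2 by norm_num, ← mul_pow,
          ← mul_pow]
        apply sq_le_sq' <;> linarith
      · have h4 := (abs_le.1 (abs_le_of_sq_le_sq h4 (by omega))).2
        refine ⟨b, .inl rfl, ?_⟩
        rw [show (100 : ℤ) = 10 ^ 2 by norm_num, show (9 : ℤ) = 3 ^ 2 by norm_num, ← mul_pow,
          ← mul_pow]
        apply sq_le_sq' <;> linarith
    refine ⟨_, ⟨a', b', .inl rfl⟩, ?_, span_s_e x ha hb⟩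
    refine lt_of_mul_lt_mul_left ?_ hx.le
    rw [A_mul_A_s]
    nlinarith

end Link

lemma vector_ne_zero (hF : F.Connected) (x : X) : ¬ (F.A x = 0 ∧ F.P x = 0 ∧ F.Q x = 0 ∧ F.C x = 0) := by
  refine hF (fun x => ¬ (F.A x = 0 ∧ F.P x = 0 ∧ F.Q x = 0 ∧ F.C x = 0))
    (by simp [F.C_base]) (fun x => not_congr ?_) (fun x => not_congr ?_)
    (fun x => mt ?_) (fun x => mt ?_) x
  · rw [F.A_t, F.P_t, F.Q_t, F.C_t]; omega
  · rw [F.A_u, F.P_u, F.Q_u, F.C_u]; omega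
  · rw [F.A_s, F.P_s, F.Q_s, F.C_s]; omega
  · rw [F.A_e, F.P_e, F.Q_e, F.C_e]; omega

lemma Nb.exists_isNb {y z : X} (h : F.Nb y z) : ∃ a b, F.IsNb y (F.shift a b z) := by
  obtain ⟨a, b, a', b', h⟩ := h
  exact ⟨a', b', a, b, h⟩

lemma not_both_zero (hF : F.Connected) {y z : X} (h : F.Nb y z) (hy : F.A y = 0) : F.A z ≠ 0 := by
  obtain ⟨a, b, hz⟩ := h.exists_isNb
  rw [← F.A_shift a b]
  intro h0
  obtain ⟨a', b', hz⟩ := hz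
  have hc := F.cone (F.shift a' b' y)
  rw [A_shift, hy, zero_mul] at hc
  have hP : F.P (F.shift a' b' y) = 0 := by nlinarith [sq_nonneg (F.Q (F.shift a' b' y))]
  have hQ : F.Q (F.shift a' b' y) = 0 := by nlinarith [sq_nonneg (F.P (F.shift a' b' y))]
  refine vector_ne_zero hF (F.shift a' b' y) ⟨by rw [A_shift, hy], hP, hQ, ?_⟩
  rcases hz with hz | hz
  · rwa [hz, F.A_s] at h0
  · rw [hz, F.A_e, A_shift, hy, hP, hQ] at h0
    omega

lemma edgeInv (hF : F.Connected) (n : ℕ) : F.EdgeInv n := by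
  induction n with
  | zero => exact fun y z _ h => absurd (F.A_nonneg y) (by simpa using h)
  | succ n ih =>
    suffices H : ∀ y z, F.Nb y z → F.A y < (n + 1 : ℕ) → F.A z < (n + 1 : ℕ) →
        F.Reach y → F.Reach z from fun y z h h1 h2 => ⟨H y z h h1 h2, H z y h.symm h2 h1⟩
    intro y z hyz hy hz hr
    push_cast at hy hz
    have lower : ∀ v, F.IsNb y v → F.A y = n → F.A v < F.A y → F.Reach v := by
      intro v hv hyn hlt
      have hpos : 0 < F.A y := lt_of_le_of_lt (F.A_nonneg v) hlt
      have hE : F.EdgeInv (F.A y) := hyn ▸ ih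
      rcases reach_cases hr with ⟨a, b, h⟩ | ⟨a, b, h, h'⟩ | ⟨a, b, h, h'⟩
      · rw [h, A_shift, F.A_base] at hpos
        exact absurd hpos (lt_irrefl _)
      · exact (lower_iff hpos hE ⟨a, b, .inl rfl⟩ hv h hlt).1 h'
      · exact (lower_iff hpos hE ⟨a, b, .inr rfl⟩ hv h hlt).1 h'
    rcases lt_trichotomy (F.A y) (F.A z) with h | h | h
    · exact hr.up hyz h
    · by_cases hn : F.A y < n
      · exact (ih y z hyz hn (h ▸ hn)).1 hr
      have hyn : F.A y = n := by omega
      have hpos : 0 < F.A y := by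
        rcases (F.A_nonneg y).lt_or_eq with h0 | h0
        · exact h0
        · exact absurd (h.symm.trans h0.symm) (not_both_zero hF hyz h0.symm)
      obtain ⟨a, b, hab⟩ := hyz.exists_isNb
      have hE : F.EdgeInv (F.A y) := hyn ▸ ih
      have hz' : F.A (F.shift a b z) = F.A y := by rw [A_shift, h]
      obtain ⟨v, hv, hlt, hs⟩ := tie_span hpos hab hz'
      exact (reach_shift_iff a b z).1 (hs.reach_of_tie hE hlt hz' (lower v hv hyn hlt))
    · by_cases hn : F.A y < n
      · exact (ih y z hyz hn (h.trans hn)).1 hr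
      obtain ⟨a, b, hab⟩ := hyz.exists_isNb
      rw [← reach_shift_iff a b]
      exact lower _ hab (by omega) (by rwa [A_shift])

lemma reach_of_nb (hF : F.Connected) {y z : X} (h : F.Nb y z) (hy : F.Reach y) : F.Reach z := by
  obtain ⟨n, hn⟩ : ∃ n : ℕ, F.A y < n ∧ F.A z < n :=
    ⟨(F.A y + F.A z + 1).toNat, by have := F.A_nonneg y; have := F.A_nonneg z; omega⟩
  exact (edgeInv hF n y z h hn.1 hn.2).1 hy

lemma reach_all (hF : F.Connected) (x : X) : F.Reach x :=
  hF _ .base (fun x => (reach_t x).symm) (fun x => (reach_u x).symm)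
    (fun _ => reach_of_nb hF (nb_s _)) (fun _ => reach_of_nb hF (nb_e _)) x

/-- The cusp at infinity is covered exactly once. -/
theorem eq_shift_of_A_eq_zero (hF : F.Connected) {x : X} (h : F.A x = 0) : ∃ a b, x = F.shift a b F.base := by
  rcases reach_cases (reach_all hF x) with h' | ⟨a, b, h', -⟩ | ⟨a, b, h', -⟩
  · exact h'
  all_goals exact absurd (h ▸ h') (F.A_nonneg _).not_gt

lemma exists_lower {x : X} (hx : 0 < F.A x) : ∃ a b, F.A (F.s (F.shift a b x)) < F.A x ∨
    F.A (F.e (F.shift a b x)) < F.A x := by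
  obtain ⟨a, ha1, ha2⟩ := exists_center (F.P x) hx
  obtain ⟨b, hb1, hb2⟩ := exists_center (F.Q x) hx
  have h3 : (2 * (F.P x + a * F.A x)) ^ 2 ≤ F.A x ^ 2 := by
    apply sq_le_sq' <;> linarith
  by_cases h : (8 * (F.Q x + b * F.A x)) ^ 2 < (3 * F.A x) ^ 2
  · refine ⟨a, b, .inl (lt_of_mul_lt_mul_left ?_ hx.le)⟩
    rw [A_mul_A_s]
    nlinarith
  push Not at h
  obtain ⟨a', ha⟩ : ∃ a', (2 * (F.P x + a' * F.A x) + F.A x) ^ 2 ≤ F.A x ^ 2 := by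
    rcases le_total (F.P x + a * F.A x) 0 with h | h
    · refine ⟨a, ?_⟩
      apply sq_le_sq' <;> linarith
    · refine ⟨a - 1, ?_⟩
      apply sq_le_sq' <;> linarith
  obtain ⟨b', hb⟩ : ∃ b', 16 * (2 * (F.Q x + b' * F.A x) + F.A x) ^ 2 ≤ F.A x ^ 2 := by
    rcases le_total (F.Q x + b * F.A x) 0 with h0 | h0
    · have h4 := (abs_le.1 (abs_le_of_sq_le_sq (h.trans_eq (neg_sq _).symm) (by omega))).2
      refine ⟨b, ?_⟩
      rw [show (16 : ℤ) = 4 ^ 2 by norm_num, ← mul_pow]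
      apply sq_le_sq' <;> linarith
    · have h4 := (abs_le.1 (abs_le_of_sq_le_sq h (by omega))).2
      refine ⟨b - 1, ?_⟩
      rw [show (16 : ℤ) = 4 ^ 2 by norm_num, ← mul_pow]
      apply sq_le_sq' <;> linarith
  refine ⟨a', b', .inr (lt_of_mul_lt_mul_left (a := 2 * F.A x) ?_ (by omega))⟩
  rw [mul_assoc, A_mul_A_e]
  nlinarith

/-- A set of frames that contains the frames of height zero and is stable under moves is everything. -/
theorem descent (p : X → Prop) (h0 : ∀ x, F.A x = 0 → p x) (ht : ∀ x, p (F.t x) ↔ p x)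
    (hu : ∀ x, p (F.u x) ↔ p x) (hs : ∀ x, p (F.s x) → p x) (he : ∀ x, p (F.e x) → p x) (x : X) :
    p x := by
  have ht' : ∀ (a : ℤ) x, p ((F.t ^ a) x) ↔ p x := fun a => by
    induction a using Int.induction_on with
    | zero => simp
    | succ i ih => intro x; rw [zpow_add, zpow_one, Equiv.Perm.mul_apply, ih, ht]
    | pred i ih =>
      intro x
      rw [zpow_sub, zpow_one, Equiv.Perm.mul_apply, ih, ← ht, ← Equiv.Perm.mul_apply,
        mul_inv_cancel, Equiv.Perm.one_apply]
  have hu' : ∀ (a : ℤ) x, p ((F.u ^ a) x) ↔ p x := fun a => by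
    induction a using Int.induction_on with
    | zero => simp
    | succ i ih => intro x; rw [zpow_add, zpow_one, Equiv.Perm.mul_apply, ih, hu]
    | pred i ih =>
      intro x
      rw [zpow_sub, zpow_one, Equiv.Perm.mul_apply, ih, ← hu, ← Equiv.Perm.mul_apply,
        mul_inv_cancel, Equiv.Perm.one_apply]
  have hsh : ∀ a b x, p (F.shift a b x) → p x := fun a b x h => by
    rwa [shift, ht', hu'] at h
  obtain ⟨n, hn⟩ : ∃ n : ℕ, F.A x ≤ n := ⟨(F.A x).toNat, Int.self_le_toNat _⟩
  induction n generalizing x with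
  | zero => exact h0 x (le_antisymm (by simpa using hn) (F.A_nonneg x))
  | succ n ih =>
    rcases (F.A_nonneg x).eq_or_lt with h | h
    · exact h0 x h.symm
    obtain ⟨a, b, h | h⟩ := exists_lower h
    · exact hsh a b x (hs _ (ih _ (by push_cast at hn; omega)))
    · exact hsh a b x (he _ (ih _ (by push_cast at hn; omega)))

end FrameSystem

/-- The defining relations of `PSL₂(ℤ[√-5])` in the generators `S, r, b, U, V`. -/
structure BianchiRel {H : Type*} [Group H] (S r b U V : H) : Prop where
  S_S : S * S = 1
  r_r : r * r = 1
  b_b : b * b * b = 1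
  r_S : r * S = S * r
  b_U : S * b * U = U * (S * b)
  V_b : V * b = b * V
  V_W : V * (r * S) = U⁻¹ * r * U * S * V

namespace BianchiRel

variable {H : Type*} [Group H] {S r b U V : H}

lemma map (h : BianchiRel S r b U V) {H' : Type*} [Group H'] (f : H →* H') :
    BianchiRel (f S) (f r) (f b) (f U) (f V) where
  S_S := by rw [← map_mul, h.S_S, map_one]
  r_r := by rw [← map_mul, h.r_r, map_one]
  b_b := by rw [← map_mul, ← map_mul, h.b_b, map_one]
  r_S := by rw [← map_mul, h.r_S, map_mul]
  b_U := by rw [← map_mul, ← map_mul, h.b_U, map_mul, map_mul]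
  V_b := by rw [← map_mul, h.V_b, map_mul]
  V_W := by simp only [← map_mul, ← map_inv, h.V_W]

lemma S_inv (h : BianchiRel S r b U V) : S⁻¹ = S := inv_eq_of_mul_eq_one_left h.S_S
lemma r_inv (h : BianchiRel S r b U V) : r⁻¹ = r := inv_eq_of_mul_eq_one_left h.r_r
lemma S_S_mul (h : BianchiRel S r b U V) (x : H) : S * (S * x) = x := by rw [← mul_assoc, h.S_S, one_mul]
lemma r_r_mul (h : BianchiRel S r b U V) (x : H) : r * (r * x) = x := by rw [← mul_assoc, h.r_r, one_mul]
lemma S_r_mul (h : BianchiRel S r b U V) (x : H) : S * (r * x) = r * (S * x) := by rw [← mul_assoc, ← h.r_S, mul_assoc]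
lemma b_b' (h : BianchiRel S r b U V) : b * (b * b) = 1 := by rw [← mul_assoc, h.b_b]
lemma b_b_mul (h : BianchiRel S r b U V) (x : H) : b * (b * (b * x)) = x := by
  rw [← mul_assoc, ← mul_assoc, h.b_b, one_mul]
lemma b_inv (h : BianchiRel S r b U V) : b⁻¹ = b * b := inv_eq_of_mul_eq_one_left h.b_b

lemma T_U (h : BianchiRel S r b U V) : b⁻¹ * S * U = U * (b⁻¹ * S) := by
  have := (show Commute (S * b) U from h.b_U).inv_left
  rwa [mul_inv_rev, h.S_inv] at this

lemma T1_U1 (h : BianchiRel S r b U V) : r * S * b * (U * V) = U * V * (r * S * b) := by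
  calc r * S * b * (U * V) = r * (S * b * U) * V := by simp only [mul_assoc]
    _ = r * U * S * (b * V) := by rw [h.b_U]; simp only [mul_assoc]
    _ = U * (U⁻¹ * r * U * S * V) * b := by rw [← h.V_b]; simp only [mul_assoc, mul_inv_cancel_left]
    _ = _ := by rw [← h.V_W]; simp only [mul_assoc]

end BianchiRel

namespace Bianchi

section LightVector

open Zsqrtd

/-- The light-cone vector of the bottom row of a matrix. -/
def lightA (g : Matrix.SpecialLinearGroup (Fin 2) (ℤ√(-5))) : ℤ := (g 1 0).norm
def lightP (g : Matrix.SpecialLinearGroup (Fin 2) (ℤ√(-5))) : ℤ := (g 1 1 * star (g 1 0)).re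
def lightQ (g : Matrix.SpecialLinearGroup (Fin 2) (ℤ√(-5))) : ℤ := (g 1 1 * star (g 1 0)).im
def lightC (g : Matrix.SpecialLinearGroup (Fin 2) (ℤ√(-5))) : ℤ := (g 1 1).norm

/-- The light-cone vector on `PSL₂`. -/
def light (p : PSL2 (ℤ√(-5))) : ℤ × ℤ × ℤ × ℤ :=
  Quotient.liftOn' p (fun g => (lightA g, lightP g, lightQ g, lightC g)) (by
    intro g g' h
    rw [QuotientGroup.leftRel_apply, Matrix.SpecialLinearGroup.mem_center_iff] at h
    obtain ⟨z, hz, hg⟩ := h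
    have hz : z * z = 1 := by simpa [pow_two] using hz
    have hn : z.norm = 1 := by
      have := congrArg Zsqrtd.norm hz
      rw [Zsqrtd.norm_mul, Zsqrtd.norm_one] at this
      nlinarith [Zsqrtd.norm_nonneg (d := -5) (by norm_num) z]
    have hs : z * star z = 1 := by
      rw [← Zsqrtd.norm_eq_mul_conj, hn]; rfl
    have h0 : g' = g * (g⁻¹ * g') := by simp
    have e : ∀ i j, g' i j = g i j * z := by
      intro i j
      rw [h0, Matrix.SpecialLinearGroup.coe_mul, ← hg, Matrix.scalar_apply,
        Matrix.mul_diagonal]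
    have h2 : g' 1 1 * star (g' 1 0) = g 1 1 * star (g 1 0) := by
      rw [e, e, star_mul]
      linear_combination g 1 1 * star (g 1 0) * hs
    simp only [lightA, lightP, lightQ, lightC, h2]
    rw [e 1 0, e 1 1, Zsqrtd.norm_mul, Zsqrtd.norm_mul, hn, mul_one, mul_one])


lemma light_mk (g : Matrix.SpecialLinearGroup (Fin 2) (ℤ√(-5))) :
    light (QuotientGroup.mk g) = (lightA g, lightP g, lightQ g, lightC g) := rfl

lemma mul_entry (g m : Matrix.SpecialLinearGroup (Fin 2) (ℤ√(-5))) (i j : Fin 2) :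
    (g * m) i j = g i 0 * m 0 j + g i 1 * m 1 j := by
  change (g.1 * m.1) i j = _
  rw [Matrix.mul_apply, Fin.sum_univ_two]

/-- The matrix generators. -/
def matS : Matrix.SpecialLinearGroup (Fin 2) (ℤ√(-5)) := ⟨!![0, -1; 1, 0], by simp⟩
def matR : Matrix.SpecialLinearGroup (Fin 2) (ℤ√(-5)) :=
  ⟨!![⟨0, 1⟩, 2; 2, ⟨0, -1⟩], by rw [Matrix.det_fin_two_of]; decide⟩
def matB : Matrix.SpecialLinearGroup (Fin 2) (ℤ√(-5)) := ⟨!![0, -1; 1, -1], by simp⟩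
def matU : Matrix.SpecialLinearGroup (Fin 2) (ℤ√(-5)) := ⟨!![1, ⟨0, 1⟩; 0, 1], by simp⟩
def matV : Matrix.SpecialLinearGroup (Fin 2) (ℤ√(-5)) :=
  ⟨!![⟨4, 1⟩, ⟨0, -2⟩; ⟨0, 2⟩, ⟨4, -1⟩], by rw [Matrix.det_fin_two_of]; decide⟩

/-- The action of a matrix on light-cone vectors, computed on matrices. -/
lemma light_mul_mk (m : Matrix.SpecialLinearGroup (Fin 2) (ℤ√(-5))) (v : ℤ × ℤ × ℤ × ℤ → ℤ × ℤ × ℤ × ℤ)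
    (h : ∀ g : Matrix.SpecialLinearGroup (Fin 2) (ℤ√(-5)), light (QuotientGroup.mk (g * m)) = v (light (QuotientGroup.mk g)))
    (p : PSL2 (ℤ√(-5))) : light (p * QuotientGroup.mk m) = v (light p) := by
  induction p using QuotientGroup.induction_on with
  | H g => rw [← QuotientGroup.mk_mul, h]

lemma light_S (p : PSL2 (ℤ√(-5))) : light (p * QuotientGroup.mk matS) =
    ((light p).2.2.2, -(light p).2.1, (light p).2.2.1, (light p).1) := by
  refine light_mul_mk _ (fun v => (v.2.2.2, -v.2.1, v.2.2.1, v.1)) (fun g => ?_) p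
  simp only [light_mk, lightA, lightP, lightQ, lightC, mul_entry]
  simp [matS, Zsqrtd.norm_def]
  constructor <;> ring

lemma light_R (p : PSL2 (ℤ√(-5))) : light (p * QuotientGroup.mk matR) =
    (5 * (light p).1 + 20 * (light p).2.2.1 + 4 * (light p).2.2.2, -(light p).2.1,
      -2 * (light p).1 - 9 * (light p).2.2.1 - 2 * (light p).2.2.2,
      4 * (light p).1 + 20 * (light p).2.2.1 + 5 * (light p).2.2.2) := by
  refine light_mul_mk _ (fun v => (5 * v.1 + 20 * v.2.2.1 + 4 * v.2.2.2, -v.2.1,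
      -2 * v.1 - 9 * v.2.2.1 - 2 * v.2.2.2, 4 * v.1 + 20 * v.2.2.1 + 5 * v.2.2.2))
      (fun g => ?_) p
  simp only [light_mk, lightA, lightP, lightQ, lightC, mul_entry]
  simp [matR, Zsqrtd.norm_def]
  refine ⟨?_, ?_, ?_, ?_⟩ <;> ring

lemma light_B (p : PSL2 (ℤ√(-5))) : light (p * QuotientGroup.mk matB) =
    ((light p).2.2.2, -(light p).2.1 - (light p).2.2.2, (light p).2.2.1,
      (light p).1 + 2 * (light p).2.1 + (light p).2.2.2) := by
  refine light_mul_mk _ (fun v => (v.2.2.2, -v.2.1 - v.2.2.2, v.2.2.1,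
    v.1 + 2 * v.2.1 + v.2.2.2)) (fun g => ?_) p
  simp only [light_mk, lightA, lightP, lightQ, lightC, mul_entry]
  simp [matB, Zsqrtd.norm_def]
  refine ⟨?_, ?_, ?_⟩ <;> ring

lemma light_U (p : PSL2 (ℤ√(-5))) : light (p * QuotientGroup.mk matU) =
    ((light p).1, (light p).2.1, (light p).2.2.1 + (light p).1,
      (light p).2.2.2 + 10 * (light p).2.2.1 + 5 * (light p).1) := by
  refine light_mul_mk _ (fun v => (v.1, v.2.1, v.2.2.1 + v.1,
      v.2.2.2 + 10 * v.2.2.1 + 5 * v.1)) (fun g => ?_) p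
  simp only [light_mk, lightA, lightP, lightQ, lightC, mul_entry]
  simp [matU, Zsqrtd.norm_def]
  refine ⟨?_, ?_, ?_⟩ <;> ring

lemma light_V (p : PSL2 (ℤ√(-5))) : light (p * QuotientGroup.mk matV) =
    (21 * (light p).1 + 20 * (light p).2.1 - 80 * (light p).2.2.1 + 20 * (light p).2.2.2,
     -10 * (light p).1 - 9 * (light p).2.1 + 40 * (light p).2.2.1 - 10 * (light p).2.2.2,
     -8 * (light p).1 - 8 * (light p).2.1 + 31 * (light p).2.2.1 - 8 * (light p).2.2.2,
     20 * (light p).1 + 20 * (light p).2.1 - 80 * (light p).2.2.1 + 21 * (light p).2.2.2) := by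
  refine light_mul_mk _ (fun v =>
    (21 * v.1 + 20 * v.2.1 - 80 * v.2.2.1 + 20 * v.2.2.2,
     -10 * v.1 - 9 * v.2.1 + 40 * v.2.2.1 - 10 * v.2.2.2,
     -8 * v.1 - 8 * v.2.1 + 31 * v.2.2.1 - 8 * v.2.2.2,
     20 * v.1 + 20 * v.2.1 - 80 * v.2.2.1 + 21 * v.2.2.2)) (fun g => ?_) p
  simp only [light_mk, lightA, lightP, lightQ, lightC, mul_entry]
  simp [matV, Zsqrtd.norm_def]
  refine ⟨?_, ?_, ?_, ?_⟩ <;> ring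

lemma light_cone (p : PSL2 (ℤ√(-5))) :
    (light p).1 * (light p).2.2.2 = (light p).2.1 ^ 2 + 5 * (light p).2.2.1 ^ 2 := by
  induction p using QuotientGroup.induction_on with
  | H g => simp [light_mk, lightA, lightP, lightQ, lightC, Zsqrtd.norm_def]; ring

lemma light_nonneg (p : PSL2 (ℤ√(-5))) : 0 ≤ (light p).1 := by
  induction p using QuotientGroup.induction_on with
  | H g => exact Zsqrtd.norm_nonneg (by norm_num) _

lemma light_norm (g : Matrix.SpecialLinearGroup (Fin 2) (ℤ√(-5))) :
    2 * (3 * (light (QuotientGroup.mk g)).1 + 2 * (light (QuotientGroup.mk g)).2.2.2 +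
      2 * (light (QuotientGroup.mk g)).2.1 + 10 * (light (QuotientGroup.mk g)).2.2.1) =
    (⟨1, 1⟩ * g 1 0 + 2 * g 1 1).norm := by
  simp [light_mk, lightA, lightP, lightQ, lightC, Zsqrtd.norm_def]; ring

lemma light_nonneg' (p : PSL2 (ℤ√(-5))) :
    0 ≤ 3 * (light p).1 + 2 * (light p).2.2.2 + 2 * (light p).2.1 + 10 * (light p).2.2.1 := by
  induction p using QuotientGroup.induction_on with
  | H g =>
    have h1 := light_norm g
    have h2 := Zsqrtd.norm_nonneg (d := -5) (by norm_num) (⟨1, 1⟩ * g 1 0 + 2 * g 1 1)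
    omega

lemma light_one : light 1 = (0, 0, 0, 1) := by
  change light (QuotientGroup.mk 1) = _
  rw [light_mk]
  simp [lightA, lightP, lightQ, lightC, Zsqrtd.norm_def]

lemma mk_eq_of_neg {g g' : Matrix.SpecialLinearGroup (Fin 2) (ℤ√(-5))} (h : g' = -g) :
    (QuotientGroup.mk g : PSL2 (ℤ√(-5))) = QuotientGroup.mk g' := by
  rw [QuotientGroup.eq, h, Subgroup.mem_center_iff]
  intro k
  simp

lemma matRel : BianchiRel (QuotientGroup.mk matS : PSL2 (ℤ√(-5))) (QuotientGroup.mk matR)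
    (QuotientGroup.mk matB) (QuotientGroup.mk matU) (QuotientGroup.mk matV) where
  S_S := mk_eq_of_neg (g := matS * matS) (g' := 1) (by decide)
  r_r := mk_eq_of_neg (g := matR * matR) (g' := 1) (by decide)
  b_b := congrArg QuotientGroup.mk (show matB * matB * matB = 1 by decide)
  r_S := mk_eq_of_neg (g := matR * matS) (g' := matS * matR) (by decide)
  b_U := congrArg QuotientGroup.mk (show matS * matB * matU = matU * (matS * matB) by decide)
  V_b := congrArg QuotientGroup.mk (show matV * matB = matB * matV by decide)
  V_W := congrArg QuotientGroup.mk
    (show matV * (matR * matS) = matU⁻¹ * matR * matU * matS * matV by decide)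

end LightVector

section Frames

variable {H : Type*} [Group H]

/-- Right multiplication on one of the two sheets of frames. -/
def sheetMul (x y : H) : Equiv.Perm (H × Bool) where
  toFun g := (g.1 * cond g.2 y x, g.2)
  invFun g := (g.1 * (cond g.2 y x)⁻¹, g.2)
  left_inv g := by simp
  right_inv g := by simp

variable {S r b U V : H} (h : BianchiRel S r b U V) (π : H →* PSL2 (ℤ√(-5)))
  (hS : π S = QuotientGroup.mk matS) (hr : π r = QuotientGroup.mk matR)
  (hb : π b = QuotientGroup.mk matB) (hU : π U = QuotientGroup.mk matU)
  (hV : π V = QuotientGroup.mk matV)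

/-- The frames of a group mapping to `PSL₂(ℤ[√-5])` on which the relations hold. -/
def frames : FrameSystem (H × Bool) where
  t := sheetMul (b * b * S) (r * S * b)
  u := sheetMul U (U * V)
  s := sheetMul S (b * b * r * S * b)
  e x := (x.1, !x.2)
  base := (1, false)
  A x := cond x.2 (3 * (light (π x.1)).1 + 2 * (light (π x.1)).2.2.2 + 2 * (light (π x.1)).2.1 +
    10 * (light (π x.1)).2.2.1) (light (π x.1)).1
  P x := cond x.2 (-2 * (light (π x.1)).1 - 2 * (light (π x.1)).2.1 - 5 * (light (π x.1)).2.2.1 -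
    (light (π x.1)).2.2.2) (light (π x.1)).2.1
  Q x := cond x.2 (- (light (π x.1)).1 - (light (π x.1)).2.1 - 4 * (light (π x.1)).2.2.1 -
    (light (π x.1)).2.2.2) (light (π x.1)).2.2.1
  C x := cond x.2 (3 * (light (π x.1)).1 + 3 * (light (π x.1)).2.2.2 + 4 * (light (π x.1)).2.1 +
    10 * (light (π x.1)).2.2.1) (light (π x.1)).2.2.2
  s_s := by
    rintro ⟨g, _ | _⟩ <;>
    simp [sheetMul, mul_assoc, h.S_S, h.S_S_mul, h.r_r_mul, h.S_r_mul, h.b_b', h.b_b_mul]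
  e_e := by rintro ⟨g, _ | _⟩ <;> rfl
  t_u := by
    have h1 := h.T_U
    have h2 := h.T1_U1
    rw [h.b_inv] at h1
    rintro ⟨g, _ | _⟩
    · simp [sheetMul, mul_assoc] at h1 ⊢
      rw [h1]
    · simp [sheetMul, mul_assoc] at h2 ⊢
      rw [h2]
  triangle := by
    rintro ⟨g, _ | _⟩ <;>
    simp [sheetMul, mul_assoc, h.S_S, h.S_S_mul, h.r_r_mul, h.S_r_mul, h.b_b', h.b_b_mul]
  square_et := by
    rintro ⟨g, _ | _⟩ <;>
    simp [sheetMul, mul_assoc, h.S_S, h.S_S_mul, h.r_r_mul, h.S_r_mul, h.b_b', h.b_b_mul, h.S_inv,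
      h.r_inv, h.b_inv]
  square_se := by
    rintro ⟨g, _ | _⟩ <;>
    simp [sheetMul, mul_assoc, h.S_S, h.S_S_mul, h.r_r_mul, h.S_r_mul, h.b_b', h.b_b_mul, h.S_inv,
      h.r_inv, h.b_inv, h.r_S]
  square_sue := by
    have h1 : V⁻¹ * b = b * V⁻¹ := ((show Commute V b from h.V_b).inv_left).eq
    have h2 : ∀ x, V⁻¹ * (b * x) = b * (V⁻¹ * x) := fun x => by
      rw [← mul_assoc, h1, mul_assoc]
    rintro ⟨g, _ | _⟩
    · simp [sheetMul, mul_assoc, h.S_S, h.S_S_mul, h.r_r_mul, h.S_r_mul, h.b_b', h.b_b_mul,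
        h.S_inv, h.r_inv, h.b_inv, h.V_b]
    · simp [sheetMul, mul_assoc, h.S_S, h.S_S_mul, h.r_r_mul, h.S_r_mul, h.b_b', h.b_b_mul,
        h.S_inv, h.r_inv, h.b_inv, h1, h2]
  cone := by
    rintro ⟨g, _ | _⟩ <;> have := light_cone (π g) <;> dsimp <;> linear_combination this
  A_nonneg := by
    rintro ⟨g, _ | _⟩
    · exact light_nonneg _
    · exact light_nonneg' _
  A_t := by
    rintro ⟨g, _ | _⟩ <;>
    simp [sheetMul, hS, hr, hb, ← mul_assoc, light_S, light_B, light_R] <;> ring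
  P_t := by
    rintro ⟨g, _ | _⟩ <;>
    simp [sheetMul, hS, hr, hb, ← mul_assoc, light_S, light_B, light_R] <;> ring
  Q_t := by
    rintro ⟨g, _ | _⟩ <;>
    simp [sheetMul, hS, hr, hb, ← mul_assoc, light_S, light_B, light_R] <;> ring
  C_t := by
    rintro ⟨g, _ | _⟩ <;>
    simp [sheetMul, hS, hr, hb, ← mul_assoc, light_S, light_B, light_R] <;> ring
  A_u := by
    rintro ⟨g, _ | _⟩ <;> simp [sheetMul, hU, hV, ← mul_assoc, light_U, light_V] <;> ring
  P_u := by
    rintro ⟨g, _ | _⟩ <;> simp [sheetMul, hU, hV, ← mul_assoc, light_U, light_V] <;> ring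
  Q_u := by
    rintro ⟨g, _ | _⟩ <;> simp [sheetMul, hU, hV, ← mul_assoc, light_U, light_V] <;> ring
  C_u := by
    rintro ⟨g, _ | _⟩ <;> simp [sheetMul, hU, hV, ← mul_assoc, light_U, light_V] <;> ring
  A_s := by
    rintro ⟨g, _ | _⟩ <;>
    simp [sheetMul, hS, hr, hb, ← mul_assoc, light_S, light_B, light_R] <;> ring
  P_s := by
    rintro ⟨g, _ | _⟩ <;>
    simp [sheetMul, hS, hr, hb, ← mul_assoc, light_S, light_B, light_R] <;> ring
  Q_s := by
    rintro ⟨g, _ | _⟩ <;>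
    simp [sheetMul, hS, hr, hb, ← mul_assoc, light_S, light_B, light_R] <;> ring
  C_s := by
    rintro ⟨g, _ | _⟩ <;>
    simp [sheetMul, hS, hr, hb, ← mul_assoc, light_S, light_B, light_R] <;> ring
  A_e := by rintro ⟨g, _ | _⟩ <;> simp <;> ring
  P_e := by rintro ⟨g, _ | _⟩ <;> simp <;> ring
  Q_e := by rintro ⟨g, _ | _⟩ <;> simp <;> ring
  C_e := by rintro ⟨g, _ | _⟩ <;> simp <;> ring
  A_base := by simp [light_one]
  C_base := by simp [light_one]

end Frames

end Bianchi

namespace Bianchi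

/-- Upper unipotent matrices. -/
def unip (z : ℤ√(-5)) : Matrix.SpecialLinearGroup (Fin 2) (ℤ√(-5)) := ⟨!![1, z; 0, 1], by simp⟩

lemma unip_mul (z w : ℤ√(-5)) : unip z * unip w = unip (z + w) := by
  refine Subtype.ext (Matrix.ext fun i j => ?_)
  change (unip z * unip w) i j = _
  rw [mul_entry]
  fin_cases i <;> fin_cases j <;> simp [unip, add_comm]

/-- Upper unipotent matrices, as a homomorphism. -/
def unipHom : Multiplicative (ℤ√(-5)) →* Matrix.SpecialLinearGroup (Fin 2) (ℤ√(-5)) where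
  toFun z := unip z.toAdd
  map_one' := by
    refine Subtype.ext (Matrix.ext fun i j => ?_)
    fin_cases i <;> fin_cases j <;> rfl
  map_mul' z w := (unip_mul _ _).symm

lemma matU_zpow_mul (a c : ℤ) : matU ^ c * (matB * matB * matS) ^ a = unip ⟨a, c⟩ := by
  have hU : matU = unipHom (Multiplicative.ofAdd ⟨0, 1⟩) := rfl
  have hT : matB * matB * matS = unipHom (Multiplicative.ofAdd 1) := by decide
  rw [hU, hT, ← map_zpow unipHom, ← map_zpow unipHom, ← map_mul, ← ofAdd_zsmul, ← ofAdd_zsmul, ← ofAdd_add]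
  change unip _ = _
  congr 1
  apply Zsqrtd.ext <;> simp [toAdd_ofAdd]

lemma unip_mk_eq_one {z : ℤ√(-5)} (h : (QuotientGroup.mk (unip z) : PSL2 (ℤ√(-5))) = 1) :
    z = 0 := by
  rw [QuotientGroup.eq_one_iff, Matrix.SpecialLinearGroup.mem_center_iff] at h
  obtain ⟨w, -, hw⟩ := h
  have := congrFun (congrFun hw 0) 1
  simpa [unip] using this.symm

section Frames

variable {H : Type*} [Group H]
variable {S r b U V : H} (h : BianchiRel S r b U V) (π : H →* PSL2 (ℤ√(-5)))
  (hS : π S = QuotientGroup.mk matS) (hr : π r = QuotientGroup.mk matR)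
  (hb : π b = QuotientGroup.mk matB) (hU : π U = QuotientGroup.mk matU)
  (hV : π V = QuotientGroup.mk matV)

lemma frames_connected (hgen : Subgroup.closure {S, r, b, U, V} = ⊤) :
    (frames h π hS hr hb hU hV).Connected := by
  intro p h0 ht hu hs he
  have he' : ∀ g, p (g, false) ↔ p (g, true) := fun g => ⟨he (g, false), he (g, true)⟩
  let N : Subgroup H :=
    { carrier := {k | ∀ g, p (g, false) ↔ p (g * k, false)}
      one_mem' := fun g => by rw [mul_one]
      mul_mem' := fun {k l} hk hl g => by rw [hk, hl, mul_assoc]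
      inv_mem' := fun {k} hk g => by rw [hk (g * k⁻¹), inv_mul_cancel_right] }
  have hSN : S ∈ N := fun g => by
    refine ⟨hs (g, false), fun hg => ?_⟩
    have := hs (g * S, false) hg
    simpa [frames, sheetMul, mul_assoc, h.S_S] using this
  have hTN : b * b * S ∈ N := fun g => ht (g, false)
  have hUN : U ∈ N := fun g => hu (g, false)
  have hT1 : r * S * b ∈ N := fun g => by
    rw [he', he']; exact ht (g, true)
  have hU1 : U * V ∈ N := fun g => by
    rw [he', he']; exact hu (g, true)
  have hVN : V ∈ N := (N.mul_mem_cancel_left hUN).1 hU1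
  have hbb : b * b ∈ N := (N.mul_mem_cancel_right hSN).1 hTN
  have hbN : b ∈ N := by
    have := N.inv_mem hbb
    rwa [← h.b_inv, inv_inv] at this
  have hrN : r ∈ N := (N.mul_mem_cancel_right hSN).1 ((N.mul_mem_cancel_right hbN).1 hT1)
  have hN : N = ⊤ := by
    rw [eq_top_iff, ← hgen, Subgroup.closure_le]
    rintro x (rfl | rfl | rfl | rfl | rfl) <;> assumption
  have key : ∀ g, p (g, false) := fun g => by
    have : g ∈ N := hN ▸ Subgroup.mem_top g
    have := (this 1).1 h0
    rwa [one_mul] at this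
  rintro ⟨g, _ | _⟩
  · exact key g
  · exact (he' g).1 (key g)

theorem injective_of_closure (h : BianchiRel S r b U V) (hS : π S = QuotientGroup.mk matS)
    (hr : π r = QuotientGroup.mk matR) (hb : π b = QuotientGroup.mk matB)
    (hU : π U = QuotientGroup.mk matU) (hV : π V = QuotientGroup.mk matV)
    (hgen : Subgroup.closure {S, r, b, U, V} = ⊤) :
    Function.Injective π := by
  rw [injective_iff_map_eq_one]
  intro g hg
  obtain ⟨a, c, hac⟩ := (frames h π hS hr hb hU hV).eq_shift_of_A_eq_zero
    (frames_connected h π hS hr hb hU hV hgen) (x := (g, false)) (by simp [frames, hg, light_one])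
  have hz : ∀ (x y : H) (n : ℤ) (k : H), (sheetMul x y ^ n) (k, false) = (k * x ^ n, false) := by
    intro x y n k
    induction n using Int.induction_on generalizing k with
    | zero => simp
    | succ i ih => rw [zpow_add_one, Equiv.Perm.mul_apply]; simp [sheetMul] at ih ⊢; rw [ih, add_comm, zpow_add, mul_assoc]; simp
    | pred i ih =>
      rw [zpow_sub_one, Equiv.Perm.mul_apply]
      change (sheetMul x y ^ (-(i : ℤ))) (k * x⁻¹, false) = _
      rw [ih, sub_eq_neg_add, zpow_add, zpow_neg_one, mul_assoc]
  have hg' : g = U ^ c * (b * b * S) ^ a := by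
    have := congrArg Prod.fst hac
    simpa [FrameSystem.shift, frames, hz] using this
  have h1 : (QuotientGroup.mk (unip ⟨a, c⟩) : PSL2 (ℤ√(-5))) = 1 := by
    rw [← hg, hg', ← matU_zpow_mul]
    simp [hU, hb, hS]
  have h2 := unip_mk_eq_one h1
  rw [Zsqrtd.ext_iff] at h2
  obtain ⟨rfl, rfl⟩ := h2
  simpa using hg'

end Frames

lemma norm_two (k : ℤ√(-5)) : k.norm ≠ 2 := by
  intro hk
  rw [Zsqrtd.norm_def] at hk
  have h1 : k.im = 0 := by
    by_contra h0
    have : 1 ≤ k.im * k.im := by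
      have := mul_self_pos.2 h0
      omega
    nlinarith [mul_self_nonneg k.re]
  rw [h1] at hk
  have : k.re ≤ 1 := by nlinarith
  have : -1 ≤ k.re := by nlinarith
  interval_cases k.re <;> omega

lemma eq_one_or_neg_one_of_norm {k : ℤ√(-5)} (hk : k.norm = 1) : k = 1 ∨ k = -1 := by
  rw [Zsqrtd.norm_def] at hk
  have h1 : k.im = 0 := by
    by_contra h0
    have : 1 ≤ k.im * k.im := by
      have := mul_self_pos.2 h0
      omega
    nlinarith [mul_self_nonneg k.re]
  rw [h1] at hk
  have h2 : k.re = 1 ∨ k.re = -1 := by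
    have : (k.re - 1) * (k.re + 1) = 0 := by linarith
    rcases mul_eq_zero.1 this with h | h <;> omega
  rcases h2 with h | h
  · left; apply Zsqrtd.ext <;> simp [h, h1]
  · right; apply Zsqrtd.ext <;> simp [h, h1]


lemma exists_unip_of_lower_zero (g : Matrix.SpecialLinearGroup (Fin 2) (ℤ√(-5))) (h : g 1 0 = 0) :
    ∃ z, (QuotientGroup.mk g : PSL2 (ℤ√(-5))) = QuotientGroup.mk (unip z) := by
  have hdet := g.det_coe
  rw [Matrix.det_fin_two, h, mul_zero, sub_zero] at hdet
  have hn := congrArg Zsqrtd.norm hdet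
  rw [Zsqrtd.norm_mul, Zsqrtd.norm_one] at hn
  have hn1 : (g 1 1).norm = 1 := by
    have h0 := Zsqrtd.norm_nonneg (d := -5) (by norm_num) (g 0 0)
    have h1 := Zsqrtd.norm_nonneg (d := -5) (by norm_num) (g 1 1)
    rcases Int.eq_one_or_neg_one_of_mul_eq_one' hn with h | h <;> omega
  rcases eq_one_or_neg_one_of_norm hn1 with h1 | h1
  · refine ⟨g 0 1, congrArg _ (Subtype.ext (Matrix.ext fun i j => ?_))⟩
    rw [h1, mul_one] at hdet
    fin_cases i <;> fin_cases j <;> simp [unip, h, h1, hdet]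
  · refine ⟨-g 0 1, mk_eq_of_neg (Subtype.ext (Matrix.ext fun i j => ?_))⟩
    rw [h1] at hdet
    have h00 : g 0 0 = -1 := by linear_combination -hdet
    fin_cases i <;> fin_cases j <;> simp [unip, h, h1, h00]

lemma second_cusp (g : Matrix.SpecialLinearGroup (Fin 2) (ℤ√(-5))) :
    ⟨1, 1⟩ * g 1 0 + 2 * g 1 1 ≠ 0 := by
  intro h
  have hdet := g.det_coe
  rw [Matrix.det_fin_two] at hdet
  set k : ℤ√(-5) := ⟨1, 1⟩ * g 0 0 + 2 * g 0 1 with hk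
  have h1 : g 1 1 * k = ⟨1, 1⟩ := by rw [hk]; linear_combination ⟨1, 1⟩ * hdet + g 0 1 * h
  have h2 : g 1 0 * k = -2 := by rw [hk]; linear_combination -2 * hdet + g 0 0 * h
  have n1 := congrArg Zsqrtd.norm h1
  have n2 := congrArg Zsqrtd.norm h2
  rw [Zsqrtd.norm_mul] at n1 n2
  have e1 : (⟨1, 1⟩ : ℤ√(-5)).norm = 6 := rfl
  have e2 : (-2 : ℤ√(-5)).norm = 4 := rfl
  rw [e1] at n1
  rw [e2] at n2
  have hd : k.norm ∣ 2 := by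
    have a1 : k.norm ∣ 6 := Dvd.intro_left _ n1
    have a2 : k.norm ∣ 4 := Dvd.intro_left _ n2
    exact (by norm_num : (6 - 4 : ℤ) = 2) ▸ dvd_sub a1 a2
  have hk0 := Zsqrtd.norm_nonneg (d := -5) (by norm_num) k
  have hle := Int.le_of_dvd (by norm_num) hd
  have hkk : k.norm = 1 := by
    have := norm_two k
    have h0 : k.norm ≠ 0 := by rintro h0; rw [h0] at n1; omega
    omega
  have p1 := congrArg Zsqrtd.re hk
  have p2 := congrArg Zsqrtd.im hk
  simp at p1 p2
  rcases eq_one_or_neg_one_of_norm hkk with h3 | h3 <;> rw [h3] at p1 p2 <;> simp at p1 p2 <;>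
    omega

section Surjective

variable {H : Type*} [Group H] {S r b U V : H} (π : H →* PSL2 (ℤ√(-5)))

theorem surjective_of_generators (hS : π S = QuotientGroup.mk matS)
    (hr : π r = QuotientGroup.mk matR) (hb : π b = QuotientGroup.mk matB)
    (hU : π U = QuotientGroup.mk matU) (hV : π V = QuotientGroup.mk matV) : Function.Surjective π := by
  have mS : (QuotientGroup.mk matS : PSL2 (ℤ√(-5))) ∈ π.range := ⟨S, hS⟩
  have mr : (QuotientGroup.mk matR : PSL2 (ℤ√(-5))) ∈ π.range := ⟨r, hr⟩
  have mb : (QuotientGroup.mk matB : PSL2 (ℤ√(-5))) ∈ π.range := ⟨b, hb⟩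
  have mU : (QuotientGroup.mk matU : PSL2 (ℤ√(-5))) ∈ π.range := ⟨U, hU⟩
  have mV : (QuotientGroup.mk matV : PSL2 (ℤ√(-5))) ∈ π.range := ⟨V, hV⟩
  intro g
  refine (frames matRel (MonoidHom.id _) rfl rfl rfl rfl rfl).descent (fun x => x.1 ∈ π.range)
    ?_ ?_ ?_ ?_ ?_ (g, false)
  · rintro ⟨x, _ | _⟩ hx
    · induction x using QuotientGroup.induction_on with
      | H x =>
        have h0 : x 1 0 = 0 := by
          have : (x 1 0).norm = 0 := hx
          rwa [Zsqrtd.norm_eq_zero_iff (by norm_num)] at this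
        obtain ⟨z, hz⟩ := exists_unip_of_lower_zero x h0
        change (QuotientGroup.mk x : PSL2 (ℤ√(-5))) ∈ π.range
        rw [hz, show z = ⟨z.re, z.im⟩ from rfl, ← matU_zpow_mul]
        exact π.range.mul_mem (π.range.zpow_mem mU _)
          (π.range.zpow_mem (π.range.mul_mem (π.range.mul_mem mb mb) mS) _)
    · induction x using QuotientGroup.induction_on with
      | H x =>
        exfalso
        have h1 : (⟨1, 1⟩ * x 1 0 + 2 * x 1 1 : ℤ√(-5)).norm = 2 * 0 :=
          (light_norm x).symm.trans (congrArg (fun z : ℤ => 2 * z) hx)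
        rw [mul_zero, Zsqrtd.norm_eq_zero_iff (by norm_num)] at h1
        exact second_cusp x h1
  · rintro ⟨x, _ | _⟩
    · exact π.range.mul_mem_cancel_right (π.range.mul_mem (π.range.mul_mem mb mb) mS)
    · exact π.range.mul_mem_cancel_right (π.range.mul_mem (π.range.mul_mem mr mS) mb)
  · rintro ⟨x, _ | _⟩
    · exact π.range.mul_mem_cancel_right mU
    · exact π.range.mul_mem_cancel_right (π.range.mul_mem mU mV)
  · rintro ⟨x, _ | _⟩
    · exact (π.range.mul_mem_cancel_right mS).1
    · exact (π.range.mul_mem_cancel_right (π.range.mul_mem (π.range.mul_mem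
        (π.range.mul_mem (π.range.mul_mem mb mb) mr) mS) mb)).1
  · rintro ⟨x, _ | _⟩ <;> exact id

end Surjective

/-- `S, r, b, U, V` present `G` with the relations `BianchiRel`. -/
structure IsPresentation {G : Type} [Group G] (S r b U V : G) : Prop where
  rel : BianchiRel S r b U V
  closure : Subgroup.closure {S, r, b, U, V} = ⊤
  lift : ∀ {H : Type} [Group H] {S' r' b' U' V' : H}, BianchiRel S' r' b' U' V' →
    ∃ f : G →* H, f S = S' ∧ f r = r' ∧ f b = b' ∧ f U = U' ∧ f V = V'

lemma closure_matrices : Subgroup.closure {(QuotientGroup.mk matS : PSL2 (ℤ√(-5))),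
    QuotientGroup.mk matR, QuotientGroup.mk matB, QuotientGroup.mk matU,
    QuotientGroup.mk matV} = ⊤ := by
  set L := Subgroup.closure {(QuotientGroup.mk matS : PSL2 (ℤ√(-5))), QuotientGroup.mk matR,
    QuotientGroup.mk matB, QuotientGroup.mk matU, QuotientGroup.mk matV} with hL
  have hm : ∀ x ∈ ({(QuotientGroup.mk matS : PSL2 (ℤ√(-5))), QuotientGroup.mk matR,
    QuotientGroup.mk matB, QuotientGroup.mk matU, QuotientGroup.mk matV} : Set _), x ∈ L :=
    fun x hx => Subgroup.subset_closure hx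
  have := surjective_of_generators L.subtype (S := ⟨_, hm (QuotientGroup.mk matS) (by simp)⟩)
    (r := ⟨_, hm (QuotientGroup.mk matR) (by simp)⟩)
    (b := ⟨_, hm (QuotientGroup.mk matB) (by simp)⟩)
    (U := ⟨_, hm (QuotientGroup.mk matU) (by simp)⟩)
    (V := ⟨_, hm (QuotientGroup.mk matV) (by simp)⟩) rfl rfl rfl rfl rfl
  rw [← MonoidHom.range_eq_top, Subgroup.range_subtype] at this
  exact this

theorem isPresentation_matrices : IsPresentation (QuotientGroup.mk matS : PSL2 (ℤ√(-5)))
    (QuotientGroup.mk matR) (QuotientGroup.mk matB) (QuotientGroup.mk matU)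
    (QuotientGroup.mk matV) where
  rel := matRel
  closure := closure_matrices
  lift := by
    intro H _ S' r' b' U' V' h
    let A : Set (PSL2 (ℤ√(-5)) × H) := {(QuotientGroup.mk matS, S'), (QuotientGroup.mk matR, r'),
      (QuotientGroup.mk matB, b'), (QuotientGroup.mk matU, U'), (QuotientGroup.mk matV, V')}
    have hA : ∀ x ∈ A, x ∈ Subgroup.closure A := fun x hx => Subgroup.subset_closure hx
    let L := Subgroup.closure A
    let π : L →* PSL2 (ℤ√(-5)) := (MonoidHom.fst _ _).comp L.subtype
    let S : L := ⟨(QuotientGroup.mk matS, S'), hA _ (by simp [A])⟩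
    let r : L := ⟨(QuotientGroup.mk matR, r'), hA _ (by simp [A])⟩
    let b : L := ⟨(QuotientGroup.mk matB, b'), hA _ (by simp [A])⟩
    let U : L := ⟨(QuotientGroup.mk matU, U'), hA _ (by simp [A])⟩
    let V : L := ⟨(QuotientGroup.mk matV, V'), hA _ (by simp [A])⟩
    have hrel : BianchiRel S r b U V :=
      { S_S := Subtype.ext (Prod.ext matRel.S_S h.S_S)
        r_r := Subtype.ext (Prod.ext matRel.r_r h.r_r)
        b_b := Subtype.ext (Prod.ext matRel.b_b h.b_b)
        r_S := Subtype.ext (Prod.ext matRel.r_S h.r_S)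
        b_U := Subtype.ext (Prod.ext matRel.b_U h.b_U)
        V_b := Subtype.ext (Prod.ext matRel.V_b h.V_b)
        V_W := Subtype.ext (Prod.ext matRel.V_W h.V_W) }
    have hgen : Subgroup.closure {S, r, b, U, V} = ⊤ := by
      have h1 := Subgroup.closure_closure_coe_preimage (k := A)
      convert h1 using 2
      ext x
      simp only [Set.mem_insert_iff, Set.mem_singleton_iff, Set.mem_preimage, A, S, r, b, U, V,
        Subtype.ext_iff]
    have hinj := injective_of_closure π hrel rfl rfl rfl rfl rfl hgen
    have hsurj := surjective_of_generators π (S := S) (r := r) (b := b) (U := U) (V := V)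
      rfl rfl rfl rfl rfl
    let e := MulEquiv.ofBijective π ⟨hinj, hsurj⟩
    have he : ∀ x : L, ((MonoidHom.snd _ _).comp (L.subtype.comp e.symm.toMonoidHom)) (π x)
        = x.1.2 := by
      intro x
      have : e.symm (π x) = x := e.symm_apply_apply x
      simp [this]
    exact ⟨(MonoidHom.snd _ _).comp (L.subtype.comp e.symm.toMonoidHom), he S, he r, he b, he U,
      he V⟩

lemma IsPresentation.map {G G' : Type} [Group G] [Group G'] {S r b U V : G}
    (h : IsPresentation S r b U V) (e : G ≃* G') :
    IsPresentation (e S) (e r) (e b) (e U) (e V) where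
  rel := h.rel.map e.toMonoidHom
  closure := by
    have := congrArg (Subgroup.map e.toMonoidHom) h.closure
    rw [MonoidHom.map_closure, Subgroup.map_top_of_surjective _ e.surjective] at this
    simpa [Set.image_insert_eq] using this
  lift h' := by
    obtain ⟨f, h1, h2, h3, h4, h5⟩ := h.lift h'
    exact ⟨f.comp e.symm.toMonoidHom, by simpa using h1, by simpa using h2, by simpa using h3,
      by simpa using h4, by simpa using h5⟩

end Bianchi

namespace Bianchi

lemma sq_of_dvd {x y : ℚ} {m n : ℤ} (h1 : 2 * x = m) (h2 : x ^ 2 + 5 * y ^ 2 = n) :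
    ∃ a c : ℤ, x = a ∧ y = c := by
  have h3 : (10 * y) ^ 2 = ((20 * n - 5 * m ^ 2 : ℤ) : ℚ) := by
    push_cast; rw [← h1, ← h2]; ring
  obtain ⟨k, hk⟩ : ∃ k : ℤ, 10 * y = k := by
    have : IsIntegral ℤ (10 * y) := by
      refine IsIntegral.of_pow (n := 2) (by norm_num) ?_
      rw [h3]; exact isIntegral_algebraMap
    obtain ⟨k, hk⟩ := IsIntegrallyClosed.isIntegral_iff.1 this
    exact ⟨k, hk.symm⟩
  rw [hk] at h3
  have h4 : k ^ 2 = 20 * n - 5 * m ^ 2 := by exact_mod_cast h3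
  obtain ⟨l, rfl⟩ : (5 : ℤ) ∣ k := by
    have : (5 : ℤ) ∣ k ^ 2 := ⟨4 * n - m ^ 2, by rw [h4]; ring⟩
    exact Int.Prime.dvd_pow' (by norm_num) this
  have h5 : 5 * l ^ 2 + m ^ 2 = 4 * n := by nlinarith
  have h6 : 2 ∣ l ∧ 2 ∣ m := by
    have h7 : (5 * l ^ 2 + m ^ 2) % 4 = 0 := by omega
    have hl : l % 4 = 0 ∨ l % 4 = 1 ∨ l % 4 = 2 ∨ l % 4 = 3 := by omega
    have hm : m % 4 = 0 ∨ m % 4 = 1 ∨ m % 4 = 2 ∨ m % 4 = 3 := by omega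
    rcases hl with h | h | h | h <;> rcases hm with h' | h' | h' | h' <;>
      simp [pow_two, Int.add_emod, Int.mul_emod, h, h'] at h7 <;> omega
  obtain ⟨⟨c, rfl⟩, ⟨a, rfl⟩⟩ := h6
  refine ⟨a, c, ?_, ?_⟩
  · push_cast at h1; linarith
  · push_cast at hk; linarith

variable (K : Type) [Field K] [NumberField K]

lemma exists_coords (hdeg : Module.finrank ℚ K = 2) {α : K} (hα : α ^ 2 = -5) (z : K) : ∃ x y : ℚ, z = (x : K) + y * α := by
  have hirr : ∀ x : ℚ, (x : K) ≠ α := by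
    intro x hx
    have : (x : K) ^ 2 = -5 := by rw [hx, hα]
    have : x ^ 2 = -5 := by exact_mod_cast this
    nlinarith [sq_nonneg x]
  have hli : LinearIndependent ℚ ![(1 : K), α] := by
    rw [LinearIndependent.pair_iff]
    intro s t hst
    have ht : t = 0 := by
      by_contra ht
      apply hirr (-s / t)
      simp only [Rat.smul_def, mul_one] at hst
      have ht' : (t : K) ≠ 0 := by exact_mod_cast ht
      push_cast
      field_simp
      linear_combination -hst
    subst ht
    simpa using hst
  have hspan := hli.span_eq_top_of_card_eq_finrank (by simp [hdeg])
  have hz : z ∈ Submodule.span ℚ (Set.range ![(1 : K), α]) := hspan ▸ Submodule.mem_top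
  rw [Matrix.range_cons, Matrix.range_cons, Matrix.range_empty, Set.union_empty,
    Set.singleton_union, Submodule.mem_span_pair] at hz
  obtain ⟨x, y, h⟩ := hz
  exact ⟨x, y, by rw [← h]; simp [Rat.smul_def]⟩

lemma exists_ringEquiv (hdeg : Module.finrank ℚ K = 2) {α : K} (hα : α ^ 2 = -5) :
    Nonempty (ℤ√(-5) ≃+* NumberField.RingOfIntegers K) := by
  have hαi : IsIntegral ℤ α := by
    refine IsIntegral.of_pow (n := 2) (by norm_num) ?_
    rw [hα]
    simpa using isIntegral_algebraMap (R := ℤ) (A := K) (x := -5)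
  let a : NumberField.RingOfIntegers K := ⟨α, hαi⟩
  have ha : a * a = ((-5 : ℤ) : NumberField.RingOfIntegers K) := by
    apply NumberField.RingOfIntegers.ext
    rw [NumberField.RingOfIntegers.coe_eq_algebraMap, NumberField.RingOfIntegers.coe_eq_algebraMap,
      map_mul, map_intCast]
    change α * α = _
    rw [← pow_two, hα]; simp
  let f : ℤ√(-5) →+* NumberField.RingOfIntegers K := Zsqrtd.lift ⟨a, ha⟩
  have hf : ∀ z : ℤ√(-5), ((f z : NumberField.RingOfIntegers K) : K) = z.re + z.im * α := by
    intro z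
    simp only [f, Zsqrtd.lift, NumberField.RingOfIntegers.coe_eq_algebraMap]
    simp
    left; rfl
  refine ⟨RingEquiv.ofBijective f ⟨?_, ?_⟩⟩
  · exact Zsqrtd.lift_injective ⟨a, ha⟩ (fun n hn => by nlinarith [mul_self_nonneg n])
  · intro z
    obtain ⟨x, y, hz⟩ := exists_coords K hdeg hα (z : K)
    -- the conjugate
    have hzi : IsIntegral ℤ (z : K) := z.2
    let σ : K →+* ℂ := Classical.arbitrary _
    have hσ : starRingEnd ℂ (σ α) = - σ α := by
      have h1 : (σ α) ^ 2 = -5 := by rw [← map_pow, hα, map_neg, map_ofNat]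
      have h2 := congrArg Complex.re h1
      have h3 := congrArg Complex.im h1
      simp [pow_two] at h2 h3
      have h4 : (σ α).re = 0 := by
        rcases mul_eq_zero.1 (show (σ α).re * (σ α).im = 0 by linarith) with h3 | h3
        · exact h3
        · rw [h3] at h2; nlinarith
      apply Complex.ext <;> simp [h4]
    have hsz : σ (z : K) = x + y * σ α := by rw [hz]; simp
    have hτz : starRingEnd ℂ (σ (z : K)) = x - y * σ α := by rw [hsz]; simp [hσ]; ring
    have hsi : IsIntegral ℤ (σ (z : K)) := hzi.map σ.toIntAlgHom
    have hti : IsIntegral ℤ (starRingEnd ℂ (σ (z : K))) :=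
      hzi.map ((starRingEnd ℂ).comp σ).toIntAlgHom
    have h1 : IsIntegral ℤ (2 * x) := by
      have := hsi.add hti
      rw [hτz, hsz] at this
      have e : (x + y * σ α + (x - y * σ α) : ℂ) = algebraMap ℚ ℂ (2 * x) := by simp; ring
      rw [e] at this
      exact (isIntegral_algebraMap_iff (algebraMap ℚ ℂ).injective).1 this
    have h2 : IsIntegral ℤ (x ^ 2 + 5 * y ^ 2) := by
      have := hsi.mul hti
      rw [hτz, hsz] at this
      have h1 : (σ α) ^ 2 = -5 := by rw [← map_pow, hα, map_neg, map_ofNat]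
      have e : ((x + y * σ α) * (x - y * σ α) : ℂ) = algebraMap ℚ ℂ (x ^ 2 + 5 * y ^ 2) := by
        simp; linear_combination -(y : ℂ) ^ 2 * h1
      rw [e] at this
      exact (isIntegral_algebraMap_iff (algebraMap ℚ ℂ).injective).1 this
    obtain ⟨m, hm⟩ := IsIntegrallyClosed.isIntegral_iff.1 h1
    obtain ⟨n, hn⟩ := IsIntegrallyClosed.isIntegral_iff.1 h2
    obtain ⟨p, q, rfl, rfl⟩ := sq_of_dvd (m := m) (n := n) hm.symm hn.symm
    refine ⟨⟨p, q⟩, NumberField.RingOfIntegers.ext ?_⟩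
    rw [hf, hz]
    simp


/-- Isomorphic rings have isomorphic special linear groups. -/
def slEquiv {R R' : Type} [CommRing R] [CommRing R'] (e : R ≃+* R') :
    Matrix.SpecialLinearGroup (Fin 2) R ≃* Matrix.SpecialLinearGroup (Fin 2) R' :=
  { Matrix.SpecialLinearGroup.map e.toRingHom with
    invFun := Matrix.SpecialLinearGroup.map e.symm.toRingHom
    left_inv := fun g => Subtype.ext (Matrix.ext fun i j => e.symm_apply_apply (g i j))
    right_inv := fun g => Subtype.ext (Matrix.ext fun i j => e.apply_symm_apply (g i j)) }

/-- Isomorphic rings have isomorphic projective special linear groups. -/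
def pslEquiv {R R' : Type} [CommRing R] [CommRing R'] (e : R ≃+* R') : PSL2 R ≃* PSL2 R' :=
  QuotientGroup.congr _ _ (slEquiv e) (by
    ext g
    simp only [Subgroup.mem_map, Subgroup.mem_center_iff]
    constructor
    · rintro ⟨x, hx, rfl⟩ k
      have := congrArg (slEquiv e) (hx ((slEquiv e).symm k))
      simpa using this
    · intro h
      refine ⟨(slEquiv e).symm g, fun k => ?_, by simp⟩
      apply (slEquiv e).injective
      simpa using h (slEquiv e k))

theorem exists_isPresentation (hdeg : Module.finrank ℚ K = 2) {α : K} (hα : α ^ 2 = -5) :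
    ∃ S r b U V : PSL2 (NumberField.RingOfIntegers K),
    IsPresentation S r b U V := by
  obtain ⟨e⟩ := exists_ringEquiv K hdeg hα
  exact ⟨_, _, _, _, _, isPresentation_matrices.map (pslEquiv e)⟩

end Bianchi

namespace GHom

open CategoryTheory

variable (G : Type) [Group G]

/-- The representation underlying a module over the integral group ring. -/
noncomputable abbrev repOf (M : Type) [AddCommGroup M] [Module (MonoidAlgebra ℤ G) M] : Rep ℤ G :=
  (Rep.ofModuleMonoidAlgebra (k := ℤ) (G := G)).obj (ModuleCat.of (MonoidAlgebra ℤ G) M)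

/-- Homology of `G` with coefficients in a module over the integral group ring. -/
def hh (q : ℕ) (M : Type) [AddCommGroup M] [Module (MonoidAlgebra ℤ G) M] : Type :=
  groupHomology (repOf G M) q

noncomputable instance (q : ℕ) (M : Type) [AddCommGroup M] [Module (MonoidAlgebra ℤ G) M] :
    AddCommGroup (hh G q M) :=
  inferInstanceAs (AddCommGroup (groupHomology (repOf G M) q))

variable {G}
variable {M N P A B C : Type} [AddCommGroup M] [Module (MonoidAlgebra ℤ G) M]
  [AddCommGroup N] [Module (MonoidAlgebra ℤ G) N] [AddCommGroup P] [Module (MonoidAlgebra ℤ G) P]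
  [AddCommGroup A] [Module (MonoidAlgebra ℤ G) A] [AddCommGroup B] [Module (MonoidAlgebra ℤ G) B]
  [AddCommGroup C] [Module (MonoidAlgebra ℤ G) C]

/-- The morphism of representations underlying a linear map. -/
noncomputable abbrev repMap (f : M →ₗ[MonoidAlgebra ℤ G] N) : repOf G M ⟶ repOf G N :=
  (Rep.ofModuleMonoidAlgebra (k := ℤ) (G := G)).map (ModuleCat.ofHom f)

/-- Functoriality of homology in the coefficients. -/
noncomputable def hmap (q : ℕ) (f : M →ₗ[MonoidAlgebra ℤ G] N) : hh G q M →+ hh G q N :=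
  ((groupHomology.functor ℤ G q).map (repMap f)).hom.toAddMonoidHom

theorem hmap_id (q : ℕ) : hmap q (LinearMap.id : M →ₗ[MonoidAlgebra ℤ G] M) = AddMonoidHom.id _ := by
  unfold hmap repMap
  rw [show ModuleCat.ofHom (LinearMap.id : M →ₗ[MonoidAlgebra ℤ G] M) = 𝟙 _ from rfl,
    CategoryTheory.Functor.map_id, CategoryTheory.Functor.map_id]
  rfl

theorem hmap_comp (q : ℕ) (g : N →ₗ[MonoidAlgebra ℤ G] P) (f : M →ₗ[MonoidAlgebra ℤ G] N) :
    hmap q (g ∘ₗ f) = (hmap q g).comp (hmap q f) := by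
  unfold hmap repMap
  rw [ModuleCat.ofHom_comp, Functor.map_comp, Functor.map_comp]
  rfl

theorem hmap_zero (q : ℕ) : hmap q (0 : M →ₗ[MonoidAlgebra ℤ G] N) = 0 := by
  unfold hmap repMap
  rw [show ModuleCat.ofHom (0 : M →ₗ[MonoidAlgebra ℤ G] N) = 0 from rfl,
    Functor.map_zero, Functor.map_zero]
  rfl

theorem hmap_add (q : ℕ) (f g : M →ₗ[MonoidAlgebra ℤ G] N) :
    hmap q (f + g) = hmap q f + hmap q g := by
  have : (groupHomology.chainsFunctor ℤ G).map (repMap (f + g)) =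
      (groupHomology.chainsFunctor ℤ G).map (repMap f) +
      (groupHomology.chainsFunctor ℤ G).map (repMap g) := by
    ext n : 1
    rw [HomologicalComplex.add_f_apply]
    apply groupHomology.inhomogeneousChains.ext
    intro x
    refine ConcreteCategory.hom_ext _ _ fun a => ?_
    have e := fun φ => groupHomology.chainsMap_f_single (A := repOf G M) (B := repOf G N)
      (MonoidHom.id G) φ n x a
    exact (e (repMap (f + g))).trans ((Finsupp.single_add ..).trans
      (congrArg₂ (· + ·) (e (repMap f)) (e (repMap g))).symm)
  unfold hmap
  change ((HomologicalComplex.homologyMap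
    ((groupHomology.chainsFunctor ℤ G).map (repMap (f + g))) q).hom).toAddMonoidHom = _
  rw [this, HomologicalComplex.homologyMap_add]
  rfl

/-- A short exact sequence of modules. -/
structure IsSES (f : A →ₗ[MonoidAlgebra ℤ G] B) (g : B →ₗ[MonoidAlgebra ℤ G] C) : Prop where
  inj : Function.Injective f
  surj : Function.Surjective g
  exact : Function.Exact f g

/-- The short complex in the category of modules. -/
noncomputable abbrev IsSES.cplx {f : A →ₗ[MonoidAlgebra ℤ G] B} {g : B →ₗ[MonoidAlgebra ℤ G] C}
    (h : IsSES f g) : ShortComplex (ModuleCat (MonoidAlgebra ℤ G)) :=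
  ShortComplex.mk (ModuleCat.ofHom f) (ModuleCat.ofHom g) (by
    ext x; exact h.exact.apply_apply_eq_zero x)

theorem IsSES.shortExact {f : A →ₗ[MonoidAlgebra ℤ G] B} {g : B →ₗ[MonoidAlgebra ℤ G] C}
    (h : IsSES f g) : h.cplx.ShortExact where
  exact := (ShortComplex.ShortExact.moduleCat_exact_iff_function_exact _).2 h.exact
  mono_f := (ModuleCat.mono_iff_injective _).2 h.inj
  epi_g := (ModuleCat.epi_iff_surjective _).2 h.surj

theorem IsSES.repShortExact {f : A →ₗ[MonoidAlgebra ℤ G] B} {g : B →ₗ[MonoidAlgebra ℤ G] C}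
    (h : IsSES f g) : (h.cplx.map (Rep.ofModuleMonoidAlgebra (k := ℤ) (G := G))).ShortExact :=
  h.shortExact.map_of_exact _

namespace IsSES

variable {f : A →ₗ[MonoidAlgebra ℤ G] B} {g : B →ₗ[MonoidAlgebra ℤ G] C}

/-- The connecting homomorphism. -/
noncomputable def δ (h : IsSES f g) (q : ℕ) : hh G (q + 1) C →+ hh G q A :=
  (groupHomology.δ h.repShortExact (q + 1) q rfl).hom.toAddMonoidHom

theorem exact₁ (h : IsSES f g) (q : ℕ) : Function.Exact (h.δ q) (hmap q f) :=
  (ShortComplex.ShortExact.moduleCat_exact_iff_function_exact _).1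
    (groupHomology.mapShortComplex₁_exact h.repShortExact (i := q + 1) (j := q) rfl)

theorem exact₂ (h : IsSES f g) (q : ℕ) : Function.Exact (hmap q f) (hmap q g) :=
  (ShortComplex.ShortExact.moduleCat_exact_iff_function_exact _).1
    (groupHomology.mapShortComplex₂_exact h.repShortExact q)

theorem exact₃ (h : IsSES f g) (q : ℕ) : Function.Exact (hmap (q + 1) g) (h.δ q) :=
  (ShortComplex.ShortExact.moduleCat_exact_iff_function_exact _).1
    (groupHomology.mapShortComplex₃_exact h.repShortExact (i := q + 1) (j := q) rfl)

variable {A' B' C' : Type} [AddCommGroup A'] [Module (MonoidAlgebra ℤ G) A']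
  [AddCommGroup B'] [Module (MonoidAlgebra ℤ G) B'] [AddCommGroup C'] [Module (MonoidAlgebra ℤ G) C']
  {f' : A' →ₗ[MonoidAlgebra ℤ G] B'} {g' : B' →ₗ[MonoidAlgebra ℤ G] C'}

theorem δ_nat (h : IsSES f g) (h' : IsSES f' g') (a : A →ₗ[MonoidAlgebra ℤ G] A')
    (b : B →ₗ[MonoidAlgebra ℤ G] B') (c : C →ₗ[MonoidAlgebra ℤ G] C')
    (hab : b ∘ₗ f = f' ∘ₗ a) (hbc : c ∘ₗ g = g' ∘ₗ b) (q : ℕ) (x : hh G (q + 1) C) :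
    h'.δ q (hmap (q + 1) c x) = hmap q a (h.δ q x) := by
  let φ : h.cplx ⟶ h'.cplx :=
    { τ₁ := ModuleCat.ofHom a, τ₂ := ModuleCat.ofHom b, τ₃ := ModuleCat.ofHom c
      comm₁₂ := by ext x; exact (LinearMap.congr_fun hab x).symm
      comm₂₃ := by ext x; exact (LinearMap.congr_fun hbc x).symm }
  let F := Rep.ofModuleMonoidAlgebra (k := ℤ) (G := G)
  let ψ := (groupHomology.chainsFunctor ℤ G).mapShortComplex.map (F.mapShortComplex.map φ)
  have := HomologicalComplex.HomologySequence.δ_naturality ψ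
    (groupHomology.map_chainsFunctor_shortExact h.repShortExact)
    (groupHomology.map_chainsFunctor_shortExact h'.repShortExact) (q + 1) q rfl
  exact (ConcreteCategory.congr_hom this x).symm

end IsSES

section RepChains

variable (A B : Rep.{0} ℤ G)

theorem iCycles_injective (q : ℕ) : Function.Injective (groupHomology.iCycles A q) :=
  (ModuleCat.mono_iff_injective _).1
    (inferInstanceAs (Mono ((groupHomology.inhomogeneousChains A).iCycles q)))

theorem rep_π_surjective (q : ℕ) : Function.Surjective (groupHomology.π A q) :=
  (ModuleCat.epi_iff_surjective _).1
    (inferInstanceAs (Epi ((groupHomology.inhomogeneousChains A).homologyπ q)))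

/-- Cycles of the inhomogeneous bar complex. -/
noncomputable def repCyc : (q : ℕ) → AddSubgroup ((Fin q → G) →₀ A)
  | 0 => ⊤
  | q + 1 => (groupHomology.inhomogeneousChains.d A q).hom.toAddMonoidHom.ker

theorem repCyc_iff (q : ℕ) (c : (Fin q → G) →₀ A) : c ∈ repCyc A q ↔
    (groupHomology.inhomogeneousChains A).d q ((ComplexShape.down ℕ).next q) c = 0 := by
  cases q with
  | zero =>
    refine ⟨fun _ => ?_, fun _ => trivial⟩
    rw [(groupHomology.inhomogeneousChains A).shape _ _ (by simp)]
    rfl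
  | succ q =>
    rw [ChainComplex.next_nat_succ, groupHomology.inhomogeneousChains.d_def]
    rfl

/-- A chain that is a cycle, as an element of the categorical kernel. -/
noncomputable def repCycMk (q : ℕ) : repCyc A q →+ groupHomology.cycles A q where
  toFun c := groupHomology.cyclesMk q _ rfl (c : (Fin q → G) →₀ A) ((repCyc_iff A q _).1 c.2)
  map_zero' := by
    apply iCycles_injective A q
    exact (groupHomology.iCycles_mk _ _ _).trans
      (map_zero (groupHomology.iCycles A q).hom).symm
  map_add' a b := by
    apply iCycles_injective A q
    refine (groupHomology.iCycles_mk _ _ _).trans ?_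
    refine Eq.trans ?_ (map_add (groupHomology.iCycles A q).hom _ _).symm
    refine Eq.trans ?_ (congrArg₂ (· + ·) (groupHomology.iCycles_mk rfl (a : (Fin q → G) →₀ A) _)
      (groupHomology.iCycles_mk rfl (b : (Fin q → G) →₀ A) _)).symm
    rfl

theorem iCycles_repCycMk (q : ℕ) (c : repCyc A q) :
    groupHomology.iCycles A q (repCycMk A q c) = (c : (Fin q → G) →₀ A) :=
  groupHomology.iCycles_mk rfl _ ((repCyc_iff A q _).1 c.2)

theorem repCycMk_surjective (q : ℕ) : Function.Surjective (repCycMk A q) := fun z => by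
  refine ⟨⟨groupHomology.iCycles A q z, (repCyc_iff A q _).2 ?_⟩, ?_⟩
  · exact ConcreteCategory.congr_hom
      ((groupHomology.inhomogeneousChains A).iCycles_d q _) z
  · apply iCycles_injective A q
    exact iCycles_repCycMk A q _

theorem repMk_eq_zero (q : ℕ) (c : repCyc A q) : groupHomology.π A q (repCycMk A q c) = 0 ↔
    ∃ y, groupHomology.inhomogeneousChains.d A q y = (c : (Fin q → G) →₀ A) := by
  have hex : Function.Exact (groupHomology.toCycles A (q + 1) q) (groupHomology.π A q) :=
    (ShortComplex.ShortExact.moduleCat_exact_iff_function_exact _).1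
      (ShortComplex.exact_of_g_is_cokernel (ShortComplex.mk _ _
        ((groupHomology.inhomogeneousChains A).toCycles_comp_homologyπ (q + 1) q))
        ((groupHomology.inhomogeneousChains A).homologyIsCokernel (q + 1) q (by simp)))
  refine (hex _).trans (exists_congr fun y => ?_)
  have e : groupHomology.iCycles A q
      (groupHomology.toCycles A (q + 1) q y) = groupHomology.inhomogeneousChains.d A q y := by
    refine (ConcreteCategory.congr_hom
      ((groupHomology.inhomogeneousChains A).toCycles_i (q + 1) q) y).trans ?_
    rw [groupHomology.inhomogeneousChains.d_def]
  rw [← (iCycles_injective A q).eq_iff, iCycles_repCycMk, e]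

variable {A B} in
theorem repMap_mk (q : ℕ) (φ : A ⟶ B) (c : repCyc A q) (c' : repCyc B q)
    (h : ∀ x, φ.hom ((c : (Fin q → G) →₀ A) x) = (c' : (Fin q → G) →₀ B) x) :
    (groupHomology.functor ℤ G q).map φ (groupHomology.π A q (repCycMk A q c)) =
      groupHomology.π B q (repCycMk B q c') := by
  refine (ConcreteCategory.congr_hom (groupHomology.π_map (A := A) (B := B) (MonoidHom.id G) φ q) _).trans ?_
  refine congrArg (groupHomology.π B q).hom ?_
  apply iCycles_injective B q
  rw [iCycles_repCycMk]
  refine (ConcreteCategory.congr_hom (HomologicalComplex.cyclesMap_i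
    (groupHomology.chainsMap (A := A) (B := B) (MonoidHom.id G) φ) q) _).trans ?_
  refine Eq.trans (congrArg ((groupHomology.chainsMap (MonoidHom.id G) φ).f q).hom
    (iCycles_repCycMk A q c)) ?_
  refine Eq.trans (congrArg (fun t => t (c : (Fin q → G) →₀ A))
    (groupHomology.chainsMap_id_f_hom_eq_mapRange q φ)) (Finsupp.ext h)

end RepChains

section Chains

theorem smul_int_module {X : Type} [AddCommGroup X] (i : Module ℤ X) (n : ℤ) (x : X) :
    @HSMul.hSMul ℤ X X (@instHSMul _ _ i.toSMul) n x = n • x := int_smul_eq_zsmul i n x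

variable (G M) in
/-- The differential of the inhomogeneous bar complex with coefficients in a module. -/
noncomputable def dd (q : ℕ) : ((Fin (q + 1) → G) →₀ M) →+ ((Fin q → G) →₀ M) :=
  (groupHomology.inhomogeneousChains.d (repOf G M) q).hom.toAddMonoidHom

theorem dd_single (q : ℕ) (g : Fin (q + 1) → G) (m : M) :
    dd G M q (Finsupp.single g m) =
      Finsupp.single (fun i => g i.succ) (MonoidAlgebra.single (g 0)⁻¹ (1 : ℤ) • m) +
      ∑ j : Fin (q + 1), (-1 : ℤ) ^ ((j : ℕ) + 1) •
        Finsupp.single (Fin.contractNth j (· * ·) g) m := by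
  refine (groupHomology.inhomogeneousChains.d_single (A := repOf G M) q g m).trans ?_
  refine congrArg₂ (· + ·) rfl (Finset.sum_congr rfl fun j _ => ?_)
  exact smul_int_module (X := (Fin q → G) →₀ M)
    (@Finsupp.module _ (repOf G M).V ℤ _ _ (repOf G M).hV2) _ _

variable (G M) in
/-- Cycles of the inhomogeneous bar complex. -/
noncomputable def hcyc : (q : ℕ) → AddSubgroup ((Fin q → G) →₀ M)
  | 0 => ⊤
  | q + 1 => (dd G M q).ker

theorem hcyc_eq (q : ℕ) : hcyc G M q = repCyc (repOf G M) q := by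
  cases q <;> rfl

theorem mem_hcyc_succ (q : ℕ) (c : (Fin (q + 1) → G) →₀ M) :
    c ∈ hcyc G M (q + 1) ↔ dd G M q c = 0 := Iff.rfl

variable (G M) in
/-- The homology class of a cycle. -/
noncomputable def hmk (q : ℕ) : hcyc G M q →+ hh G q M :=
  ((groupHomology.π (repOf G M) q).hom.toAddMonoidHom.comp (repCycMk (repOf G M) q)).comp
    (AddSubgroup.inclusion (hcyc_eq q).le)

theorem hmk_surjective (q : ℕ) : Function.Surjective (hmk G M q) := by
  intro x
  obtain ⟨z, rfl⟩ := rep_π_surjective (repOf G M) q x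
  obtain ⟨c, rfl⟩ := repCycMk_surjective (repOf G M) q z
  exact ⟨⟨c.1, (hcyc_eq q).ge c.2⟩, rfl⟩

theorem hmk_eq_zero (q : ℕ) (c : hcyc G M q) : hmk G M q c = 0 ↔ ∃ y, dd G M q y = c :=
  repMk_eq_zero (repOf G M) q ⟨c.1, (hcyc_eq q).le c.2⟩

theorem hmap_hmk (q : ℕ) (f : M →ₗ[MonoidAlgebra ℤ G] N) (c : hcyc G M q) (c' : hcyc G N q)
    (h : ∀ x, f (c.1 x) = c'.1 x) : hmap q f (hmk G M q c) = hmk G N q c' :=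
  repMap_mk q (repMap f) ⟨c.1, (hcyc_eq q).le c.2⟩ ⟨c'.1, (hcyc_eq q).le c'.2⟩ h

theorem dd_mapRange (q : ℕ) (f : M →ₗ[MonoidAlgebra ℤ G] N) (c : (Fin (q + 1) → G) →₀ M) :
    dd G N q (Finsupp.mapRange.addMonoidHom f.toAddMonoidHom c) =
      Finsupp.mapRange.addMonoidHom f.toAddMonoidHom (dd G M q c) := by
  suffices (dd G N q).comp (Finsupp.mapRange.addMonoidHom f.toAddMonoidHom) =
      (Finsupp.mapRange.addMonoidHom f.toAddMonoidHom).comp (dd G M q) from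
    DFunLike.congr_fun this c
  ext g : 1
  have e : ∀ (x : Fin (q + 1) → G) (m : M), Finsupp.mapRange.addMonoidHom f.toAddMonoidHom
    (Finsupp.single x m) = Finsupp.single x (f m) := fun x m =>
      Finsupp.mapRange_single (hf := map_zero f)
  have e' : ∀ (x : Fin q → G) (m : M), Finsupp.mapRange.addMonoidHom f.toAddMonoidHom
    (Finsupp.single x m) = Finsupp.single x (f m) := fun x m =>
      Finsupp.mapRange_single (hf := map_zero f)
  refine DFunLike.ext _ _ fun m => ?_
  simp only [AddMonoidHom.comp_apply, Finsupp.singleAddHom_apply, e, dd_single, map_add, map_sum,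
    map_zsmul, e', map_smul]

theorem mapRange_mem_hcyc (q : ℕ) (f : M →ₗ[MonoidAlgebra ℤ G] N) (c : hcyc G M q) :
    Finsupp.mapRange.addMonoidHom f.toAddMonoidHom (c : (Fin q → G) →₀ M) ∈ hcyc G N q := by
  cases q with
  | zero => trivial
  | succ q =>
    have hc : dd G M q c = 0 := c.2
    rw [mem_hcyc_succ, dd_mapRange, hc, map_zero]

variable (G M) in
/-- The projection to coinvariants. -/
noncomputable def h0mk : M →+ hh G 0 M :=
  (hmk G M 0).comp (((Finsupp.singleAddHom default).codRestrict ⊤ fun _ => trivial))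

theorem h0mk_surjective : Function.Surjective (h0mk G M) := by
  intro x
  obtain ⟨c, rfl⟩ := hmk_surjective 0 x
  refine ⟨c.1 default, congrArg (hmk G M 0) (Subtype.ext ?_)⟩
  refine Finsupp.ext fun y => ?_
  rw [Subsingleton.elim y default]
  exact Finsupp.single_eq_same

theorem hmap_h0mk (f : M →ₗ[MonoidAlgebra ℤ G] N) (m : M) :
    hmap 0 f (h0mk G M m) = h0mk G N (f m) := by
  refine hmap_hmk 0 f _ _ fun x => ?_
  rw [Subsingleton.elim x default]
  exact (congrArg f Finsupp.single_eq_same).trans Finsupp.single_eq_same.symm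

theorem dd_zero_single (g : Fin 1 → G) (m : M) : dd G M 0 (Finsupp.single g m) =
    Finsupp.single default (MonoidAlgebra.single (g 0)⁻¹ (1 : ℤ) • m - m) := by
  rw [dd_single, Fin.sum_univ_one, Finsupp.single_sub,
    Subsingleton.elim (fun i : Fin 0 => g i.succ) default,
    Subsingleton.elim (Fin.contractNth (0 : Fin 1) (· * ·) g) default]
  simp [sub_eq_add_neg]

theorem h0mk_smul (g : G) (m : M) :
    h0mk G M (MonoidAlgebra.single g (1 : ℤ) • m) = h0mk G M m := by
  rw [← sub_eq_zero, ← map_sub]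
  refine (hmk_eq_zero 0 _).2 ⟨Finsupp.single (fun _ => g⁻¹) m, ?_⟩
  rw [dd_zero_single, inv_inv]
  rfl

/-- The universal property of coinvariants. -/
noncomputable def h0lift {T : Type*} [AddCommGroup T] (φ : M →+ T)
    (hφ : ∀ (g : G) m, φ (MonoidAlgebra.single g (1 : ℤ) • m) = φ m) : hh G 0 M →+ T :=
  (QuotientAddGroup.lift (hmk G M 0).ker
    ((φ.comp (Finsupp.applyAddHom default)).comp (hcyc G M 0).subtype) (by
      intro c hc
      obtain ⟨y, hy⟩ := (hmk_eq_zero 0 c).1 hc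
      change φ (c.1 default) = 0
      rw [← hy]
      suffices (φ.comp (Finsupp.applyAddHom default)).comp (dd G M 0) = 0 from
        DFunLike.congr_fun this y
      ext g : 1
      refine DFunLike.ext _ _ fun m => ?_
      simp only [AddMonoidHom.comp_apply, Finsupp.singleAddHom_apply, dd_zero_single,
        Finsupp.applyAddHom_apply, Finsupp.single_eq_same, map_sub, hφ, sub_self,
        AddMonoidHom.zero_apply])).comp
  (QuotientAddGroup.quotientKerEquivOfSurjective (hmk G M 0) (hmk_surjective 0)).symm.toAddMonoidHom

theorem h0lift_h0mk {T : Type*} [AddCommGroup T] (φ : M →+ T)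
    (hφ : ∀ (g : G) m, φ (MonoidAlgebra.single g (1 : ℤ) • m) = φ m) (m : M) :
    h0lift φ hφ (h0mk G M m) = φ m := by
  have : (QuotientAddGroup.quotientKerEquivOfSurjective (hmk G M 0) (hmk_surjective 0)).symm
      (h0mk G M m) = QuotientAddGroup.mk (⟨Finsupp.single default m, trivial⟩ : hcyc G M 0) := by
    rw [AddEquiv.symm_apply_eq]
    rfl
  rw [h0lift, AddMonoidHom.comp_apply]
  refine (congrArg (QuotientAddGroup.lift _ _ _) this).trans ?_
  exact congrArg φ Finsupp.single_eq_same

/-- The operator prepending the inverse of the coefficient. -/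
noncomputable def prepend (q : ℕ) : ((Fin q → G) →₀ MonoidAlgebra ℤ G) →+
    ((Fin (q + 1) → G) →₀ MonoidAlgebra ℤ G) :=
  Finsupp.liftAddHom fun g => (Finsupp.liftAddHom fun h : G =>
    ((Finsupp.singleAddHom (Fin.cons h⁻¹ g : Fin (q + 1) → G)).comp
      (MonoidAlgebra.singleAddHom (1 : G)))).comp MonoidAlgebra.coeffAddEquiv.toAddMonoidHom

theorem prepend_single (q : ℕ) (g : Fin q → G) (h : G) (n : ℤ) :
    prepend q (Finsupp.single g (MonoidAlgebra.single h n)) =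
      Finsupp.single (Fin.cons h⁻¹ g : Fin (q + 1) → G) (MonoidAlgebra.single (1 : G) n) := by
  simp [prepend]

theorem contractNth_zero_cons (q : ℕ) (a : G) (g : Fin (q + 1) → G) :
    Fin.contractNth 0 (· * ·) (Fin.cons a g : Fin (q + 2) → G) =
      (Fin.cons (a * g 0) (fun i => g i.succ) : Fin (q + 1) → G) := by
  funext i
  refine Fin.cases ?_ (fun i => ?_) i
  · rw [Fin.contractNth_apply_of_eq _ _ _ _ (by simp)]
    simp
  · rw [Fin.contractNth_apply_of_gt _ _ _ _ (by simp)]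
    simp

theorem contractNth_succ_cons (q : ℕ) (a : G) (g : Fin (q + 1) → G) (j : Fin (q + 1)) :
    Fin.contractNth j.succ (· * ·) (Fin.cons a g : Fin (q + 2) → G) =
      (Fin.cons a (Fin.contractNth j (· * ·) g) : Fin (q + 1) → G) := by
  funext i
  refine Fin.cases ?_ (fun i => ?_) i
  · rw [Fin.contractNth_apply_of_lt _ _ _ _ (by simp)]
    simp
  · rw [Fin.cons_succ]
    rcases lt_trichotomy (i : ℕ) (j : ℕ) with h | h | h
    · rw [Fin.contractNth_apply_of_lt _ _ _ _ h, Fin.contractNth_apply_of_lt _ _ _ _ (by simpa)]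
      rfl
    · rw [Fin.contractNth_apply_of_eq _ _ _ _ h, Fin.contractNth_apply_of_eq _ _ _ _ (by simpa)]
      rfl
    · rw [Fin.contractNth_apply_of_gt _ _ _ _ h, Fin.contractNth_apply_of_gt _ _ _ _ (by simpa)]
      rfl

theorem dd_prepend (q : ℕ) (c : (Fin (q + 1) → G) →₀ MonoidAlgebra ℤ G) :
    dd G (MonoidAlgebra ℤ G) (q + 1) (prepend (q + 1) c) +
      prepend q (dd G (MonoidAlgebra ℤ G) q c) = c := by
  suffices ((dd G (MonoidAlgebra ℤ G) (q + 1)).comp (prepend (q + 1)) +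
      (prepend q).comp (dd G (MonoidAlgebra ℤ G) q)) = AddMonoidHom.id _ from
    DFunLike.congr_fun this c
  ext g : 1
  refine MonoidAlgebra.addMonoidHom_ext fun h n => ?_
  simp only [AddMonoidHom.comp_apply, AddMonoidHom.add_apply, Finsupp.singleAddHom_apply,
    AddMonoidHom.id_apply, prepend_single, dd_single, Fin.cons_zero, inv_inv, map_add, map_sum,
    map_zsmul, smul_eq_mul, MonoidAlgebra.single_mul_single, mul_one, one_mul, Fin.cons_succ,
    Fin.sum_univ_succ (n := q + 1), contractNth_zero_cons, contractNth_succ_cons, mul_inv_rev]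
  rw [add_assoc, add_eq_left]
  rw [add_add_add_comm]
  simp only [Fin.val_zero, Fin.val_succ, pow_succ _ (_ + 1), mul_neg, mul_one, neg_smul,
    Finset.sum_neg_distrib]
  rw [neg_add_cancel, add_zero, zero_add, pow_one, neg_smul, one_smul, neg_add_cancel]

theorem hh_free_subsingleton (q : ℕ) : Subsingleton (hh G (q + 1) (MonoidAlgebra ℤ G)) := by
  refine subsingleton_of_forall_eq 0 fun x => ?_
  obtain ⟨c, rfl⟩ := hmk_surjective _ x
  refine (hmk_eq_zero _ _).2 ⟨prepend (q + 1) c.1, ?_⟩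
  have := dd_prepend q c.1
  rwa [(mem_hcyc_succ q _).1 c.2, map_zero, add_zero] at this

end Chains

end GHom

namespace GHom

variable (G : Type) [Group G]

/-- The augmentation of the integral group ring. -/
noncomputable def aug : MonoidAlgebra ℤ G →+* ℤ :=
  ((MonoidAlgebra.lift ℤ ℤ G) (1 : G →* ℤ)).toRingHom

theorem aug_single (g : G) (n : ℤ) : aug G (MonoidAlgebra.single g n) = n := by
  simp [aug]

/-- The trivial module `ℤ`. -/
noncomputable instance trivModule : Module (MonoidAlgebra ℤ G) ℤ := Module.compHom ℤ (aug G)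

theorem triv_smul (a : MonoidAlgebra ℤ G) (x : ℤ) : a • x = aug G a * x := rfl

theorem triv_single_smul (g : G) (x : ℤ) : MonoidAlgebra.single g (1 : ℤ) • x = x := by
  rw [triv_smul, aug_single, one_mul]

theorem dd_triv (q : ℕ) (c : (Fin (q + 1) → G) →₀ ℤ) :
    dd G ℤ q c = BarHomology.d ℤ G ℤ q c := by
  suffices dd G ℤ q = (BarHomology.d ℤ G ℤ q).toAddMonoidHom from
    DFunLike.congr_fun this c
  ext g : 1
  refine DFunLike.ext _ _ fun m => ?_
  refine (dd_single q g m).trans ?_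
  simp [BarHomology.d, triv_single_smul]

theorem hcyc_triv (q : ℕ) : hcyc G ℤ q = (BarHomology.cycles ℤ G ℤ q).toAddSubgroup := by
  cases q with
  | zero => rfl
  | succ q =>
    ext c
    exact (mem_hcyc_succ q c).trans (by rw [dd_triv]; rfl)

/-- Homology with coefficients in the trivial module agrees with the untwisted bar homology. -/
theorem hh_triv_equiv (q : ℕ) : Nonempty (GroupHomology ℤ G ℤ q ≃+ hh G q ℤ) := by
  let φ : BarHomology.cycles ℤ G ℤ q →+ hh G q ℤ :=
    (hmk G ℤ q).comp (AddSubgroup.inclusion (hcyc_triv G q).ge)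
  have hφ : Function.Surjective φ := fun x => by
    obtain ⟨c, rfl⟩ := hmk_surjective q x
    exact ⟨⟨c.1, (hcyc_triv G q).le c.2⟩, rfl⟩
  have hk : φ.ker = (boundariesIn ℤ G ℤ q).toAddSubgroup := by
    ext c
    refine (hmk_eq_zero q _).trans (exists_congr fun y => ?_)
    rw [dd_triv]
    rfl
  exact ⟨(QuotientAddGroup.quotientAddEquivOfEq hk.symm).trans
    (QuotientAddGroup.quotientKerEquivOfSurjective φ hφ)⟩

end GHom

namespace GHom

variable {G : Type} [Group G]

/-- A group element in the integral group ring. -/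
noncomputable abbrev gr (g : G) : MonoidAlgebra ℤ G := MonoidAlgebra.single g (1 : ℤ)

theorem gr_mul (g h : G) : gr (g * h) = gr g * gr h := by simp [gr]

theorem gr_one : gr (1 : G) = 1 := rfl

theorem gr_pow (g : G) (n : ℕ) : gr (g ^ n) = gr g ^ n := by simp [gr]

theorem ring_induction {C : MonoidAlgebra ℤ G → Prop} (z : MonoidAlgebra ℤ G)
    (gr : ∀ g, C (gr g)) (add : ∀ y z, C y → C z → C (y + z)) (neg : ∀ y, C y → C (-y)) : C z := by
  refine MonoidAlgebra.induction_on z gr add fun n y hy => ?_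
  have h0 : C 0 := by simpa using add _ _ hy (neg _ hy)
  induction n using Int.induction_on with
  | zero => simpa using h0
  | succ n ih => rw [add_smul, one_smul]; exact add _ _ ih hy
  | pred n ih => rw [sub_smul, one_smul, sub_eq_add_neg]; exact add _ _ ih (neg _ hy)

/-- Right multiplication by `z` maps the left ideal `L` into `L'`. -/
def Compat (L : Submodule (MonoidAlgebra ℤ G) (MonoidAlgebra ℤ G)) (z : MonoidAlgebra ℤ G)
    (L' : Submodule (MonoidAlgebra ℤ G) (MonoidAlgebra ℤ G)) : Prop :=
  ∀ y ∈ L, y * z ∈ L'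

section Compat

variable {L L' L'' : Submodule (MonoidAlgebra ℤ G) (MonoidAlgebra ℤ G)} {z z' : MonoidAlgebra ℤ G}

theorem compat_of_le (h : L ≤ L') : Compat L 1 L' := fun y hy => by rw [mul_one]; exact h hy

theorem Compat.mul (h : Compat L z L') (h' : Compat L' z' L'') : Compat L (z * z') L'' :=
  fun y hy => by rw [← mul_assoc]; exact h' _ (h y hy)

theorem Compat.sup {K : Submodule (MonoidAlgebra ℤ G) (MonoidAlgebra ℤ G)}
    (h : Compat L z L'') (h' : Compat K z L'') : Compat (L ⊔ K) z L'' := fun y hy => by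
  obtain ⟨u, hu, v, hv, rfl⟩ := Submodule.mem_sup.1 hy
  rw [add_mul]; exact add_mem (h u hu) (h' v hv)

theorem compat_span {w : MonoidAlgebra ℤ G} (h : w * z ∈ L') :
    Compat (Submodule.span (MonoidAlgebra ℤ G) {w}) z L' := fun y hy => by
  obtain ⟨u, rfl⟩ := Submodule.mem_span_singleton.1 hy
  rw [smul_eq_mul, mul_assoc]; exact L'.smul_mem u h

theorem compat_bot : Compat (⊥ : Submodule (MonoidAlgebra ℤ G) (MonoidAlgebra ℤ G)) z L' :=
  fun y hy => by rw [(Submodule.mem_bot _).1 hy, zero_mul]; exact L'.zero_mem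

/-- Right multiplication on quotients by left ideals. -/
noncomputable def qm (h : Compat L z L') :
    (MonoidAlgebra ℤ G ⧸ L) →ₗ[MonoidAlgebra ℤ G] (MonoidAlgebra ℤ G ⧸ L') :=
  L.mapQ L' (LinearMap.toSpanSingleton _ _ z) h

theorem qm_mk (h : Compat L z L') (y : MonoidAlgebra ℤ G) :
    qm h (Submodule.Quotient.mk y) = Submodule.Quotient.mk (y * z) := rfl

theorem qm_comp (h : Compat L z L') (h' : Compat L' z' L'') : qm h' ∘ₗ qm h = qm (h.mul h') := by
  ext
  simp [qm_mk, mul_assoc]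

theorem qm_congr (h : Compat L z L') (h' : Compat L z' L') (e : z - z' ∈ L') : qm h = qm h' := by
  refine LinearMap.ext fun x => ?_
  obtain ⟨y, rfl⟩ := Submodule.Quotient.mk_surjective _ x
  rw [qm_mk, qm_mk, Submodule.Quotient.eq, ← mul_sub]
  exact L'.smul_mem y e

end Compat

/-- Restriction of an element of the group ring to a set of group elements. -/
noncomputable def restr (p : G → Prop) : MonoidAlgebra ℤ G →+ MonoidAlgebra ℤ G := by
  classical
  exact (MonoidAlgebra.coeffAddEquiv.symm.toAddMonoidHom.comp
    (Finsupp.filterAddHom p)).comp MonoidAlgebra.coeffAddEquiv.toAddMonoidHom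

theorem restr_gr_pos (p : G → Prop) (g : G) (h : p g) : restr p (gr g) = gr g := by
  classical
  have : Finsupp.filterAddHom p (Finsupp.single g (1 : ℤ)) = Finsupp.single g 1 :=
    Finsupp.filter_single_of_pos p h
  simp only [restr, gr, AddMonoidHom.comp_apply]
  exact congrArg MonoidAlgebra.ofCoeff this

theorem restr_gr_neg (p : G → Prop) (g : G) (h : ¬ p g) : restr p (gr g) = 0 := by
  classical
  have : Finsupp.filterAddHom p (Finsupp.single g (1 : ℤ)) = 0 :=
    Finsupp.filter_single_of_neg p h
  simp only [restr, gr, AddMonoidHom.comp_apply]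
  exact congrArg MonoidAlgebra.ofCoeff this

/-- The norm element of a cyclic group. -/
noncomputable def nrm (n : ℕ) (a : G) : MonoidAlgebra ℤ G := ∑ i ∈ Finset.range n, gr a ^ i

theorem one_sub_mul_nrm (n : ℕ) (a : G) (ha : a ^ n = 1) : (1 - gr a) * nrm n a = 0 := by
  rw [nrm, mul_neg_geom_sum, ← gr_pow, ha, gr_one, sub_self]

theorem nrm_mul_one_sub (n : ℕ) (a : G) (ha : a ^ n = 1) : nrm n a * (1 - gr a) = 0 := by
  rw [nrm, geom_sum_mul_neg, ← gr_pow, ha, gr_one, sub_self]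

theorem aug_nrm (n : ℕ) (a : G) : aug G (nrm n a) = n := by
  simp [nrm, aug_single, gr]

theorem sum_restr {n : ℕ} [NeZero n] (χ : G →* Multiplicative (ZMod n)) (a : G) (ha : a ^ n = 1)
    (hχ : χ a = Multiplicative.ofAdd 1) (z : MonoidAlgebra ℤ G) :
    ∑ i ∈ Finset.range n, restr (fun g => χ g = 1) (z * gr a ^ (n - i)) * gr a ^ i = z := by
  induction z using ring_induction with
  | gr g =>
    have hchar : ∀ i ∈ Finset.range n, (χ (g * a ^ (n - i)) = 1 ↔ (i : ZMod n) = (χ g).toAdd) := by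
      intro i hi
      rw [map_mul, map_pow, hχ, ← ofAdd_nsmul, nsmul_eq_mul, mul_one,
        Nat.cast_sub (Finset.mem_range.1 hi).le, ZMod.natCast_self, zero_sub, ofAdd_neg,
        mul_inv_eq_one]
      exact ⟨fun h => by rw [h]; rfl, fun h => by rw [h]; rfl⟩
    rw [Finset.sum_eq_single ((χ g).toAdd.val)]
    · have hi : (χ g).toAdd.val ∈ Finset.range n := Finset.mem_range.2 (ZMod.val_lt _)
      rw [← gr_pow, ← gr_mul, restr_gr_pos (fun g => χ g = 1) _ ((hchar _ hi).2 (by simp)), ← gr_pow, ← gr_mul,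
        mul_assoc, ← pow_add, Nat.sub_add_cancel (Finset.mem_range.1 hi).le, ha, mul_one]
    · intro i hi hne
      rw [← gr_pow, ← gr_mul, restr_gr_neg, zero_mul]
      rw [hchar i hi]
      intro h
      apply hne
      rw [← h, ZMod.val_cast_of_lt (Finset.mem_range.1 hi)]
    · intro h
      exact absurd (Finset.mem_range.2 (ZMod.val_lt _)) h
  | add y z hy hz =>
    simp only [add_mul, map_add, Finset.sum_add_distrib, hy, hz]
  | neg y hy =>
    simp only [neg_mul, map_neg, Finset.sum_neg_distrib, hy]

/-- The periodic extension of modules attached to a cyclic group acting on the right. -/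
structure Cyc (n : ℕ) (L K J : Submodule (MonoidAlgebra ℤ G) (MonoidAlgebra ℤ G))
    (a N : MonoidAlgebra ℤ G) : Prop where
  L_le_K : L ≤ K
  L_le_J : L ≤ J
  K_N : Compat K N L
  J_a : Compat J (1 - a) L
  ses₁ : IsSES (qm K_N) (qm (compat_of_le L_le_J))
  ses₂ : IsSES (qm J_a) (qm (compat_of_le L_le_K))
  aug_K : ∀ y ∈ K, aug G y = 0
  aug_J : ∀ y ∈ J, (aug G y : ZMod n) = 0
  N_mem : N ∈ J
  aug_a : aug G a = 1
  aug_N : aug G N = n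
  N_sub : N - (n : MonoidAlgebra ℤ G) ∈ K

theorem cyc_of_character {n : ℕ} [NeZero n] (χ : G →* Multiplicative (ZMod n)) (a : G)
    (ha : a ^ n = 1) (hχ : χ a = Multiplicative.ofAdd 1)
    (L K : Submodule (MonoidAlgebra ℤ G) (MonoidAlgebra ℤ G))
    (hLa : Compat L (gr a) L) (hLe : ∀ z ∈ L, restr (fun g => χ g = 1) z ∈ L)
    (hLaug : ∀ z ∈ L, aug G z = 0)
    (hK : K = L ⊔ Submodule.span (MonoidAlgebra ℤ G) {1 - gr a}) :
    Cyc n L K (L ⊔ Submodule.span (MonoidAlgebra ℤ G) {nrm n a}) (gr a) (nrm n a) := by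
  have hLpow : ∀ i, Compat L (gr a ^ i) L := fun i => by
    induction i with
    | zero => rw [pow_zero]; exact compat_of_le le_rfl
    | succ i ih => rw [pow_succ]; exact ih.mul hLa
  have hLN : Compat L (nrm n a) L := fun y hy => by
    rw [nrm, Finset.mul_sum]
    exact sum_mem fun i _ => hLpow i y hy
  have hLD : Compat L (1 - gr a) L := fun y hy => by
    rw [mul_sub, mul_one]; exact sub_mem hy (hLa y hy)
  have L_le_K : L ≤ K := hK ▸ le_sup_left
  have K_N : Compat K (nrm n a) L := by
    rw [hK]
    refine hLN.sup (compat_span ?_)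
    rw [one_sub_mul_nrm n a ha]; exact L.zero_mem
  have J_a : Compat (L ⊔ Submodule.span (MonoidAlgebra ℤ G) {nrm n a}) (1 - gr a) L := by
    refine hLD.sup (compat_span ?_)
    rw [nrm_mul_one_sub n a ha]; exact L.zero_mem
  have pow_sub : ∀ i (y : MonoidAlgebra ℤ G),
      y * gr a ^ i - y ∈ Submodule.span (MonoidAlgebra ℤ G) {1 - gr a} := fun i y => by
    refine Submodule.mem_span_singleton.2 ⟨-(y * ∑ j ∈ Finset.range i, gr a ^ j), ?_⟩
    rw [smul_eq_mul, neg_mul, mul_assoc, geom_sum_mul_neg]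
    noncomm_ring
  have ker_N : ∀ y, y * nrm n a ∈ L → y ∈ K := fun y hy => by
    have h1 := sum_restr χ a ha hχ y
    have h2 : restr (fun g => χ g = 1) (y * nrm n a) =
        ∑ i ∈ Finset.range n, restr (fun g => χ g = 1) (y * gr a ^ (n - i)) := by
      rw [nrm, Finset.mul_sum, map_sum]
      obtain ⟨m, rfl⟩ : ∃ m, n = m + 1 := Nat.exists_eq_succ_of_ne_zero (NeZero.ne n)
      rw [← Finset.sum_range_reflect, Finset.sum_range_succ, Finset.sum_range_succ']
      congr 1
      · refine Finset.sum_congr rfl fun i hi => ?_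
        congr 3
        have := Finset.mem_range.1 hi
        lia
      · rw [Nat.sub_zero, ← gr_pow a (m + 1), ha, gr_one]; simp
    rw [hK, ← h1]
    have h3 : ∑ i ∈ Finset.range n, restr (fun g => χ g = 1) (y * gr a ^ (n - i)) * gr a ^ i =
        restr (fun g => χ g = 1) (y * nrm n a) + ∑ i ∈ Finset.range n,
          (restr (fun g => χ g = 1) (y * gr a ^ (n - i)) * gr a ^ i -
            restr (fun g => χ g = 1) (y * gr a ^ (n - i))) := by
      rw [Finset.sum_sub_distrib, h2]; abel
    rw [h3]
    exact Submodule.add_mem_sup (hLe _ hy) (sum_mem fun i _ => pow_sub _ _)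
  have ker_D : ∀ y, y * (1 - gr a) ∈ L → y ∈ L ⊔ Submodule.span (MonoidAlgebra ℤ G) {nrm n a} :=
      fun y hy => by
    have hp : ∀ i, y * gr a ^ i - y ∈ L := fun i => by
      induction i with
      | zero => simp
      | succ i ih =>
        have : y * gr a ^ (i + 1) - y = (y * gr a ^ i - y) * gr a - y * (1 - gr a) := by
          rw [pow_succ]; noncomm_ring
        rw [this]
        exact sub_mem (hLa _ ih) hy
    have h1 := sum_restr χ a ha hχ y
    have h3 : ∑ i ∈ Finset.range n, restr (fun g => χ g = 1) (y * gr a ^ (n - i)) * gr a ^ i =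
        ∑ i ∈ Finset.range n, restr (fun g => χ g = 1) (y * gr a ^ (n - i) - y) * gr a ^ i +
        restr (fun g => χ g = 1) y * nrm n a := by
      rw [nrm, Finset.mul_sum, ← Finset.sum_add_distrib]
      refine Finset.sum_congr rfl fun i _ => ?_
      rw [map_sub, sub_mul, sub_add_cancel]
    rw [← h1, h3]
    exact Submodule.add_mem_sup (sum_mem fun i _ => hLpow i _ (hLe _ (hp _)))
      (Submodule.mem_span_singleton.2 ⟨_, rfl⟩)
  refine ⟨L_le_K, le_sup_left, K_N, J_a, ⟨?_, ?_, ?_⟩, ⟨?_, ?_, ?_⟩, ?_, ?_, ?_, ?_, ?_, ?_⟩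
  · refine (injective_iff_map_eq_zero _).2 fun x hx => ?_
    obtain ⟨y, rfl⟩ := Submodule.Quotient.mk_surjective _ x
    rw [qm_mk, Submodule.Quotient.mk_eq_zero] at hx
    exact (Submodule.Quotient.mk_eq_zero _).2 (ker_N y hx)
  · intro x
    obtain ⟨y, rfl⟩ := Submodule.Quotient.mk_surjective _ x
    exact ⟨Submodule.Quotient.mk y, by rw [qm_mk, mul_one]⟩
  · intro x
    obtain ⟨y, rfl⟩ := Submodule.Quotient.mk_surjective _ x
    rw [qm_mk, mul_one, Submodule.Quotient.mk_eq_zero]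
    constructor
    · intro h
      obtain ⟨u, hu, v, hv, rfl⟩ := Submodule.mem_sup.1 h
      obtain ⟨w, rfl⟩ := Submodule.mem_span_singleton.1 hv
      refine ⟨Submodule.Quotient.mk w, ?_⟩
      rw [qm_mk, Submodule.Quotient.eq, smul_eq_mul, sub_add_cancel_right]
      exact neg_mem hu
    · rintro ⟨w, hw⟩
      obtain ⟨w, rfl⟩ := Submodule.Quotient.mk_surjective _ w
      rw [qm_mk, Submodule.Quotient.eq] at hw
      rw [← sub_sub_cancel (w * nrm n a) y]
      exact sub_mem (Submodule.mem_sup_right (Submodule.mem_span_singleton.2 ⟨w, rfl⟩))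
        (Submodule.mem_sup_left hw)
  · refine (injective_iff_map_eq_zero _).2 fun x hx => ?_
    obtain ⟨y, rfl⟩ := Submodule.Quotient.mk_surjective _ x
    rw [qm_mk, Submodule.Quotient.mk_eq_zero] at hx
    exact (Submodule.Quotient.mk_eq_zero _).2 (ker_D y hx)
  · intro x
    obtain ⟨y, rfl⟩ := Submodule.Quotient.mk_surjective _ x
    exact ⟨Submodule.Quotient.mk y, by rw [qm_mk, mul_one]⟩
  · intro x
    obtain ⟨y, rfl⟩ := Submodule.Quotient.mk_surjective _ x
    rw [qm_mk, mul_one, Submodule.Quotient.mk_eq_zero, hK]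
    constructor
    · intro h
      obtain ⟨u, hu, v, hv, rfl⟩ := Submodule.mem_sup.1 h
      obtain ⟨w, rfl⟩ := Submodule.mem_span_singleton.1 hv
      refine ⟨Submodule.Quotient.mk w, ?_⟩
      rw [qm_mk, Submodule.Quotient.eq, smul_eq_mul, sub_add_cancel_right]
      exact neg_mem hu
    · rintro ⟨w, hw⟩
      obtain ⟨w, rfl⟩ := Submodule.Quotient.mk_surjective _ w
      rw [qm_mk, Submodule.Quotient.eq] at hw
      rw [← sub_sub_cancel (w * (1 - gr a)) y]
      exact sub_mem (Submodule.mem_sup_right (Submodule.mem_span_singleton.2 ⟨w, rfl⟩))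
        (Submodule.mem_sup_left hw)
  · intro y hy
    rw [hK] at hy
    obtain ⟨u, hu, v, hv, rfl⟩ := Submodule.mem_sup.1 hy
    obtain ⟨w, rfl⟩ := Submodule.mem_span_singleton.1 hv
    simp [hLaug u hu, aug_single]
  · intro y hy
    obtain ⟨u, hu, v, hv, rfl⟩ := Submodule.mem_sup.1 hy
    obtain ⟨w, rfl⟩ := Submodule.mem_span_singleton.1 hv
    simp [hLaug u hu, aug_nrm]
  · exact Submodule.mem_sup_right (Submodule.mem_span_singleton_self _)
  · exact aug_single G a 1
  · exact aug_nrm n a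
  · rw [hK, nrm]
    refine Submodule.mem_sup_right ?_
    have : ∑ i ∈ Finset.range n, gr a ^ i - (n : MonoidAlgebra ℤ G) =
        ∑ i ∈ Finset.range n, (1 * gr a ^ i - 1) := by
      simp [Finset.sum_sub_distrib]
    rw [this]
    exact sum_mem fun i _ => pow_sub i 1

end GHom

namespace GHom

variable {G : Type} [Group G]

/-- Homology with coefficients in the cyclic module defined by a left ideal. -/
abbrev hl (q : ℕ) (L : Submodule (MonoidAlgebra ℤ G) (MonoidAlgebra ℤ G)) : Type :=
  hh G q (MonoidAlgebra ℤ G ⧸ L)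

section

variable {L L' L'' : Submodule (MonoidAlgebra ℤ G) (MonoidAlgebra ℤ G)} {z z' : MonoidAlgebra ℤ G}

/-- The map on homology induced by a right multiplication. -/
noncomputable abbrev hm (q : ℕ) (h : Compat L z L') : hl q L →+ hl q L' := hmap q (qm h)

theorem hm_hm (q : ℕ) (h : Compat L z L') (h' : Compat L' z' L'') (x : hl q L) :
    hm q h' (hm q h x) = hm q (h.mul h') x := by
  have := hmap_comp q (qm h') (qm h)
  rw [qm_comp] at this
  exact (DFunLike.congr_fun this x).symm

theorem hm_congr (q : ℕ) (h : Compat L z L') (h' : Compat L z' L') (e : z - z' ∈ L')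
    (x : hl q L) : hm q h x = hm q h' x := by
  rw [hm, qm_congr h h' e]

theorem hm_eq_zero (q : ℕ) (h : Compat L z L') (e : z ∈ L') (x : hl q L) : hm q h x = 0 := by
  have : qm h = 0 := by
    refine LinearMap.ext fun x => ?_
    obtain ⟨y, rfl⟩ := Submodule.Quotient.mk_surjective _ x
    exact (Submodule.Quotient.mk_eq_zero _).2 (L'.smul_mem y e)
  rw [hm, this, hmap_zero]; rfl

theorem hm_eq_self (q : ℕ) (h : Compat L z L) (e : z - 1 ∈ L) (x : hl q L) : hm q h x = x := by
  have : qm h = LinearMap.id := by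
    refine LinearMap.ext fun x => ?_
    obtain ⟨y, rfl⟩ := Submodule.Quotient.mk_surjective _ x
    rw [qm_mk, LinearMap.id_apply, Submodule.Quotient.eq]
    have := L.smul_mem y e
    rwa [smul_eq_mul, mul_sub, mul_one] at this
  rw [hm, this, hmap_id]; rfl

theorem hm_add (q : ℕ) (h : Compat L z L') (h' : Compat L z' L') (h'' : Compat L (z + z') L')
    (x : hl q L) : hm q h'' x = hm q h x + hm q h' x := by
  have : qm h'' = qm h + qm h' := by
    refine LinearMap.ext fun x => ?_
    obtain ⟨y, rfl⟩ := Submodule.Quotient.mk_surjective _ x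
    rw [LinearMap.add_apply, qm_mk, qm_mk, qm_mk, mul_add]; rfl
  rw [hm, this, hmap_add]; rfl

/-- The canonical generator of degree zero homology. -/
noncomputable def hu (L : Submodule (MonoidAlgebra ℤ G) (MonoidAlgebra ℤ G)) : hl 0 L :=
  h0mk G _ (Submodule.Quotient.mk 1)

theorem h0mk_mk (L : Submodule (MonoidAlgebra ℤ G) (MonoidAlgebra ℤ G)) (y : MonoidAlgebra ℤ G) :
    h0mk G (MonoidAlgebra ℤ G ⧸ L) (Submodule.Quotient.mk y) = aug G y • hu L := by
  induction y using ring_induction with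
  | gr g =>
    rw [aug_single, one_smul, hu, ← h0mk_smul g (Submodule.Quotient.mk 1), ← Submodule.Quotient.mk_smul,
      smul_eq_mul, mul_one]
  | add y z hy hz => rw [Submodule.Quotient.mk_add, map_add, hy, hz, map_add, add_smul]
  | neg y hy => rw [Submodule.Quotient.mk_neg, map_neg, hy, map_neg, neg_smul]

theorem hl_zero_eq (x : hl 0 L) : ∃ k : ℤ, x = k • hu L := by
  obtain ⟨m, rfl⟩ := h0mk_surjective x
  obtain ⟨y, rfl⟩ := Submodule.Quotient.mk_surjective _ m
  exact ⟨_, h0mk_mk L y⟩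

theorem hm_hu (h : Compat L z L') : hm 0 h (hu L) = aug G z • hu L' := by
  rw [hu, hm, hmap_h0mk, qm_mk, one_mul, h0mk_mk]

theorem exists_aug_lift (A : Type) [AddCommGroup A] (φ : ℤ →+ A)
    (hL : ∀ y ∈ L, φ (aug G y) = 0) : ∃ f : hl 0 L →+ A, f (hu L) = φ 1 := by
  have hker : L.toAddSubgroup ≤ (φ.comp (aug G).toAddMonoidHom).ker := fun y hy => hL y hy
  let f : (MonoidAlgebra ℤ G ⧸ L) →+ A :=
    QuotientAddGroup.lift L.toAddSubgroup (φ.comp (aug G).toAddMonoidHom) hker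
  have hf : ∀ y, f (Submodule.Quotient.mk y) = φ (aug G y) := fun y => rfl
  refine ⟨h0lift f ?_, ?_⟩
  · intro g m
    obtain ⟨y, rfl⟩ := Submodule.Quotient.mk_surjective _ m
    rw [← Submodule.Quotient.mk_smul, hf, hf]
    simp [aug_single]
  · rw [hu, h0lift_h0mk, hf, map_one]

theorem zsmul_hu_eq_zero (hL : ∀ y ∈ L, aug G y = 0) (k : ℤ) : k • hu L = 0 ↔ k = 0 := by
  refine ⟨fun h => ?_, fun h => by rw [h, zero_smul]⟩
  obtain ⟨f, hf⟩ := exists_aug_lift (L := L) ℤ (AddMonoidHom.id ℤ) hL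
  have := congrArg f h
  simpa [hf] using this

theorem zsmul_hu_eq_zero_mod {n : ℕ} {N : MonoidAlgebra ℤ G} (hN : N ∈ L) (hn : aug G N = n)
    (hL : ∀ y ∈ L, (aug G y : ZMod n) = 0) (k : ℤ) : k • hu L = 0 ↔ (k : ZMod n) = 0 := by
  constructor
  · intro h
    obtain ⟨f, hf⟩ := exists_aug_lift (L := L) (ZMod n) (Int.castAddHom _) hL
    have := congrArg f h
    simpa [hf] using this
  · intro h
    obtain ⟨m, rfl⟩ := (ZMod.intCast_zmod_eq_zero_iff_dvd k n).1 h
    have h1 : (n : ℤ) • hu L = 0 := by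
      rw [← hn, ← h0mk_mk, (Submodule.Quotient.mk_eq_zero _).2 hN, map_zero]
    rw [mul_comm, mul_smul, h1, smul_zero]

theorem hl_bot_subsingleton (q : ℕ) :
    Subsingleton (hl (q + 1) (⊥ : Submodule (MonoidAlgebra ℤ G) (MonoidAlgebra ℤ G))) := by
  let e := Submodule.quotEquivOfEqBot (⊥ : Submodule (MonoidAlgebra ℤ G) (MonoidAlgebra ℤ G)) rfl
  have := hh_free_subsingleton (G := G) q
  refine ⟨fun x y => ?_⟩
  have key : ∀ x, hmap (q + 1) e.symm.toLinearMap (hmap (q + 1) e.toLinearMap x) = x := fun x => by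
    have := hmap_comp (q + 1) e.symm.toLinearMap e.toLinearMap
    rw [LinearEquiv.symm_comp, hmap_id] at this
    exact (DFunLike.congr_fun this x).symm
  rw [← key x, ← key y, Subsingleton.elim (hmap (q + 1) e.toLinearMap x)]

end

section Cyc

variable {n n' : ℕ} {L K J L' K' J' : Submodule (MonoidAlgebra ℤ G) (MonoidAlgebra ℤ G)}
  {a N a' N' m : MonoidAlgebra ℤ G}

/-- Right multiplication by `m` is a morphism of periodic extensions. -/
structure CycHom (c : Cyc n L K J a N) (c' : Cyc n' L' K' J' a' N') (m : MonoidAlgebra ℤ G) :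
    Prop where
  hL : Compat L m L'
  hK : Compat K m K'
  hJ : Compat J m J'
  hN : N * m - m * N' ∈ L'
  ha : a * m - m * a' ∈ L'

theorem CycHom.δ₁ {c : Cyc n L K J a N} {c' : Cyc n' L' K' J' a' N'} (f : CycHom c c' m) (q : ℕ)
    (x : hl (q + 1) J) : c'.ses₁.δ q (hm (q + 1) f.hJ x) = hm q f.hK (c.ses₁.δ q x) := by
  refine IsSES.δ_nat c.ses₁ c'.ses₁ (qm f.hK) (qm f.hL) (qm f.hJ) ?_ ?_ q x
  · rw [qm_comp, qm_comp]
    exact qm_congr _ _ f.hN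
  · rw [qm_comp, qm_comp]
    exact qm_congr _ _ (by simp)

theorem CycHom.δ₂ {c : Cyc n L K J a N} {c' : Cyc n' L' K' J' a' N'} (f : CycHom c c' m) (q : ℕ)
    (x : hl (q + 1) K) : c'.ses₂.δ q (hm (q + 1) f.hK x) = hm q f.hJ (c.ses₂.δ q x) := by
  refine IsSES.δ_nat c.ses₂ c'.ses₂ (qm f.hJ) (qm f.hL) (qm f.hK) ?_ ?_ q x
  · rw [qm_comp, qm_comp]
    refine qm_congr _ _ ?_
    rw [sub_mul, mul_sub, one_mul, mul_one, sub_sub_sub_cancel_left, ← neg_sub]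
    exact neg_mem f.ha
  · rw [qm_comp, qm_comp]
    exact qm_congr _ _ (by simp)

theorem Cyc.δ₁_injective (c : Cyc n ⊥ K J a N) (q : ℕ) : Function.Injective (c.ses₁.δ q) := by
  refine (injective_iff_map_eq_zero _).2 fun x hx => ?_
  obtain ⟨y, rfl⟩ := (c.ses₁.exact₃ q x).1 hx
  have := hl_bot_subsingleton (G := G) q
  rw [Subsingleton.elim y 0, map_zero]

theorem Cyc.δ₂_injective (c : Cyc n ⊥ K J a N) (q : ℕ) : Function.Injective (c.ses₂.δ q) := by
  refine (injective_iff_map_eq_zero _).2 fun x hx => ?_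
  obtain ⟨y, rfl⟩ := (c.ses₂.exact₃ q x).1 hx
  have := hl_bot_subsingleton (G := G) q
  rw [Subsingleton.elim y 0, map_zero]

theorem Cyc.δ₁_bijective (c : Cyc n ⊥ K J a N) (q : ℕ) :
    Function.Bijective (c.ses₁.δ (q + 1)) := by
  refine ⟨c.δ₁_injective _, fun x => (c.ses₁.exact₁ (q + 1) x).1 ?_⟩
  have := hl_bot_subsingleton (G := G) q
  exact Subsingleton.elim _ _

theorem Cyc.δ₂_bijective (c : Cyc n ⊥ K J a N) (q : ℕ) : Function.Bijective (c.ses₂.δ q) := by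
  refine ⟨c.δ₂_injective _, fun x => (c.ses₂.exact₁ q x).1 ?_⟩
  cases q with
  | succ q =>
    have := hl_bot_subsingleton (G := G) q
    exact Subsingleton.elim _ _
  | zero =>
    obtain ⟨k, rfl⟩ := hl_zero_eq x
    rw [map_zsmul]
    have := hm_hu c.J_a
    rw [map_sub, map_one, c.aug_a, sub_self, zero_smul] at this
    exact (congrArg (k • ·) this).trans (smul_zero _)

theorem Cyc.mul_injective (c : Cyc n L K J a N) (hn : n ≠ 0) :
    Function.Injective (hm 0 c.K_N) := by
  refine (injective_iff_map_eq_zero _).2 fun x hx => ?_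
  obtain ⟨k, rfl⟩ := hl_zero_eq x
  rw [map_zsmul, hm_hu, c.aug_N, smul_smul,
    zsmul_hu_eq_zero (fun y hy => c.aug_K y (c.L_le_K hy))] at hx
  rcases mul_eq_zero.1 hx with h | h
  · rw [h, zero_smul]
  · exact absurd h (by exact_mod_cast hn)

theorem Cyc.J_one (c : Cyc n ⊥ K J a N) (hn : n ≠ 0) : Subsingleton (hl 1 J) := by
  have h0 : ∀ x, c.ses₁.δ 0 x = 0 := fun x => by
    apply c.mul_injective hn
    rw [map_zero]
    exact (c.ses₁.exact₁ 0).apply_apply_eq_zero x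
  exact ⟨fun x y => c.δ₁_injective 0 ((h0 x).trans (h0 y).symm)⟩

theorem Cyc.card_J_zero (c : Cyc n L K J a N) : Nat.card (hl 0 J) = n := by
  obtain ⟨f, hf⟩ := exists_aug_lift (L := J) (ZMod n) (Int.castAddHom _) c.aug_J
  have hb : Function.Bijective f := by
    constructor
    · refine (injective_iff_map_eq_zero _).2 fun x hx => ?_
      obtain ⟨k, rfl⟩ := hl_zero_eq x
      rw [zsmul_hu_eq_zero_mod c.N_mem c.aug_N c.aug_J]
      simpa [hf] using hx
    · intro y
      obtain ⟨k, rfl⟩ := ZMod.intCast_surjective y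
      exact ⟨k • hu J, by simp [hf]⟩
  rw [Nat.card_congr (Equiv.ofBijective f hb), Nat.card_zmod]

theorem Cyc.card_even_odd (c : Cyc n ⊥ K J a N) (hn : n ≠ 0) (k : ℕ) :
    Nat.card (hl (2 * k) J) = n ∧ Nat.card (hl (2 * k + 1) J) = 1 ∧
      Nat.card (hl (2 * k + 1) K) = n ∧ Nat.card (hl (2 * k + 2) K) = 1 := by
  have s₁ : ∀ q, Nat.card (hl (q + 2) J) = Nat.card (hl (q + 1) K) := fun q =>
    Nat.card_congr (Equiv.ofBijective _ (c.δ₁_bijective q))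
  have s₂ : ∀ q, Nat.card (hl (q + 1) K) = Nat.card (hl q J) := fun q =>
    Nat.card_congr (Equiv.ofBijective _ (c.δ₂_bijective q))
  have h1 : Nat.card (hl 1 J) = 1 := by
    have := c.J_one hn
    exact Nat.card_unique
  induction k with
  | zero => exact ⟨c.card_J_zero, h1, (s₂ 0).trans c.card_J_zero, (s₂ 1).trans h1⟩
  | succ k ih =>
    obtain ⟨-, -, i1, i2⟩ := ih
    have e1 := (s₁ (2 * k)).trans i1
    have e2 := (s₁ (2 * k + 1)).trans i2
    exact ⟨e1, e2, (s₂ (2 * k + 2)).trans e1, (s₂ (2 * k + 3)).trans e2⟩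

theorem CycHom.detect {c : Cyc n ⊥ K J a N} {c' : Cyc n L' K' J' a' N'} (f : CycHom c c' 1)
    (q : ℕ) : Function.Injective (hm q f.hJ) ∧ Function.Injective (hm q f.hK) := by
  simp only [injective_iff_map_eq_zero]
  induction q with
  | zero =>
    constructor
    · intro x hx
      obtain ⟨k, rfl⟩ := hl_zero_eq x
      rw [map_zsmul, hm_hu, map_one, one_smul,
        zsmul_hu_eq_zero_mod c'.N_mem c'.aug_N c'.aug_J] at hx
      rwa [zsmul_hu_eq_zero_mod c.N_mem c.aug_N c.aug_J]
    · intro x hx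
      obtain ⟨k, rfl⟩ := hl_zero_eq x
      rw [map_zsmul, hm_hu, map_one, one_smul, zsmul_hu_eq_zero c'.aug_K] at hx
      rw [hx, zero_smul]
  | succ q ih =>
    constructor
    · intro x hx
      have := f.δ₁ q x
      rw [hx, map_zero] at this
      exact (injective_iff_map_eq_zero _).1 (c.δ₁_injective q) x (ih.2 _ this.symm)
    · intro x hx
      have := f.δ₂ q x
      rw [hx, map_zero] at this
      exact (injective_iff_map_eq_zero _).1 (c.δ₂_injective q) x (ih.1 _ this.symm)

theorem Cyc.δ₂_of_le (c : Cyc n L K J a N) (h : Compat L' m K) (h' : Compat L' m L) (q : ℕ)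
    (x : hl (q + 1) L') : c.ses₂.δ q (hm (q + 1) h x) = 0 := by
  have := hm_hm (q + 1) h' (compat_of_le c.L_le_K) x
  rw [hm_congr (q + 1) h (h'.mul (compat_of_le c.L_le_K)) (by simp), ← this]
  exact (c.ses₂.exact₃ q).apply_apply_eq_zero _

end Cyc

end GHom

namespace GHom

variable {G : Type} [Group G]

theorem restr_mul_gr (p : G → Prop) (h : G) (hp : ∀ g, p (g * h) ↔ p g) (z : MonoidAlgebra ℤ G) :
    restr p (z * gr h) = restr p z * gr h := by
  induction z using ring_induction with
  | gr g =>
    by_cases hg : p g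
    · rw [← gr_mul, restr_gr_pos p _ ((hp g).2 hg), restr_gr_pos p _ hg, gr_mul]
    · rw [← gr_mul, restr_gr_neg p _ (fun h => hg ((hp g).1 h)), restr_gr_neg p _ hg, zero_mul]
  | add y z hy hz => rw [add_mul, map_add, hy, hz, map_add, add_mul]
  | neg y hy => rw [neg_mul, map_neg, hy, map_neg, neg_mul]

/-- The left ideal generated by `1 - a`. -/
noncomputable def La (a : G) : Submodule (MonoidAlgebra ℤ G) (MonoidAlgebra ℤ G) :=
  Submodule.span _ {1 - gr a}

/-- The left ideal generated by `1 - h` for `h` in a subgroup. -/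
noncomputable def Ls (H : Subgroup G) : Submodule (MonoidAlgebra ℤ G) (MonoidAlgebra ℤ G) :=
  Submodule.span _ ((fun h => 1 - gr h) '' (H : Set G))

theorem La_le {a : G} {L : Submodule (MonoidAlgebra ℤ G) (MonoidAlgebra ℤ G)} (h : 1 - gr a ∈ L) :
    La a ≤ L := Submodule.span_le.2 (by simpa using h)

theorem mem_La (a : G) : 1 - gr a ∈ La a := Submodule.mem_span_singleton_self _

theorem mem_Ls {H : Subgroup G} {h : G} (hh : h ∈ H) : 1 - gr h ∈ Ls H :=
  Submodule.subset_span ⟨h, hh, rfl⟩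

theorem gr_sub_gr_mem_Ls {H : Subgroup G} {g h : G} (e : g⁻¹ * h ∈ H) : gr g - gr h ∈ Ls H := by
  have := (Ls H).smul_mem (gr g) (mem_Ls e)
  rwa [smul_eq_mul, mul_sub, mul_one, ← gr_mul, mul_inv_cancel_left] at this

theorem compat_Ls {H : Subgroup G} [H.Normal] (z : MonoidAlgebra ℤ G) : Compat (Ls H) z (Ls H) := by
  intro y hy
  induction hy using Submodule.span_induction with
  | mem y hy =>
    obtain ⟨h, hh, rfl⟩ := hy
    induction z using ring_induction with
    | gr g =>
      have e : (1 - gr h) * gr g = gr g - gr (h * g) := by rw [sub_mul, one_mul, ← gr_mul]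
      rw [show (fun h => 1 - gr h) h * gr g = _ from e]
      refine gr_sub_gr_mem_Ls ?_
      rw [← mul_assoc]
      simpa using ‹H.Normal›.conj_mem h hh g⁻¹
    | add y z hy hz => rw [mul_add]; exact add_mem hy hz
    | neg y hy => rw [mul_neg]; exact neg_mem hy
  | zero => rw [zero_mul]; exact zero_mem _
  | add x y _ _ hx hy => rw [add_mul]; exact add_mem hx hy
  | smul a x _ hx => rw [smul_eq_mul, mul_assoc]; exact (Ls H).smul_mem a hx

theorem aug_Ls {H : Subgroup G} : ∀ y ∈ Ls H, aug G y = 0 := by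
  intro y hy
  induction hy using Submodule.span_induction with
  | mem y hy =>
    obtain ⟨h, hh, rfl⟩ := hy
    simp [aug_single]
  | zero => rw [map_zero]
  | add x y _ _ hx hy => rw [map_add, hx, hy, add_zero]
  | smul a x _ hx => rw [smul_eq_mul, map_mul, hx, mul_zero]

theorem restr_Ls {n : ℕ} (χ : G →* Multiplicative (ZMod n)) {H : Subgroup G} (hH : H ≤ χ.ker) :
    ∀ y ∈ Ls H, restr (fun g => χ g = 1) y ∈ Ls H := by
  have key : ∀ (h : G), h ∈ H → ∀ z : MonoidAlgebra ℤ G,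
      restr (fun g => χ g = 1) (z * (1 - gr h)) ∈ Ls H := fun h hh z => by
    rw [mul_sub, mul_one, map_sub, restr_mul_gr]
    · have := (Ls H).smul_mem (restr (fun g => χ g = 1) z) (mem_Ls hh)
      rwa [smul_eq_mul, mul_sub, mul_one] at this
    · intro g
      rw [map_mul, show χ h = 1 from hH hh, mul_one]
  intro y hy
  obtain ⟨c, rfl⟩ := (Finsupp.mem_span_iff_linearCombination _ _ _).1 hy
  rw [Finsupp.linearCombination_apply, Finsupp.sum, map_sum]
  refine sum_mem fun i _ => ?_
  obtain ⟨i, h, hh, rfl⟩ := i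
  exact key h hh _

theorem La_eq_Ls (a : G) : La a = Ls (Subgroup.zpowers a) := by
  refine le_antisymm (La_le (mem_Ls (Subgroup.mem_zpowers a))) (Submodule.span_le.2 ?_)
  rintro _ ⟨h, hh, rfl⟩
  have : ∀ h ∈ Subgroup.closure {a}, 1 - gr h ∈ La a := fun h hh => by
    induction hh using Subgroup.closure_induction with
    | mem x hx => rw [Set.mem_singleton_iff.1 hx]; exact mem_La a
    | one => rw [gr_one, sub_self]; exact zero_mem _
    | mul x y _ _ hx hy =>
      have := add_mem hx ((La a).smul_mem (gr x) hy)
      rw [gr_mul]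
      convert this using 1
      rw [smul_eq_mul]; noncomm_ring
    | inv x _ hx =>
      have := neg_mem ((La a).smul_mem (gr x⁻¹) hx)
      rwa [smul_eq_mul, mul_sub, mul_one, ← gr_mul, inv_mul_cancel, gr_one, neg_sub] at this
  rw [SetLike.mem_coe, ← Subgroup.zpowers_eq_closure] at *
  exact this h hh

/-- The augmentation ideal. -/
noncomputable abbrev Ia (G : Type) [Group G] : Submodule (MonoidAlgebra ℤ G) (MonoidAlgebra ℤ G) :=
  Ls (⊤ : Subgroup G)

theorem La_le_Ia (a : G) : La a ≤ Ia G := La_le (mem_Ls (Subgroup.mem_top a))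

theorem mem_Ia_iff (z : MonoidAlgebra ℤ G) : z ∈ Ia G ↔ aug G z = 0 := by
  refine ⟨aug_Ls z, fun h => ?_⟩
  have : ∀ z : MonoidAlgebra ℤ G, z - (aug G z : MonoidAlgebra ℤ G) ∈ Ia G := fun z => by
    induction z using ring_induction with
    | gr g =>
      rw [aug_single, Int.cast_one, ← neg_sub]
      exact neg_mem (mem_Ls (Subgroup.mem_top g))
    | add y z hy hz =>
      rw [map_add, Int.cast_add, add_sub_add_comm]
      exact add_mem hy hz
    | neg y hy =>
      rw [map_neg, Int.cast_neg, ← neg_add', ← sub_eq_add_neg]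
      exact neg_mem hy
  simpa [h] using this z

section Character

variable {n : ℕ} [NeZero n] (χ : G →* Multiplicative (ZMod n))

theorem cycD (a : G) (ha : a ^ n = 1) (hχ : χ a = Multiplicative.ofAdd 1) :
    Cyc n ⊥ (La a) (⊥ ⊔ Submodule.span (MonoidAlgebra ℤ G) {nrm n a}) (gr a) (nrm n a) :=
  cyc_of_character χ a ha hχ ⊥ (La a) compat_bot (fun z hz => by
    rw [(Submodule.mem_bot _).1 hz, map_zero]; exact zero_mem _) (fun z hz => by
    rw [(Submodule.mem_bot _).1 hz, map_zero]) (by rw [bot_sup_eq]; rfl)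

theorem cycT (a : G) (ha : a ^ n = 1) (hχ : χ a = Multiplicative.ofAdd 1) :
    Cyc n (Ls χ.ker) (Ia G) (Ls χ.ker ⊔ Submodule.span (MonoidAlgebra ℤ G) {nrm n a})
      (gr a) (nrm n a) :=
  cyc_of_character χ a ha hχ _ _ (compat_Ls _) (restr_Ls χ le_rfl) aug_Ls (by
    refine le_antisymm (Submodule.span_le.2 ?_) (sup_le (Submodule.span_mono (by
      intro x; rintro ⟨h, -, rfl⟩; exact ⟨h, Subgroup.mem_top h, rfl⟩)) (La_le_Ia a))
    rintro _ ⟨g, -, rfl⟩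
    have h1 : 1 - gr (a ^ (χ g).toAdd.val) ∈ La a := by
      rw [La_eq_Ls]; exact mem_Ls (Subgroup.npow_mem_zpowers a _)
    have h2 : gr (a ^ (χ g).toAdd.val) - gr g ∈ Ls χ.ker := by
      refine gr_sub_gr_mem_Ls ?_
      rw [MonoidHom.mem_ker, map_mul, map_inv, map_pow, hχ, ← ofAdd_nsmul, nsmul_eq_mul, mul_one,
        ZMod.natCast_zmod_val]
      simp
    have := Submodule.add_mem_sup h2 h1
    rwa [show gr (a ^ (χ g).toAdd.val) - gr g + (1 - gr (a ^ (χ g).toAdd.val)) = 1 - gr g by abel]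
      at this)

variable {χ}

theorem cycHom_DT {a a' : G} (ha : a ^ n = 1) (hχ : χ a = Multiplicative.ofAdd 1)
    (ha' : a' ^ n = 1) (hχ' : χ a' = Multiplicative.ofAdd 1) :
    CycHom (cycD χ a ha hχ) (cycT χ a' ha' hχ') 1 := by
  have hp : ∀ i : ℕ, gr a ^ i - gr a' ^ i ∈ Ls χ.ker := fun i => by
    rw [← gr_pow, ← gr_pow]
    refine gr_sub_gr_mem_Ls ?_
    rw [MonoidHom.mem_ker, map_mul, map_inv, map_pow, map_pow, hχ, hχ', inv_mul_cancel]
  have hN : nrm n a - nrm n a' ∈ Ls χ.ker := by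
    rw [nrm, nrm, ← Finset.sum_sub_distrib]
    exact sum_mem fun i _ => hp i
  refine ⟨compat_bot, compat_of_le (La_le_Ia a), ?_, ?_, ?_⟩
  · refine compat_bot.sup (compat_span ?_)
    rw [mul_one, ← sub_add_cancel (nrm n a) (nrm n a')]
    exact Submodule.add_mem_sup hN (Submodule.mem_span_singleton_self _)
  · rw [mul_one, one_mul]; exact hN
  · rw [mul_one, one_mul]; simpa using hp 1

theorem La_detect {a : G} (ha : a ^ n = 1) (hχ : χ a = Multiplicative.ofAdd 1) (q : ℕ) :
    Function.Injective (hm q (compat_of_le (La_le_Ia a))) :=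
  ((cycHom_DT ha hχ ha hχ).detect q).2

theorem La_detect_pair {a a' : G} (ha : a ^ n = 1) (hχ : χ a = Multiplicative.ofAdd 1)
    (ha' : χ a' = 1) (q : ℕ) (x : hl (q + 1) (La a)) (y : hl (q + 1) (La a'))
    (h : hm (q + 1) (compat_of_le (La_le_Ia a)) x + hm (q + 1) (compat_of_le (La_le_Ia a')) y = 0) :
    x = 0 := by
  have f := cycHom_DT ha hχ ha hχ
  have h1 := congrArg ((cycT χ a ha hχ).ses₂.δ q) h
  rw [map_add, map_zero, (cycT χ a ha hχ).δ₂_of_le (L' := La a') _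
    (compat_of_le (La_le (mem_Ls (H := χ.ker) ha'))), add_zero, f.δ₂ q x] at h1
  exact (injective_iff_map_eq_zero _).1 ((cycD χ a ha hχ).δ₂_injective q) x
    ((injective_iff_map_eq_zero _).1 (f.detect q).1 _ h1)

theorem La_subsingleton {a : G} (ha : a ^ n = 1) (hχ : χ a = Multiplicative.ofAdd 1) (k : ℕ) :
    Subsingleton (hl (2 * k + 2) (La a)) :=
  (Nat.card_eq_one_iff_unique.1 ((cycD χ a ha hχ).card_even_odd (NeZero.ne n) k).2.2.2).1

theorem La_card {a : G} (ha : a ^ n = 1) (hχ : χ a = Multiplicative.ofAdd 1) (k : ℕ) :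
    Nat.card (hl (2 * k + 1) (La a)) = n :=
  ((cycD χ a ha hχ).card_even_odd (NeZero.ne n) k).2.2.1

end Character

theorem Cyc.nsmul_eq {n : ℕ} {L K J : Submodule (MonoidAlgebra ℤ G) (MonoidAlgebra ℤ G)}
    {a N : MonoidAlgebra ℤ G} (c : Cyc n L K J a N) (q : ℕ) (x : hl q K) :
    n • x = hm q (compat_of_le c.L_le_K) (hm q c.K_N x) := by
  have key : ∀ (m : ℕ) (h : Compat K (m : MonoidAlgebra ℤ G) K), hm q h x = m • x := fun m => by
    induction m with
    | zero => intro h; rw [hm_eq_zero q h (by simp), zero_smul]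
    | succ m ih =>
      intro h
      have h' : Compat K (m : MonoidAlgebra ℤ G) K := fun y hy => by
        rw [← nsmul_eq_mul']; exact K.nsmul_mem hy m
      have h1 : Compat K (m + 1 : MonoidAlgebra ℤ G) K := by simpa using h
      rw [hm_congr q h h1 (by simp), hm_add q h' (compat_of_le le_rfl) h1, ih h',
        hm_eq_self q (compat_of_le le_rfl) (by simp), add_smul, one_smul]
  have h : Compat K (n : MonoidAlgebra ℤ G) K := fun y hy => by
    rw [← nsmul_eq_mul']; exact K.nsmul_mem hy n
  rw [hm_hm, ← key n h]
  refine hm_congr q _ _ ?_ x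
  rw [mul_one, ← neg_sub]
  exact neg_mem c.N_sub

theorem La_nsmul {n : ℕ} [NeZero n] {χ : G →* Multiplicative (ZMod n)} {a : G} (ha : a ^ n = 1)
    (hχ : χ a = Multiplicative.ofAdd 1) (q : ℕ) (x : hl (q + 1) (La a)) : n • x = 0 := by
  have := hl_bot_subsingleton (G := G) q
  rw [(cycD χ a ha hχ).nsmul_eq, Subsingleton.elim (hm (q + 1) _ x) 0, map_zero]

end GHom

namespace GHom

variable {G : Type} [Group G]

theorem card_of_exact {A B C : Type} [AddCommGroup A] [AddCommGroup B] [AddCommGroup C]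
    (f : A →+ B) (g : B →+ C) (hf : Function.Injective f) (hg : Function.Surjective g)
    (h : Function.Exact f g) : Nat.card B = Nat.card A * Nat.card C := by
  rw [AddSubgroup.card_eq_card_quotient_mul_card_addSubgroup g.ker,
    Nat.card_congr (QuotientAddGroup.quotientKerEquivOfSurjective g hg).toEquiv, mul_comm]
  congr 1
  have : g.ker = f.range := by
    ext x; exact h x
  rw [this]
  exact (Nat.card_congr (AddMonoidHom.ofInjective hf).toEquiv).symm

/-- Two commuting involutions separated by a pair of characters. -/
structure Klein (s t : G) (χs χt : G →* Multiplicative (ZMod 2)) : Prop where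
  s_sq : s * s = 1
  t_sq : t * t = 1
  comm : s * t = t * s
  s_s : χs s = Multiplicative.ofAdd 1
  s_t : χs t = 1
  t_s : χt s = 1
  t_t : χt t = Multiplicative.ofAdd 1

namespace Klein

variable {s t : G} {χs χt : G →* Multiplicative (ZMod 2)}

theorem symm (k : Klein s t χs χt) : Klein t s χt χs :=
  ⟨k.t_sq, k.s_sq, k.comm.symm, k.t_t, k.t_s, k.s_t, k.s_s⟩

theorem s_pow (k : Klein s t χs χt) : s ^ 2 = 1 := by rw [pow_two, k.s_sq]

theorem t_pow (k : Klein s t χs χt) : t ^ 2 = 1 := by rw [pow_two, k.t_sq]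

theorem gr_comm (k : Klein s t χs χt) : gr s * gr t = gr t * gr s := by
  rw [← gr_mul, k.comm, gr_mul]

theorem cyc (k : Klein s t χs χt) : Cyc 2 (La s) (La s ⊔ La t)
    (La s ⊔ Submodule.span (MonoidAlgebra ℤ G) {nrm 2 t}) (gr t) (nrm 2 t) := by
  refine cyc_of_character χt t k.t_pow k.t_t _ _ ?_ ?_ ?_ rfl
  · refine compat_span ?_
    rw [sub_mul, one_mul, k.gr_comm]
    have := (La s).smul_mem (gr t) (mem_La s)
    rwa [smul_eq_mul, mul_sub, mul_one] at this
  · rw [La_eq_Ls]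
    exact restr_Ls χt (by rw [Subgroup.zpowers_le]; exact k.t_s)
  · rw [La_eq_Ls]; exact aug_Ls

theorem cyc' (k : Klein s t χs χt) : Cyc 2 (La t) (La s ⊔ La t)
    (La t ⊔ Submodule.span (MonoidAlgebra ℤ G) {nrm 2 s}) (gr s) (nrm 2 s) := by
  rw [sup_comm]; exact k.symm.cyc

theorem cycHom (k : Klein s t χs χt) : CycHom k.cyc' (cycD χs s k.s_pow k.s_s) (nrm 2 t) := by
  have hc : ∀ z : MonoidAlgebra ℤ G, z = 1 - gr s ∨ z = nrm 2 s ∨ z = gr s →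
      z * nrm 2 t = nrm 2 t * z := by
    have : gr s * nrm 2 t = nrm 2 t * gr s := by
      simp [nrm, Finset.sum_range_succ, mul_add, add_mul, k.gr_comm]
    rintro z (rfl | rfl | rfl)
    · rw [sub_mul, mul_sub, one_mul, mul_one, this]
    · rw [show nrm 2 s = 1 + gr s by simp [nrm, Finset.sum_range_succ, gr_one], add_mul, mul_add, one_mul,
        mul_one, this]
    · exact this
  have h0 : Compat (La t) (nrm 2 t) (⊥ : Submodule (MonoidAlgebra ℤ G) (MonoidAlgebra ℤ G)) :=
    compat_span (by rw [one_sub_mul_nrm 2 t k.t_pow]; exact zero_mem _)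
  have h0' : ∀ K : Submodule (MonoidAlgebra ℤ G) (MonoidAlgebra ℤ G), Compat (La t) (nrm 2 t) K :=
    fun K => compat_span (by rw [one_sub_mul_nrm 2 t k.t_pow]; exact zero_mem _)
  refine ⟨h0, Compat.sup (compat_span ?_) (h0' _), (h0' _).sup (compat_span ?_), ?_, ?_⟩
  · rw [hc _ (.inl rfl)]
    exact (La s).smul_mem _ (mem_La s)
  · rw [hc _ (.inr (.inl rfl)), bot_sup_eq]
    exact Submodule.smul_mem _ _ (Submodule.mem_span_singleton_self _)
  · rw [hc _ (.inr (.inl rfl)), sub_self]; exact zero_mem _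
  · rw [hc _ (.inr (.inr rfl)), sub_self]; exact zero_mem _

theorem nrm_J_eq_zero (k : Klein s t χs χt) (q : ℕ) (x) : hm q k.cycHom.hJ x = 0 := by
  have c := cycD χs s k.s_pow k.s_s
  induction q using Nat.twoStepInduction with
  | zero =>
    obtain ⟨m, rfl⟩ := hl_zero_eq x
    rw [map_zsmul, hm_hu, aug_nrm, smul_smul,
      zsmul_hu_eq_zero_mod c.N_mem c.aug_N c.aug_J]
    push_cast
    rw [show (2 : ZMod 2) = 0 from rfl, mul_zero]
  | one =>
    have := c.J_one two_ne_zero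
    exact Subsingleton.elim _ _
  | more q ih _ =>
    refine (injective_iff_map_eq_zero _).1 (c.δ₁_injective _) _ ?_
    refine (injective_iff_map_eq_zero _).1 (c.δ₂_injective _) _ ?_
    rw [k.cycHom.δ₁, k.cycHom.δ₂, ih]

theorem nrm_eq_zero (k : Klein s t χs χt) (q : ℕ) (x) : hm (q + 1) k.cyc.K_N x = 0 := by
  refine (injective_iff_map_eq_zero _).1 ((cycD χs s k.s_pow k.s_s).δ₂_injective q) _ ?_
  exact (k.cycHom.δ₂ q x).trans (k.nrm_J_eq_zero q _)

theorem two_nsmul (k : Klein s t χs χt) (q : ℕ) (x : hl (q + 1) (La s ⊔ La t)) : 2 • x = 0 := by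
  rw [k.cyc.nsmul_eq, k.nrm_eq_zero, map_zero]

theorem le_Ia (s t : G) : La s ⊔ La t ≤ Ia G := sup_le (La_le_Ia s) (La_le_Ia t)

theorem incl_injective (k : Klein s t χs χt) (q : ℕ) :
    Function.Injective (hm q (compat_of_le k.cyc.L_le_K)) := by
  refine (injective_iff_map_eq_zero _).2 fun x hx => ?_
  refine (injective_iff_map_eq_zero _).1 (La_detect k.s_pow k.s_s q) x ?_
  have := congrArg (hm q (compat_of_le (le_Ia s t))) hx
  rwa [map_zero, hm_hm, hm_congr q _ (compat_of_le (La_le_Ia s)) (by simp)] at this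

theorem one_sub_eq_zero (k : Klein s t χs χt) (q : ℕ) (x) : hm q k.cyc.J_a x = 0 := by
  refine (injective_iff_map_eq_zero _).1 (k.incl_injective q) _ ?_
  exact (k.cyc.ses₂.exact₂ q).apply_apply_eq_zero x

theorem card_K (k : Klein s t χs χt) (q : ℕ) : Nat.card (hl (q + 1) (La s ⊔ La t)) =
    Nat.card (hl (q + 1) (La s)) *
      Nat.card (hl q (La s ⊔ Submodule.span (MonoidAlgebra ℤ G) {nrm 2 t})) :=
  card_of_exact _ _ (k.incl_injective _)
    (fun x => (k.cyc.ses₂.exact₁ q x).1 (k.one_sub_eq_zero q x)) (k.cyc.ses₂.exact₃ q)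

theorem incl_J_injective (k : Klein s t χs χt) (q : ℕ) :
    Function.Injective (hm (q + 1) (compat_of_le k.cyc.L_le_J)) := by
  refine (injective_iff_map_eq_zero _).2 fun x hx => ?_
  obtain ⟨y, rfl⟩ := (k.cyc.ses₁.exact₂ (q + 1) x).1 hx
  exact k.nrm_eq_zero q y

theorem card_J (k : Klein s t χs χt) (q : ℕ) :
    Nat.card (hl (q + 2) (La s ⊔ Submodule.span (MonoidAlgebra ℤ G) {nrm 2 t})) =
      Nat.card (hl (q + 2) (La s)) * Nat.card (hl (q + 1) (La s ⊔ La t)) :=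
  card_of_exact _ _ (k.incl_J_injective _)
    (fun x => (k.cyc.ses₁.exact₁ (q + 1) x).1 (k.nrm_eq_zero q x)) (k.cyc.ses₁.exact₃ (q + 1))

theorem card_J_one (k : Klein s t χs χt) :
    Nat.card (hl 1 (La s ⊔ Submodule.span (MonoidAlgebra ℤ G) {nrm 2 t})) =
      Nat.card (hl 1 (La s)) := by
  refine (Nat.card_congr (Equiv.ofBijective _ ⟨k.incl_J_injective 0, fun x => ?_⟩)).symm
  refine (k.cyc.ses₁.exact₃ 0 x).1 ?_
  apply k.cyc.mul_injective two_ne_zero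
  rw [map_zero]
  exact (k.cyc.ses₁.exact₁ 0).apply_apply_eq_zero x

theorem card_odd_even (k : Klein s t χs χt) (m : ℕ) :
    Nat.card (hl (2 * m + 1) (La s ⊔ La t)) = 2 ^ (m + 2) ∧
    Nat.card (hl (2 * m + 1) (La s ⊔ Submodule.span (MonoidAlgebra ℤ G) {nrm 2 t})) = 2 ^ (m + 1) ∧
    Nat.card (hl (2 * m + 2) (La s ⊔ La t)) = 2 ^ (m + 1) ∧
    Nat.card (hl (2 * m + 2) (La s ⊔ Submodule.span (MonoidAlgebra ℤ G) {nrm 2 t})) =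
      2 ^ (m + 2) := by
  have o := fun m => La_card k.s_pow k.s_s m
  have e := fun m => ((cycD χs s k.s_pow k.s_s).card_even_odd two_ne_zero m).2.2.2
  induction m with
  | zero =>
    have h1 := k.card_K 0
    have h2 := k.card_K 1
    have h3 := k.card_J 0
    have h4 := k.card_J_one
    have o0 := o 0
    have e0 := e 0
    simp only [mul_zero, zero_add, k.cyc.card_J_zero] at *
    rw [o0] at h1 h4
    rw [e0] at h2 h3
    rw [h4] at h2
    rw [h1] at h3
    exact ⟨h1, h4, h2, h3⟩
  | succ m ih =>
    obtain ⟨i1, i2, i3, i4⟩ := ih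
    have h1 := k.card_K (2 * m + 2)
    have h4 := k.card_J (2 * m + 1)
    have h2 := k.card_K (2 * m + 3)
    have h3 := k.card_J (2 * m + 2)
    have o0 := o (m + 1)
    have e0 := e (m + 1)
    simp only [show 2 * (m + 1) + 1 = 2 * m + 3 by ring, show 2 * (m + 1) + 2 = 2 * m + 4 by ring,
      show 2 * m + 1 + 2 = 2 * m + 3 by ring, show 2 * m + 2 + 1 = 2 * m + 3 by ring,
      show 2 * m + 3 + 1 = 2 * m + 4 by ring, show 2 * m + 2 + 2 = 2 * m + 4 by ring,
      show 2 * m + 1 + 1 = 2 * m + 2 by ring] at *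
    rw [o0, i4] at h1
    rw [o0, i3] at h4
    rw [e0, h4] at h2
    rw [e0, h1] at h3
    refine ⟨h1.trans ?_, h4.trans ?_, h2.trans ?_, h3.trans ?_⟩ <;> ring

end Klein

/-- The classes of three involutions of a Klein group are independent in high degree. -/
theorem Klein.detect_triple {s t w : G} {χs χt : G →* Multiplicative (ZMod 2)}
    (k : Klein s t χs χt) (hw : w = t * s) (q : ℕ) (x : hl (q + 3) (La s)) (y : hl (q + 3) (La t))
    (z : hl (q + 3) (La w))
    (h : hm (q + 3) (compat_of_le (La_le_Ia s)) x + hm (q + 3) (compat_of_le (La_le_Ia t)) y +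
      hm (q + 3) (compat_of_le (La_le_Ia w)) z = 0) : x = 0 ∧ y = 0 ∧ z = 0 := by
  have hw2 : w ^ 2 = 1 := by
    rw [hw, pow_two, mul_assoc, ← mul_assoc s, k.comm, mul_assoc t, k.s_sq, mul_one, k.t_sq]
  have hsw : χs w = Multiplicative.ofAdd 1 := by rw [hw, map_mul, k.s_t, k.s_s, one_mul]
  have htw : χt w = Multiplicative.ofAdd 1 := by rw [hw, map_mul, k.t_s, k.t_t, mul_one]
  have fs := cycHom_DT k.s_pow k.s_s k.s_pow k.s_s
  have fw := cycHom_DT hw2 hsw k.s_pow k.s_s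
  have cT := cycT χs s k.s_pow k.s_s
  have cs := cycD χs s k.s_pow k.s_s
  have cw := cycD χs w hw2 hsw
  have h1 := congrArg (cT.ses₂.δ (q + 2)) h
  rw [map_add, map_add, map_zero, cT.δ₂_of_le (L' := La t) _
    (compat_of_le (La_le (mem_Ls (H := χs.ker) k.s_t))), add_zero, fs.δ₂ (q + 2) x,
    fw.δ₂ (q + 2) z] at h1
  have h2 := congrArg (cT.ses₁.δ (q + 1)) h1
  rw [map_add, map_zero, fs.δ₁, fw.δ₁] at h2
  have e1 := La_detect_pair hw2 htw k.t_s q _ _ ((add_comm _ _).trans h2)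
  rw [e1, map_zero, add_zero] at h2
  have e2 := (injective_iff_map_eq_zero _).1 (La_detect k.s_pow k.s_s _) _ h2
  have z0 : z = 0 := (injective_iff_map_eq_zero _).1 (cw.δ₂_injective _) _
    ((injective_iff_map_eq_zero _).1 (cw.δ₁_injective _) _ e1)
  have x0 : x = 0 := (injective_iff_map_eq_zero _).1 (cs.δ₂_injective _) _
    ((injective_iff_map_eq_zero _).1 (cs.δ₁_injective _) _ e2)
  rw [z0, x0, map_zero, map_zero, zero_add, add_zero] at h
  exact ⟨x0, (injective_iff_map_eq_zero _).1 (La_detect k.t_pow k.t_t _) _ h, z0⟩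

end GHom

namespace GHom

variable {G : Type} [Group G]

theorem eq_zero_of_mul_gr {t : G} (ht : ∀ m : ℕ, 1 ≤ m → t ^ m ≠ 1) {w : MonoidAlgebra ℤ G}
    (hw : w * gr t = w) : w = 0 := by
  have hpow : ∀ m : ℕ, w * gr (t ^ m) = w := fun m => by
    induction m with
    | zero => rw [pow_zero, gr_one, mul_one]
    | succ m ih => rw [pow_succ, gr_mul, ← mul_assoc, ih, hw]
  by_contra hne
  obtain ⟨g, hg⟩ : ∃ g, w.coeff g ≠ 0 := by
    by_contra! h
    exact hne (MonoidAlgebra.coeff_injective (Finsupp.ext h))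
  have hmem : ∀ m : ℕ, g * t ^ m ∈ w.coeff.support := fun m => by
    rw [Finsupp.mem_support_iff, ← hpow m]
    simpa [MonoidAlgebra.coeff_mul_single_eq_coeff_mul] using hg
  have : ¬ Function.Injective fun m : ℕ => g * t ^ m := fun hi =>
    (Set.infinite_range_of_injective hi) (w.coeff.support.finite_toSet.subset
      (by rintro _ ⟨m, rfl⟩; exact hmem m))
  obtain ⟨i, j, e, hij⟩ : ∃ i j : ℕ, g * t ^ i = g * t ^ j ∧ i ≠ j := by
    simpa [Function.Injective] using this
  wlog hlt : i < j generalizing i j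
  · exact this j i e.symm hij.symm (by omega)
  refine ht (j - i) (by omega) ?_
  have e' := mul_left_cancel e
  rw [← Nat.add_sub_of_le hlt.le, pow_add] at e'
  simpa using e'

end GHom

namespace Bianchi

open GHom

/-- The unipotent generator acting on binary quadratic forms. -/
def formT : Equiv.Perm (ℤ × ℤ × ℤ) where
  toFun v := (v.1 + 2 * v.2.1 + v.2.2, v.2.1 + v.2.2, v.2.2)
  invFun v := (v.1 - 2 * v.2.1 + v.2.2, v.2.1 - v.2.2, v.2.2)
  left_inv v := by ext <;> simp; ring
  right_inv v := by ext <;> simp; ring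

/-- The inversion acting on binary quadratic forms. -/
def formS : Equiv.Perm (ℤ × ℤ × ℤ) where
  toFun v := (v.2.2, -v.2.1, v.1)
  invFun v := (v.2.2, -v.2.1, v.1)
  left_inv v := by ext <;> simp
  right_inv v := by ext <;> simp

theorem formT_apply (v : ℤ × ℤ × ℤ) :
    formT v = (v.1 + 2 * v.2.1 + v.2.2, v.2.1 + v.2.2, v.2.2) := rfl

theorem formS_apply (v : ℤ × ℤ × ℤ) : formS v = (v.2.2, -v.2.1, v.1) := rfl

theorem form_rel : BianchiRel formS 1 (formS * formT) (formT ^ 3) 1 where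
  S_S := by ext v <;> simp [formS_apply]
  r_r := by simp
  b_b := by ext v <;> simp [formS_apply, formT_apply] <;> ring
  r_S := by simp
  b_U := by ext v <;> simp [formS_apply, formT_apply, pow_succ]
  V_b := by simp
  V_W := by simp

/-- A permutation of the forms that increases the outer coefficients of every positive form. -/
def Expands (f : Equiv.Perm (ℤ × ℤ × ℤ)) (k : ℤ) : Prop :=
  ∀ v : ℤ × ℤ × ℤ, 0 < v.1 → 0 < v.2.1 → 0 < v.2.2 →
    0 < (f v).1 ∧ 0 < (f v).2.1 ∧ 0 < (f v).2.2 ∧ v.1 + v.2.2 + k ≤ (f v).1 + (f v).2.2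

theorem Expands.mul {f g : Equiv.Perm (ℤ × ℤ × ℤ)} {k l : ℤ} (hf : Expands f k)
    (hg : Expands g l) : Expands (f * g) (k + l) := fun v h1 h2 h3 => by
  obtain ⟨g1, g2, g3, g4⟩ := hg v h1 h2 h3
  obtain ⟨f1, f2, f3, f4⟩ := hf _ g1 g2 g3
  exact ⟨f1, f2, f3, by rw [Equiv.Perm.mul_apply]; linarith⟩

theorem expands_one : Expands 1 0 := fun v h1 h2 h3 => ⟨h1, h2, h3, by simp⟩

theorem Expands.pow {f : Equiv.Perm (ℤ × ℤ × ℤ)} {k : ℤ} (hf : Expands f k) (m : ℕ) :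
    Expands (f ^ m) (m * k) := by
  induction m with
  | zero => simpa using expands_one
  | succ m ih =>
    rw [pow_succ, Nat.cast_succ, add_mul, one_mul]
    exact ih.mul hf

theorem Expands.ne_one {f : Equiv.Perm (ℤ × ℤ × ℤ)} {k : ℤ} (hf : Expands f k) (hk : 1 ≤ k) :
    f ≠ 1 := by
  rintro rfl
  have := (hf (1, 1, 1) one_pos one_pos one_pos).2.2.2
  simp at this
  omega

theorem expands_T : Expands formT 1 := fun v h1 h2 h3 => by
  simp only [formT_apply]
  refine ⟨?_, ?_, ?_, ?_⟩ <;> omega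

theorem expands_L : Expands (formS * formT⁻¹ * formS) 1 := fun v h1 h2 h3 => by
  have e : (formS * formT⁻¹ * formS) v = (v.1, v.1 + v.2.1, v.1 + 2 * v.2.1 + v.2.2) := by
    change formS (formT.symm (formS v)) = _
    ext <;> simp [formS_apply, formT] <;> ring
  rw [e]
  refine ⟨?_, ?_, ?_, ?_⟩ <;> dsimp only <;> omega

variable {G : Type} [Group G] {S r b U V : G}

theorem IsPresentation.exists_form (h : IsPresentation S r b U V) :
    ∃ f : G →* Equiv.Perm (ℤ × ℤ × ℤ), f S = formS ∧ f r = 1 ∧ f b = formS * formT ∧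
      f U = formT ^ 3 ∧ f V = 1 := h.lift form_rel

theorem IsPresentation.pow_T_ne (h : IsPresentation S r b U V) (m : ℕ) (hm : 1 ≤ m) :
    (S * b) ^ m ≠ 1 := by
  obtain ⟨f, hS, -, hb, -, -⟩ := h.exists_form
  intro e
  have := congrArg f e
  rw [map_pow, map_mul, hS, hb, map_one, ← mul_assoc, form_rel.S_S, one_mul] at this
  exact (expands_T.pow m).ne_one (by simpa using by exact_mod_cast hm) this

theorem IsPresentation.pow_hyp_ne (h : IsPresentation S r b U V) (m : ℕ) (hm : 1 ≤ m) :
    (S * (U * S * U⁻¹)) ^ m ≠ 1 := by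
  obtain ⟨f, hS, -, -, hU, -⟩ := h.exists_form
  intro e
  have e' : (U * S * U⁻¹ * S) ^ m = 1 := by
    have : U * S * U⁻¹ * S = (S * (U * S * U⁻¹))⁻¹ := by
      simp [mul_inv_rev, h.rel.S_inv, mul_assoc]
    rw [this, inv_pow, e, inv_one]
  have := congrArg f e'
  have e3 : formS * (formT ^ 3)⁻¹ * formS = (formS * formT⁻¹ * formS) ^ 3 := by
    have s : ∀ x, formS * (formS * x) = x := form_rel.S_S_mul
    simp [pow_succ, mul_assoc, s]
  rw [map_pow, map_mul, map_mul, map_mul, map_inv, hS, hU, map_one, mul_assoc, mul_assoc,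
    ← mul_assoc formS, e3] at this
  exact (((expands_T.pow 3).mul (expands_L.pow 3)).pow m).ne_one (by push_cast; omega) this

/-- The step of the tree walk. -/
theorem IsPresentation.eq_zero_of_mul (h : IsPresentation S r b U V) {y : MonoidAlgebra ℤ G}
    (h1 : y * (1 + gr (r * S)) = 0) (h2 : y * (1 + gr b + gr (b * b)) = 0) : y = 0 := by
  obtain ⟨f, hS, hr, hb, -, -⟩ := h.exists_form
  have c1 : ∀ g, y.coeff g ≠ 0 → y.coeff (g * (r * S)) ≠ 0 := by
    intro g hg h0
    have hinv : (r * S)⁻¹ = r * S := by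
      rw [mul_inv_rev, h.rel.S_inv, h.rel.r_inv, h.rel.r_S]
    have := congrArg (fun z => z.coeff g) h1
    simp [mul_add, hinv, h0, hg] at this
  have c2 : ∀ g, y.coeff g ≠ 0 → y.coeff (g * b) ≠ 0 ∨ y.coeff (g * (b * b)) ≠ 0 := by
    intro g hg
    by_contra! h0
    have := congrArg (fun z => z.coeff g) h2
    have hinv : (b * b)⁻¹ = b := by
      rw [← h.rel.b_inv, inv_inv]
    simp [mul_add, hinv, h.rel.b_inv, h0, hg, -mul_inv_rev] at this
  have hstep : ∀ g : {g // y.coeff g ≠ 0}, ∃ g' : {g // y.coeff g ≠ 0},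
      Expands (f (g.1⁻¹ * g'.1)) 1 := by
    rintro ⟨g, hg⟩
    rcases c2 _ (c1 g hg) with h' | h'
    · refine ⟨⟨_, h'⟩, ?_⟩
      have : f (g⁻¹ * (g * (r * S) * b)) = formT := by
        simp [hr, hS, hb, mul_assoc, form_rel.S_S_mul]
      rw [this]; exact expands_T
    · refine ⟨⟨_, h'⟩, ?_⟩
      have : f (g⁻¹ * (g * (r * S) * (b * b))) = formS * formT⁻¹ * formS := by
        have e : formS * formT * (formS * formT) = (formS * formT)⁻¹ := form_rel.b_inv.symm
        simp only [map_mul, hr, hS, hb, e]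
        simp [mul_assoc, form_rel.S_inv]
      rw [this]; exact expands_L
  choose nx hnx using hstep
  by_contra hne
  obtain ⟨g, hg⟩ : ∃ g, y.coeff g ≠ 0 := by
    by_contra! h
    exact hne (MonoidAlgebra.coeff_injective (Finsupp.ext h))
  let p : ℕ → {g // y.coeff g ≠ 0} := fun n => nx^[n] ⟨g, hg⟩
  have hp : ∀ i k : ℕ, Expands (f ((p i).1⁻¹ * (p (i + k)).1)) k := fun i k => by
    induction k with
    | zero => simpa using expands_one
    | succ k ih =>
      have e : (p i).1⁻¹ * (p (i + (k + 1))).1 =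
          ((p i).1⁻¹ * (p (i + k)).1) * ((p (i + k)).1⁻¹ * (nx (p (i + k))).1) := by
        have : p (i + (k + 1)) = nx (p (i + k)) := Function.iterate_succ_apply' nx _ _
        rw [this]; group
      rw [e, map_mul, Nat.cast_succ]
      exact ih.mul (hnx _)
  have hfin : Finite {g // y.coeff g ≠ 0} :=
    (y.coeff.support.finite_toSet.subset fun g hg => Finsupp.mem_support_iff.2 hg).to_subtype
  obtain ⟨i, j, hij, e⟩ := Finite.exists_ne_map_eq_of_infinite p
  wlog hlt : i < j generalizing i j
  · exact this j i hij.symm e.symm (by omega)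
  have := hp i (j - i)
  rw [Nat.add_sub_of_le hlt.le, e, inv_mul_cancel, map_one] at this
  exact this.ne_one (by have := Nat.sub_pos_of_lt hlt; exact_mod_cast this) rfl

end Bianchi

namespace Bianchi

open GHom

variable {G : Type} [Group G] {S r b U V : G}

section

variable {Q : Type} [AddCommGroup Q] [Module (MonoidAlgebra ℤ G) Q]

theorem gr_smul_smul (g h : G) (q : Q) : gr g • gr h • q = gr (g * h) • q := by
  rw [smul_smul, gr_mul]

theorem gr_one_smul (q : Q) : gr (1 : G) • q = q := one_smul _ q

/-- The affine transformation with linear part a group element. -/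
noncomputable def affine (g : G) (d : Q) : Equiv.Perm Q where
  toFun q := gr g • q + d
  invFun q := gr g⁻¹ • (q - d)
  left_inv q := by simp only [add_sub_cancel_right, gr_smul_smul, inv_mul_cancel, gr_one_smul]
  right_inv q := by
    simp only [gr_smul_smul, mul_inv_cancel, gr_one_smul, sub_add_cancel]

theorem affine_mul (g g' : G) (d d' : Q) :
    affine g d * affine g' d' = affine (g * g') (d + gr g • d') := by
  ext q
  change gr g • (gr g' • q + d') + d = gr (g * g') • q + (d + gr g • d')
  rw [smul_add, gr_smul_smul]; abel

theorem affine_inv (g : G) (d : Q) : (affine g d)⁻¹ = affine g⁻¹ (-(gr g⁻¹ • d)) := by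
  ext q
  change gr g⁻¹ • (q - d) = gr g⁻¹ • q + -(gr g⁻¹ • d)
  rw [smul_sub, sub_eq_add_neg]

theorem affine_one : affine (1 : G) (0 : Q) = 1 := by
  ext q
  change gr (1 : G) • q + 0 = q
  rw [gr_one_smul, add_zero]

theorem IsPresentation.exists_derivation (h : IsPresentation S r b U V) {db dU dV : Q}
    (hb : db + gr b • db + gr (b * b) • db = 0)
    (hU : gr S • db + gr (S * b) • dU = dU + gr (U * S) • db)
    (hV : dV + gr V • db = db + gr b • dV)
    (hW : dU + gr U • dV = gr r • dU + gr (r * U * S) • dV) :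
    ∃ D : G → Q, (∀ g g', D (g * g') = D g + gr g • D g') ∧ D S = 0 ∧ D r = 0 ∧ D b = db ∧
      D U = dU ∧ D V = dV := by
  have rel : BianchiRel (affine S (0 : Q)) (affine r (0 : Q)) (affine b db) (affine U dU)
      (affine V dV) := by
    refine ⟨?_, ?_, ?_, ?_, ?_, ?_, ?_⟩
    · rw [affine_mul, h.rel.S_S, smul_zero, add_zero, affine_one]
    · rw [affine_mul, h.rel.r_r, smul_zero, add_zero, affine_one]
    · rw [affine_mul, affine_mul, h.rel.b_b, hb, affine_one]
    · rw [affine_mul, affine_mul, h.rel.r_S, smul_zero, smul_zero]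
    · rw [affine_mul, affine_mul, affine_mul, h.rel.b_U, zero_add, hU, gr_smul_smul]
    · rw [affine_mul, affine_mul, h.rel.V_b, hV]
    · rw [mul_assoc, mul_assoc, mul_assoc, eq_inv_mul_iff_mul_eq]
      simp only [affine_mul, smul_zero, zero_add, add_zero]
      rw [hW, gr_smul_smul, h.rel.V_W]
      simp only [smul_add, gr_smul_smul, mul_assoc, mul_inv_cancel_left]
  obtain ⟨f, fS, fr, fb, fU, fV⟩ := h.lift rel
  have key : ∀ g, ∃ d, f g = affine g d := by
    intro g
    have hg : g ∈ Subgroup.closure {S, r, b, U, V} := by rw [h.closure]; trivial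
    induction hg using Subgroup.closure_induction with
    | mem x hx =>
      rcases hx with rfl | rfl | rfl | rfl | rfl
      exacts [⟨_, fS⟩, ⟨_, fr⟩, ⟨_, fb⟩, ⟨_, fU⟩, ⟨_, fV⟩]
    | one => exact ⟨0, by rw [map_one, affine_one]⟩
    | mul x y _ _ hx hy =>
      obtain ⟨d, hd⟩ := hx
      obtain ⟨d', hd'⟩ := hy
      exact ⟨_, by rw [map_mul, hd, hd', affine_mul]⟩
    | inv x _ hx =>
      obtain ⟨d, hd⟩ := hx
      exact ⟨_, by rw [map_inv, hd, affine_inv]⟩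
  have h0 : ∀ (g : G) (d : Q), affine g d 0 = d := fun g d => by
    change gr g • (0 : Q) + d = d
    rw [smul_zero, zero_add]
  refine ⟨fun g => f g 0, fun g g' => ?_, ?_, ?_, ?_, ?_, ?_⟩
  · obtain ⟨d, hd⟩ := key g
    obtain ⟨d', hd'⟩ := key g'
    simp only [map_mul, hd, hd', affine_mul, h0]
  · simp only [fS, h0]
  · simp only [fr, h0]
  · simp only [fb, h0]
  · simp only [fU, h0]
  · simp only [fV, h0]

/-- Additive extension of a derivation to the group ring. -/
theorem exists_extension (D : G → Q) (hD : ∀ g g', D (g * g') = D g + gr g • D g') :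
    ∃ E : MonoidAlgebra ℤ G →+ Q, ∀ y g, E (y * gr g) = E y + y • D g := by
  have h1 : D 1 = 0 := by
    have := hD 1 1
    rw [mul_one, gr_one_smul] at this
    simpa using this
  let E : MonoidAlgebra ℤ G →+ Q := (Finsupp.liftAddHom fun g => (zmultiplesHom Q (D g))).comp
    MonoidAlgebra.coeffAddEquiv.toAddMonoidHom
  have hE : ∀ g, E (gr g) = D g := fun g => by
    simp only [E, AddMonoidHom.comp_apply]
    refine (Finsupp.liftAddHom_apply_single _ g (1 : ℤ)).trans ?_
    simp
  refine ⟨E, fun y g => ?_⟩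
  induction y using ring_induction with
  | gr g' => rw [← gr_mul, hE, hE, hD]
  | add y z hy hz => rw [add_mul, map_add, hy, hz, map_add, add_smul]; abel
  | neg y hy => rw [neg_mul, map_neg, hy, map_neg, neg_smul]; abel

end

end Bianchi

namespace Bianchi

open GHom

variable {G : Type} [Group G] {S r b U V : G}

/-- Chains on the vertices. -/
abbrev C0 (S r b U : G) : Type :=
  (MonoidAlgebra ℤ G ⧸ (La S ⊔ La r)) × (MonoidAlgebra ℤ G ⧸ (La S ⊔ La (U⁻¹ * r * U))) ×
    (MonoidAlgebra ℤ G ⧸ La b)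

/-- Chains on the edges. -/
abbrev C1 (S r b : G) : Type :=
  (MonoidAlgebra ℤ G ⧸ La S) × (MonoidAlgebra ℤ G ⧸ La r) × (MonoidAlgebra ℤ G ⧸ La (r * S)) ×
    (MonoidAlgebra ℤ G ⧸ La b) ×
    (MonoidAlgebra ℤ G ⧸ (⊥ : Submodule (MonoidAlgebra ℤ G) (MonoidAlgebra ℤ G)))

/-- Chains on the faces. -/
abbrev C2 (G : Type) [Group G] : Type :=
  (MonoidAlgebra ℤ G ⧸ (⊥ : Submodule (MonoidAlgebra ℤ G) (MonoidAlgebra ℤ G))) ×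
    (MonoidAlgebra ℤ G ⧸ (⊥ : Submodule (MonoidAlgebra ℤ G) (MonoidAlgebra ℤ G)))

theorem compat_La {a g a' : G} {L : Submodule (MonoidAlgebra ℤ G) (MonoidAlgebra ℤ G)}
    (h : a * g = g * a') (h' : 1 - gr a' ∈ L) : Compat (La a) (gr g) L := by
  refine compat_span ?_
  have := L.smul_mem (gr g) h'
  rwa [smul_eq_mul, mul_sub, mul_one, ← gr_mul, ← h, gr_mul,
    show gr g - gr a * gr g = (1 - gr a) * gr g by rw [sub_mul, one_mul]] at this

theorem mul_mem_sup (s t : G) : 1 - gr (t * s) ∈ La s ⊔ La t := by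
  have := Submodule.add_mem_sup ((La s).smul_mem (gr t) (mem_La s)) (mem_La t)
  rwa [smul_eq_mul, mul_sub, mul_one, ← gr_mul, add_comm, sub_add_sub_cancel] at this

theorem compat_S_one : Compat (La S) 1 (La S ⊔ La r) := compat_of_le le_sup_left

theorem compat_r_one : Compat (La r) 1 (La S ⊔ La r) := compat_of_le le_sup_right

theorem compat_W_one : Compat (La (r * S)) 1 (La S ⊔ La r) :=
  compat_of_le (La_le (mul_mem_sup S r))

theorem compat_S_two : Compat (La S) 1 (La S ⊔ La (U⁻¹ * r * U)) := compat_of_le le_sup_left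

theorem compat_r_two : Compat (La r) (gr U) (La S ⊔ La (U⁻¹ * r * U)) :=
  compat_La (a' := U⁻¹ * r * U) (by group) (Submodule.mem_sup_right (mem_La _))

theorem compat_W_two (h : IsPresentation S r b U V) : Compat (La (r * S)) (gr V⁻¹) (La S ⊔ La (U⁻¹ * r * U)) := by
  refine compat_La (a' := U⁻¹ * r * U * S) ?_ (mul_mem_sup _ _)
  rw [mul_inv_eq_iff_eq_mul, mul_assoc, ← h.rel.V_W, inv_mul_cancel_left]

theorem compat_b (h : IsPresentation S r b U V) : Compat (La b) (gr V - 1) (La b) := by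
  have h1 : Compat (La b) (gr V) (La b) := compat_La h.rel.V_b.symm (mem_La b)
  intro y hy
  rw [mul_sub, mul_one]
  exact sub_mem (h1 y hy) hy

/-- The boundary of the edges. -/
noncomputable def d1 (h : IsPresentation S r b U V) : C1 S r b →ₗ[MonoidAlgebra ℤ G] C0 S r b U :=
  let p1 : C1 S r b →ₗ[MonoidAlgebra ℤ G] _ := LinearMap.fst _ _ _
  let s1 : C1 S r b →ₗ[MonoidAlgebra ℤ G] _ := LinearMap.snd _ _ _
  let p2 := LinearMap.fst _ _ _ ∘ₗ s1
  let s2 := LinearMap.snd _ _ _ ∘ₗ s1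
  let p3 := LinearMap.fst _ _ _ ∘ₗ s2
  let s3 := LinearMap.snd _ _ _ ∘ₗ s2
  let p4 := LinearMap.fst _ _ _ ∘ₗ s3
  let p5 := LinearMap.snd _ _ _ ∘ₗ s3
  LinearMap.prod
    (-(qm compat_S_one ∘ₗ p1) - qm compat_r_one ∘ₗ p2 - qm compat_W_one ∘ₗ p3 -
      qm (compat_bot (z := 1)) ∘ₗ p5)
    (LinearMap.prod
      (qm compat_S_two ∘ₗ p1 + qm compat_r_two ∘ₗ p2 + qm (compat_W_two h) ∘ₗ p3)
      (qm (compat_b h) ∘ₗ p4 + qm (compat_bot (z := 1)) ∘ₗ p5))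

theorem d1_apply (h : IsPresentation S r b U V) (x : C1 S r b) : d1 h x =
    (-(qm compat_S_one x.1) - qm compat_r_one x.2.1 - qm compat_W_one x.2.2.1 -
        qm (compat_bot (z := 1)) x.2.2.2.2,
      qm compat_S_two x.1 + qm compat_r_two x.2.1 + qm (compat_W_two h) x.2.2.1,
      qm (compat_b h) x.2.2.2.1 + qm (compat_bot (z := 1)) x.2.2.2.2) := rfl

/-- The boundary of the faces. -/
noncomputable def d2 (S r b U V : G) : C2 G →ₗ[MonoidAlgebra ℤ G] C1 S r b :=
  let p : C2 G →ₗ[MonoidAlgebra ℤ G] _ := LinearMap.fst _ _ _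
  let s : C2 G →ₗ[MonoidAlgebra ℤ G] _ := LinearMap.snd _ _ _
  LinearMap.prod
    (-(qm (compat_bot (z := (gr (S * b) - 1) * gr U)) ∘ₗ p) + qm (compat_bot (z := 1)) ∘ₗ s)
    (LinearMap.prod (qm (compat_bot (z := gr (S * b) - 1)) ∘ₗ p)
      (LinearMap.prod (-(qm (compat_bot (z := gr V)) ∘ₗ s))
        (LinearMap.prod (-(qm (compat_bot (z := 1)) ∘ₗ s))
          (qm (compat_bot (z := (1 - gr U) * gr S * (1 - gr b))) ∘ₗ p +
            qm (compat_bot (z := gr V - 1)) ∘ₗ s))))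

theorem d2_apply (x : C2 G) : d2 S r b U V x =
    (-(qm (compat_bot (z := (gr (S * b) - 1) * gr U)) x.1) + qm (compat_bot (z := 1)) x.2,
      qm (compat_bot (z := gr (S * b) - 1)) x.1, -(qm (compat_bot (z := gr V)) x.2),
      -(qm (compat_bot (z := 1)) x.2),
      qm (compat_bot (z := (1 - gr U) * gr S * (1 - gr b))) x.1 +
            qm (compat_bot (z := gr V - 1)) x.2) := rfl

/-- The augmentation of the vertices. -/
noncomputable def eps (S r b U : G) : C0 S r b U →ₗ[MonoidAlgebra ℤ G] (MonoidAlgebra ℤ G ⧸ Ia G) :=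
  let p : C0 S r b U →ₗ[MonoidAlgebra ℤ G] _ := LinearMap.fst _ _ _
  let s : C0 S r b U →ₗ[MonoidAlgebra ℤ G] _ := LinearMap.snd _ _ _
  qm (compat_of_le (Klein.le_Ia S r)) ∘ₗ p +
    (qm (compat_of_le (Klein.le_Ia S (U⁻¹ * r * U))) ∘ₗ (LinearMap.fst _ _ _) ∘ₗ s +
     qm (compat_of_le (La_le_Ia b)) ∘ₗ (LinearMap.snd _ _ _) ∘ₗ s)

theorem eps_apply (x : C0 S r b U) : eps S r b U x =
    qm (compat_of_le (Klein.le_Ia S r)) x.1 +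
    (qm (compat_of_le (Klein.le_Ia S (U⁻¹ * r * U))) x.2.1 +
     qm (compat_of_le (La_le_Ia b)) x.2.2) := rfl

theorem d1_d2 (h : IsPresentation S r b U V) (x : C2 G) : d1 h (d2 S r b U V x) = 0 := by
  obtain ⟨x, y⟩ := x
  obtain ⟨x, rfl⟩ := Submodule.Quotient.mk_surjective _ x
  obtain ⟨y, rfl⟩ := Submodule.Quotient.mk_surjective _ y
  rw [d1_apply, d2_apply]
  simp only [qm_mk, ← Submodule.Quotient.mk_neg, ← Submodule.Quotient.mk_add,
    ← Submodule.Quotient.mk_sub, Prod.ext_iff, Prod.fst_zero, Prod.snd_zero,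
    Submodule.Quotient.mk_eq_zero]
  have hbU : gr S * gr b * gr U = gr U * gr S * gr b := by
    rw [← gr_mul, ← gr_mul, ← gr_mul, ← gr_mul, h.rel.b_U, mul_assoc]
  refine ⟨?_, ?_, ?_⟩
  · have : -((-(x * ((gr (S * b) - 1) * gr U)) + y * 1) * 1) - x * (gr (S * b) - 1) * 1 -
        -(y * gr V) * 1 - (x * ((1 - gr U) * gr S * (1 - gr b)) + y * (gr V - 1)) * 1 =
        (x * (1 - gr U)) • (1 - gr S) + x * (gr S * gr b * gr U - gr U * gr S * gr b) := by
      rw [smul_eq_mul, gr_mul]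
      noncomm_ring
    rw [hbU, sub_self, mul_zero, add_zero] at this
    refine Submodule.mem_sup_left ?_
    have h2 := (La S).smul_mem (x * (1 - gr U)) (mem_La S)
    rw [← this] at h2
    exact h2
  · have : (-(x * ((gr (S * b) - 1) * gr U)) + y * 1) * 1 + x * (gr (S * b) - 1) * gr U +
        -(y * gr V) * gr V⁻¹ = 0 := by
      rw [neg_mul, mul_assoc y, ← gr_mul, mul_inv_cancel, gr_one]
      noncomm_ring
    rw [this]
    exact zero_mem _
  · have : -(y * 1) * (gr V - 1) + (x * ((1 - gr U) * gr S * (1 - gr b)) + y * (gr V - 1)) * 1 =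
        (x * (1 - gr U) * gr S) • (1 - gr b) := by
      rw [smul_eq_mul]
      noncomm_ring
    rw [this]
    exact (La b).smul_mem _ (mem_La b)

theorem eps_d1 (h : IsPresentation S r b U V) (x : C1 S r b) : eps S r b U (d1 h x) = 0 := by
  obtain ⟨x1, x2, x3, x4, x5⟩ := x
  obtain ⟨x1, rfl⟩ := Submodule.Quotient.mk_surjective _ x1
  obtain ⟨x2, rfl⟩ := Submodule.Quotient.mk_surjective _ x2
  obtain ⟨x3, rfl⟩ := Submodule.Quotient.mk_surjective _ x3
  obtain ⟨x4, rfl⟩ := Submodule.Quotient.mk_surjective _ x4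
  obtain ⟨x5, rfl⟩ := Submodule.Quotient.mk_surjective _ x5
  rw [eps_apply, d1_apply]
  simp only [qm_mk, ← Submodule.Quotient.mk_neg, ← Submodule.Quotient.mk_add,
    ← Submodule.Quotient.mk_sub, Submodule.Quotient.mk_eq_zero, mem_Ia_iff, map_add, map_sub,
    map_neg, map_mul, aug_single, map_one, mul_one]
  ring

section Unit

variable {L : Submodule (MonoidAlgebra ℤ G) (MonoidAlgebra ℤ G)}

theorem mk_eq_smul (y : MonoidAlgebra ℤ G) :
    (Submodule.Quotient.mk y : MonoidAlgebra ℤ G ⧸ L) = y • Submodule.Quotient.mk 1 := by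
  rw [← Submodule.Quotient.mk_smul, smul_eq_mul, mul_one]

theorem smul_mk_one {a : G} (ha : 1 - gr a ∈ L) :
    gr a • (Submodule.Quotient.mk 1 : MonoidAlgebra ℤ G ⧸ L) = Submodule.Quotient.mk 1 := by
  rw [← mk_eq_smul, eq_comm, Submodule.Quotient.eq]
  exact ha

theorem mul_nrm_of_mem_La {a : G} {y z : MonoidAlgebra ℤ G} (hy : y ∈ La a)
    (hz : (1 - gr a) * z = 0) : y * z = 0 := by
  obtain ⟨u, rfl⟩ := Submodule.mem_span_singleton.1 hy
  rw [smul_eq_mul, mul_assoc, hz, mul_zero]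

end Unit

theorem d2_injective (h : IsPresentation S r b U V) : Function.Injective (d2 S r b U V) := by
  rw [injective_iff_map_eq_zero]
  rintro ⟨x, y⟩ e
  obtain ⟨x, rfl⟩ := Submodule.Quotient.mk_surjective _ x
  obtain ⟨y, rfl⟩ := Submodule.Quotient.mk_surjective _ y
  rw [d2_apply] at e
  simp only [qm_mk, ← Submodule.Quotient.mk_neg, ← Submodule.Quotient.mk_add, Prod.ext_iff,
    Prod.fst_zero, Prod.snd_zero, Submodule.Quotient.mk_eq_zero, Submodule.mem_bot, mul_one,
    neg_mem_iff] at e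
  obtain ⟨e1, -, e3, e4, e5⟩ := e
  have nS : (1 - gr S) * (1 + gr S) = 0 := by
    have : gr S * gr S = 1 := by rw [← gr_mul, h.rel.S_S, gr_one]
    rw [sub_mul, mul_add, mul_add, this]; noncomm_ring
  have nW : (1 - gr (r * S)) * (1 + gr (r * S)) = 0 := by
    have : gr (r * S) * gr (r * S) = 1 := by
      rw [← gr_mul, mul_assoc, ← mul_assoc S, ← h.rel.r_S, mul_assoc, h.rel.S_S, mul_one, h.rel.r_r,
        gr_one]
    rw [sub_mul, mul_add, mul_add, this]; noncomm_ring
  have nb : (1 - gr b) * (1 + gr b + gr (b * b)) = 0 := by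
    have : gr b * gr (b * b) = 1 := by rw [← gr_mul, ← mul_assoc, h.rel.b_b, gr_one]
    rw [sub_mul, mul_add (gr b), mul_add (gr b), this, gr_mul]; noncomm_ring
  have hVb : gr V * gr b = gr b * gr V := by rw [← gr_mul, ← gr_mul, h.rel.V_b]
  have hVb2 : gr V * (1 + gr b + gr (b * b)) = (1 + gr b + gr (b * b)) * gr V := by
    rw [gr_mul, mul_add, mul_add, add_mul, add_mul, mul_one, one_mul, ← mul_assoc, hVb, mul_assoc,
      hVb, mul_assoc]
  have hy : y = 0 := by
    have h1 := mul_nrm_of_mem_La e3 nW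
    have h2 : y * gr V * (1 + gr b + gr (b * b)) = 0 := by
      rw [mul_assoc, hVb2, ← mul_assoc, mul_nrm_of_mem_La e4 nb, zero_mul]
    have h3 := h.eq_zero_of_mul h1 h2
    have h4 := congrArg (· * gr V⁻¹) h3
    simpa only [mul_assoc, ← gr_mul, mul_inv_cancel, gr_one, mul_one, zero_mul] using h4
  subst hy
  simp only [zero_mul, add_zero, neg_mem_iff] at e1 e5
  set w := x * (gr (S * b) - 1) with hw
  have e6 : w * gr U * (1 + gr S) = 0 := by
    have := mul_nrm_of_mem_La e1 nS
    rwa [← mul_assoc, ← hw] at this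
  have hbU : gr (S * b) * gr U = gr U * gr (S * b) := by rw [← gr_mul, ← gr_mul, h.rel.b_U]
  have SS : gr S * gr S = 1 := by rw [← gr_mul, h.rel.S_S, gr_one]
  have e7 : w * (1 - gr U) * (1 + gr S) = 0 := by
    have e8 : x * (1 - gr U) * gr S = x * (1 - gr U) * gr (S * b) := by
      rw [gr_mul]
      rw [← sub_eq_zero, ← e5]
      noncomm_ring
    have e9 : w * (1 - gr U) = x * (1 - gr U) * (gr S - 1) := by
      rw [hw, mul_sub _ (gr S), e8, mul_assoc, sub_mul, one_mul, mul_sub (gr (S * b)), hbU]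
      noncomm_ring
    rw [e9, mul_assoc, show (gr S - 1) * (1 + gr S) = 0 by
      rw [← neg_sub, neg_mul, nS, neg_zero], mul_zero]
  have e10 : w * (1 + gr S) = 0 := by
    have : w * (1 + gr S) = w * (1 - gr U) * (1 + gr S) + w * gr U * (1 + gr S) := by noncomm_ring
    rw [this, e6, e7, add_zero]
  have e11 : w * gr S = -w := by
    rw [mul_add, mul_one] at e10
    exact (neg_eq_of_add_eq_zero_right e10).symm
  have e12 : w * gr U * gr S = -(w * gr U) := by
    rw [mul_add, mul_one] at e6
    exact (neg_eq_of_add_eq_zero_right e6).symm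
  have e13 : w = 0 := by
    refine eq_zero_of_mul_gr h.pow_hyp_ne ?_
    rw [gr_mul, gr_mul, gr_mul, ← mul_assoc, ← mul_assoc, ← mul_assoc, e11, neg_mul, neg_mul,
      e12, neg_mul, neg_mul, neg_neg, mul_assoc, ← gr_mul, mul_inv_cancel, gr_one, mul_one]
  have e14 : x = 0 := by
    refine eq_zero_of_mul_gr h.pow_T_ne ?_
    rw [hw, mul_sub, mul_one, sub_eq_zero] at e13
    exact e13
  rw [e14]
  rfl

theorem combination_eq_zero (h : IsPresentation S r b U V) {Q : Type} [AddCommGroup Q]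
    [Module (MonoidAlgebra ℤ G) Q] {eS er eW eb e0 : Q} (fS : gr S • eS = eS) (fr : gr r • er = er)
    (fW : gr (r * S) • eW = eW) (fb : gr b • eb = eb)
    (R1 : gr S • e0 - gr (S * b) • e0 + gr (S * b) • er + gr (U * S * b) • e0 + gr U • eS =
      gr (U * S) • e0 + er + gr (S * b * U) • eS)
    (R2 : eS = gr V • eW + eb - gr V • e0 + e0) {x1 x2 x3 x4 x5 : MonoidAlgebra ℤ G}
    (m1 : -x1 - x2 - x3 - x5 ∈ La S ⊔ La r)
    (m2 : x1 + x2 * gr U + x3 * gr V⁻¹ ∈ La S ⊔ La (U⁻¹ * r * U))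
    (m3 : x4 * (gr V - 1) + x5 ∈ La b) :
    x1 • eS + x2 • er + x3 • eW + x4 • eb + x5 • e0 = 0 := by
  obtain ⟨D, hD, DS, Dr, Db, DU, DV⟩ := h.exists_derivation (db := e0 - gr b • e0)
    (dU := er - gr U • eS) (dV := eS - gr V • eW)
    (by
      simp only [smul_sub, gr_smul_smul, h.rel.b_b, gr_one_smul]
      abel)
    (by
      simp only [smul_sub, gr_smul_smul]
      rw [← sub_eq_zero] at R1 ⊢
      rw [← R1]
      simp only [mul_assoc]
      abel)
    (by
      rw [R2]
      simp only [smul_sub, smul_add, gr_smul_smul, fb, h.rel.V_b]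
      abel)
    (by
      have : gr (r * U * S) • gr V • eW = gr U • gr V • eW := by
        have e : r * U * S * V = U * V * (r * S) := by
          rw [mul_assoc U, h.rel.V_W]; group
        rw [gr_smul_smul, gr_smul_smul, e, ← gr_smul_smul _ (r * S), fW]
      simp only [smul_sub, this]
      simp only [gr_smul_smul, fr]
      rw [← gr_smul_smul _ S, fS]
      abel)
  obtain ⟨E, hE⟩ := exists_extension D hD
  have D1 : D 1 = 0 := by
    have := hD 1 1
    rw [mul_one, gr_one_smul] at this
    simpa using this
  have Dinv : ∀ g, D g⁻¹ = -(gr g⁻¹ • D g) := fun g => by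
    have := hD g⁻¹ g
    rw [inv_mul_cancel, D1] at this
    exact eq_neg_of_add_eq_zero_left this.symm
  have kill : ∀ (a : G) (e : Q), D a = e - gr a • e → ∀ y ∈ La a, E y + y • e = 0 := by
    intro a e he y hy
    obtain ⟨u, rfl⟩ := Submodule.mem_span_singleton.1 hy
    rw [smul_eq_mul, mul_sub, mul_one, map_sub, hE, he, sub_smul, smul_sub, mul_smul]
    abel
  have kill2 : ∀ (a a' : G) (e : Q), D a = e - gr a • e → D a' = e - gr a' • e →
      ∀ y ∈ La a ⊔ La a', E y + y • e = 0 := by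
    intro a a' e he he' y hy
    obtain ⟨u, hu, v, hv, rfl⟩ := Submodule.mem_sup.1 hy
    rw [map_add, add_smul, add_add_add_comm, kill a e he u hu, kill a' e he' v hv, add_zero]
  have k1 := kill2 S r 0 (by simp [DS]) (by simp [Dr]) _ m1
  have k2 := kill2 S (U⁻¹ * r * U) eS (by rw [DS, fS, sub_self]) (by
    rw [hD, hD, Dinv, Dr, DU]
    simp only [smul_sub, smul_zero, gr_smul_smul, inv_mul_cancel, gr_one_smul]
    rw [← gr_smul_smul _ r er, fr]
    abel) _ m2
  have k3 := kill b e0 Db _ m3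
  have k := congrArg₂ (· + ·) k1 (congrArg₂ (· + ·) k2 k3)
  simp only [map_add, map_sub, map_neg, mul_sub, mul_one, hE, Dinv, DU, DV, smul_zero, add_zero,
    smul_sub, smul_neg, add_smul, sub_smul, mul_smul, gr_smul_smul, inv_mul_cancel,
    gr_one_smul] at k
  rw [← k]
  have R3 := congrArg (x4 • ·) R2
  simp only [smul_add, smul_sub] at R3
  rw [R3]
  abel

theorem d2_mk_zero : d2 S r b U V (Submodule.Quotient.mk 1, 0) =
    (Submodule.Quotient.mk (-((gr (S * b) - 1) * gr U)), Submodule.Quotient.mk (gr (S * b) - 1),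
      Submodule.Quotient.mk 0, Submodule.Quotient.mk 0,
      Submodule.Quotient.mk ((1 - gr U) * gr S * (1 - gr b))) := by
  simp only [d2_apply, qm_mk, map_zero, add_zero, neg_zero, one_mul, Submodule.Quotient.mk_neg,
    Submodule.Quotient.mk_zero]

theorem d2_zero_mk : d2 S r b U V (0, Submodule.Quotient.mk 1) =
    (Submodule.Quotient.mk 1, Submodule.Quotient.mk 0,
      Submodule.Quotient.mk (-gr V), Submodule.Quotient.mk (-1),
      Submodule.Quotient.mk (gr V - 1)) := by
  simp only [d2_apply, qm_mk, map_zero, zero_add, neg_zero, one_mul, Submodule.Quotient.mk_neg,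
    Submodule.Quotient.mk_zero]

theorem eq_zero_of_d1 (h : IsPresentation S r b U V) {Q : Type} [AddCommGroup Q]
    [Module (MonoidAlgebra ℤ G) Q] (π : C1 S r b →ₗ[MonoidAlgebra ℤ G] Q)
    (hd : ∀ y, π (d2 S r b U V y) = 0) (x : C1 S r b) (hx : d1 h x = 0) : π x = 0 := by
  let eS : Q := π (Submodule.Quotient.mk 1, 0, 0, 0, 0)
  let er : Q := π (0, Submodule.Quotient.mk 1, 0, 0, 0)
  let eW : Q := π (0, 0, Submodule.Quotient.mk 1, 0, 0)
  let eb : Q := π (0, 0, 0, Submodule.Quotient.mk 1, 0)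
  let e0 : Q := π (0, 0, 0, 0, Submodule.Quotient.mk 1)
  have hπ : ∀ x1 x2 x3 x4 x5, π ((Submodule.Quotient.mk x1, Submodule.Quotient.mk x2,
      Submodule.Quotient.mk x3, Submodule.Quotient.mk x4, Submodule.Quotient.mk x5) : C1 S r b) =
      x1 • eS + x2 • er + x3 • eW + x4 • eb + x5 • e0 := by
    intro x1 x2 x3 x4 x5
    simp only [eS, er, eW, eb, e0, ← map_smul, ← map_add, Prod.smul_mk, Prod.mk_add_mk, smul_zero,
      add_zero, zero_add, ← mk_eq_smul]
  obtain ⟨x1, x2, x3, x4, x5⟩ := x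
  obtain ⟨x1, rfl⟩ := Submodule.Quotient.mk_surjective _ x1
  obtain ⟨x2, rfl⟩ := Submodule.Quotient.mk_surjective _ x2
  obtain ⟨x3, rfl⟩ := Submodule.Quotient.mk_surjective _ x3
  obtain ⟨x4, rfl⟩ := Submodule.Quotient.mk_surjective _ x4
  obtain ⟨x5, rfl⟩ := Submodule.Quotient.mk_surjective _ x5
  rw [d1_apply] at hx
  simp only [qm_mk, ← Submodule.Quotient.mk_neg, ← Submodule.Quotient.mk_add,
    ← Submodule.Quotient.mk_sub, Prod.ext_iff, Prod.fst_zero, Prod.snd_zero,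
    Submodule.Quotient.mk_eq_zero, mul_one] at hx
  obtain ⟨m1, m2, m3⟩ := hx
  rw [hπ]
  refine combination_eq_zero h ?_ ?_ ?_ ?_ ?_ ?_ m1 m2 m3
  · simp only [eS, ← map_smul, Prod.smul_mk, smul_zero, smul_mk_one (mem_La S)]
  · simp only [er, ← map_smul, Prod.smul_mk, smul_zero, smul_mk_one (mem_La r)]
  · simp only [eW, ← map_smul, Prod.smul_mk, smul_zero, smul_mk_one (mem_La (r * S))]
  · simp only [eb, ← map_smul, Prod.smul_mk, smul_zero, smul_mk_one (mem_La b)]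
  · have := hd (Submodule.Quotient.mk 1, 0)
    rw [d2_mk_zero, hπ] at this
    simp only [zero_smul, add_zero, sub_mul, mul_sub, one_mul, mul_one, ← gr_mul, neg_sub,
      sub_smul, one_smul] at this
    rw [← sub_eq_zero, ← this]
    abel
  · have := hd (0, Submodule.Quotient.mk 1)
    rw [d2_zero_mk, hπ] at this
    simp only [zero_smul, add_zero, neg_smul, one_smul, sub_smul] at this
    rw [← sub_eq_zero, ← this]
    abel

theorem d1_exact (h : IsPresentation S r b U V) (x : C1 S r b) (hx : d1 h x = 0) :
    ∃ y, d2 S r b U V y = x :=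
  (Submodule.Quotient.mk_eq_zero _).1 (eq_zero_of_d1 h (LinearMap.range (d2 S r b U V)).mkQ
    (fun y => (Submodule.Quotient.mk_eq_zero _).2 ⟨y, rfl⟩) x hx)

theorem eq_zero_of_eps (h : IsPresentation S r b U V) {Q : Type} [AddCommGroup Q]
    [Module (MonoidAlgebra ℤ G) Q] (π : C0 S r b U →ₗ[MonoidAlgebra ℤ G] Q)
    (hd0 : ∀ y, π (d1 h y) = 0) (x : C0 S r b U) (hx : eps S r b U x = 0) : π x = 0 := by
  let u1 : Q := π (Submodule.Quotient.mk 1, 0, 0)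
  let u2 : Q := π (0, Submodule.Quotient.mk 1, 0)
  let u3 : Q := π (0, 0, Submodule.Quotient.mk 1)
  have hπ : ∀ x1 x2 x3, π (Submodule.Quotient.mk x1, Submodule.Quotient.mk x2,
      Submodule.Quotient.mk x3) = x1 • u1 + x2 • u2 + x3 • u3 := by
    intro x1 x2 x3
    simp only [u1, u2, u3, ← map_smul, ← map_add, Prod.smul_mk, Prod.mk_add_mk, smul_zero,
      add_zero, zero_add, ← mk_eq_smul]
  have hd : ∀ x1 x2 x3 x4 x5 : MonoidAlgebra ℤ G, -(x1 • u1) - x2 • u1 - x3 • u1 - x5 • u1 + (x1 • u2 + x2 • gr U • u2 +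
      x3 • gr V⁻¹ • u2) + (x4 • ((gr V - 1 : MonoidAlgebra ℤ G) • u3) + x5 • u3) = 0 := by
    intro x1 x2 x3 x4 x5
    have : π (d1 h (Submodule.Quotient.mk x1, Submodule.Quotient.mk x2,
      Submodule.Quotient.mk x3, Submodule.Quotient.mk x4, Submodule.Quotient.mk x5)) = 0 :=
        hd0 _
    rw [d1_apply] at this
    simp only [qm_mk, ← Submodule.Quotient.mk_neg, ← Submodule.Quotient.mk_add,
      ← Submodule.Quotient.mk_sub, mul_one, hπ] at this
    rw [← this]
    simp only [add_smul, sub_smul, neg_smul, mul_smul]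
  have e2 : u2 = u1 := by
    have := hd 1 0 0 0 0
    simp only [zero_smul, one_smul, add_zero, sub_zero] at this
    exact (neg_add_eq_zero.1 this).symm
  have eU : gr U • u1 = u1 := by
    have := hd 0 1 0 0 0
    simp only [zero_smul, one_smul, add_zero, sub_zero, neg_zero, zero_sub, zero_add, e2] at this
    exact (neg_add_eq_zero.1 this).symm
  have eV : gr V⁻¹ • u1 = u1 := by
    have := hd 0 0 1 0 0
    simp only [zero_smul, one_smul, add_zero, sub_zero, neg_zero, zero_sub, zero_add, e2] at this
    exact (neg_add_eq_zero.1 this).symm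
  have e3 : u3 = u1 := by
    have := hd 0 0 0 0 1
    simp only [zero_smul, one_smul, add_zero, sub_zero, neg_zero, zero_sub, zero_add, e2] at this
    exact (neg_add_eq_zero.1 this).symm
  have eS : gr S • u1 = u1 := by
    simp only [u1, ← map_smul, Prod.smul_mk, smul_zero,
      smul_mk_one (Submodule.mem_sup_left (T := La r) (mem_La S))]
  have er : gr r • u1 = u1 := by
    simp only [u1, ← map_smul, Prod.smul_mk, smul_zero,
      smul_mk_one (Submodule.mem_sup_right (S := La S) (mem_La r))]
  have eb : gr b • u1 = u1 := by
    rw [← e3]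
    simp only [u3, ← map_smul, Prod.smul_mk, smul_zero, smul_mk_one (mem_La b)]
  have inv : ∀ g : G, gr g • u1 = u1 → gr g⁻¹ • u1 = u1 := fun g hg => by
    conv_lhs => rw [← hg]
    rw [gr_smul_smul, inv_mul_cancel, gr_one_smul]
  have all : ∀ g : G, gr g • u1 = u1 := by
    intro g
    have hg : g ∈ Subgroup.closure {S, r, b, U, V} := by rw [h.closure]; trivial
    induction hg using Subgroup.closure_induction with
    | mem x hx =>
      rcases hx with rfl | rfl | rfl | rfl | rfl
      exacts [eS, er, eb, eU, by simpa using inv _ eV]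
    | one => exact gr_one_smul _
    | mul x y _ _ hx hy => rw [← gr_smul_smul, hy, hx]
    | inv x _ hx => exact inv _ hx
  have aug' : ∀ y : MonoidAlgebra ℤ G, y • u1 = aug G y • u1 := fun y => by
    induction y using ring_induction with
    | gr g => rw [all, aug_single, one_smul]
    | add y z hy hz => rw [add_smul, hy, hz, map_add, add_smul]
    | neg y hy => rw [neg_smul, hy, map_neg, neg_smul]
  obtain ⟨x1, x2, x3⟩ := x
  obtain ⟨x1, rfl⟩ := Submodule.Quotient.mk_surjective _ x1
  obtain ⟨x2, rfl⟩ := Submodule.Quotient.mk_surjective _ x2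
  obtain ⟨x3, rfl⟩ := Submodule.Quotient.mk_surjective _ x3
  rw [eps_apply] at hx
  simp only [qm_mk, ← Submodule.Quotient.mk_add, Submodule.Quotient.mk_eq_zero, mem_Ia_iff, mul_one,
    map_add] at hx
  rw [hπ, e2, e3, aug', aug', aug', ← add_smul, ← add_smul, add_assoc, hx, zero_smul]

theorem eps_exact (h : IsPresentation S r b U V) (x : C0 S r b U) (hx : eps S r b U x = 0) :
    ∃ y, d1 h y = x :=
  (Submodule.Quotient.mk_eq_zero _).1 (eq_zero_of_eps h (LinearMap.range (d1 h)).mkQ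
    (fun y => (Submodule.Quotient.mk_eq_zero _).2 ⟨y, rfl⟩) x hx)

end Bianchi

namespace GHom

variable {G : Type} [Group G]

section

variable {M N P : Type} [AddCommGroup M] [Module (MonoidAlgebra ℤ G) M] [AddCommGroup N]
  [Module (MonoidAlgebra ℤ G) N] [AddCommGroup P] [Module (MonoidAlgebra ℤ G) P]

theorem hmap_neg (q : ℕ) (f : M →ₗ[MonoidAlgebra ℤ G] N) : hmap q (-f) = -hmap q f := by
  have := hmap_add q f (-f)
  rw [add_neg_cancel, hmap_zero] at this
  exact eq_neg_of_add_eq_zero_right this.symm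

theorem hmap_sub (q : ℕ) (f g : M →ₗ[MonoidAlgebra ℤ G] N) :
    hmap q (f - g) = hmap q f - hmap q g := by
  rw [sub_eq_add_neg, hmap_add, hmap_neg, sub_eq_add_neg]

theorem hmap_hmap (q : ℕ) (g : N →ₗ[MonoidAlgebra ℤ G] P) (f : M →ₗ[MonoidAlgebra ℤ G] N)
    (x : hh G q M) : hmap q g (hmap q f x) = hmap q (g ∘ₗ f) x := by
  rw [hmap_comp]; rfl

theorem hmap_id_apply (q : ℕ) (x : hh G q M) : hmap q LinearMap.id x = x := by
  rw [hmap_id]; rfl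

theorem hmap_zero_apply (q : ℕ) (x : hh G q M) :
    hmap q (0 : M →ₗ[MonoidAlgebra ℤ G] N) x = 0 := by
  rw [hmap_zero]; rfl

variable (M N) in
/-- Homology of a product of coefficient modules. -/
noncomputable def hprod (q : ℕ) : hh G q (M × N) ≃+ hh G q M × hh G q N where
  toFun x := (hmap q (LinearMap.fst (MonoidAlgebra ℤ G) M N) x,
    hmap q (LinearMap.snd (MonoidAlgebra ℤ G) M N) x)
  invFun p := hmap q (LinearMap.inl (MonoidAlgebra ℤ G) M N) p.1 +
    hmap q (LinearMap.inr (MonoidAlgebra ℤ G) M N) p.2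
  left_inv x := by
    simp only [hmap_hmap]
    rw [← AddMonoidHom.add_apply, ← hmap_add]
    refine (congrArg (fun f => hmap q f x) ?_).trans (hmap_id_apply q x)
    refine LinearMap.ext fun y => ?_
    simp
  right_inv p := by
    simp only [map_add, hmap_hmap, LinearMap.fst_comp_inl, LinearMap.fst_comp_inr,
      LinearMap.snd_comp_inl, LinearMap.snd_comp_inr, hmap_id_apply, hmap_zero_apply, add_zero,
      zero_add]
  map_add' x y := by simp only [map_add, Prod.mk_add_mk]

theorem hprod_apply (q : ℕ) (x : hh G q (M × N)) : hprod M N q x =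
    (hmap q (LinearMap.fst (MonoidAlgebra ℤ G) M N) x,
      hmap q (LinearMap.snd (MonoidAlgebra ℤ G) M N) x) := rfl

end

theorem card_ker_mul_card_range {A B : Type} [AddCommGroup A] [AddCommGroup B] (f : A →+ B) :
    Nat.card f.ker * Nat.card f.range = Nat.card A := by
  rw [← AddSubgroup.index_ker, AddSubgroup.card_mul_index]

end GHom

namespace Bianchi

open GHom

variable {G : Type} [Group G] {S r b U V : G}

/-- The boundary of the edges, with values in the augmentation kernel. -/
noncomputable def d1' (h : IsPresentation S r b U V) :
    C1 S r b →ₗ[MonoidAlgebra ℤ G] LinearMap.ker (eps S r b U) :=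
  (d1 h).codRestrict _ (eps_d1 h)

theorem ses_left (h : IsPresentation S r b U V) : IsSES (d2 S r b U V) (d1' h) where
  inj := d2_injective h
  surj := fun ⟨x, hx⟩ => by
    obtain ⟨y, rfl⟩ := eps_exact h x hx
    exact ⟨y, rfl⟩
  exact := fun x => by
    refine ⟨fun hx => d1_exact h x (congrArg Subtype.val hx), ?_⟩
    rintro ⟨y, rfl⟩
    exact Subtype.ext (d1_d2 h y)

theorem ses_right (S r b U : G) :
    IsSES (LinearMap.ker (eps S r b U)).subtype (eps S r b U) where
  inj := Subtype.val_injective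
  surj := fun x => by
    obtain ⟨y, rfl⟩ := Submodule.Quotient.mk_surjective _ x
    refine ⟨(Submodule.Quotient.mk y, 0, 0), ?_⟩
    rw [eps_apply, map_zero, map_zero, add_zero, add_zero, qm_mk, mul_one]
  exact := fun x => by
    refine ⟨fun hx => ⟨⟨x, hx⟩, rfl⟩, ?_⟩
    rintro ⟨y, rfl⟩
    exact y.2

theorem subtype_d1' (h : IsPresentation S r b U V) (q : ℕ) (x : hh G q (C1 S r b)) :
    hmap q (LinearMap.ker (eps S r b U)).subtype (hmap q (d1' h) x) = hmap q (d1 h) x := by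
  rw [hmap_hmap]; rfl

theorem hC2_subsingleton (q : ℕ) : Subsingleton (hh G (q + 1) (C2 G)) :=
  have := hl_bot_subsingleton (G := G) q
  (hprod _ _ (q + 1)).toEquiv.subsingleton

theorem d1'_injective (h : IsPresentation S r b U V) (q : ℕ) :
    Function.Injective (hmap (q + 1) (d1' h)) := by
  rw [injective_iff_map_eq_zero]
  intro x hx
  obtain ⟨y, rfl⟩ := ((ses_left h).exact₂ (q + 1) x).1 hx
  rw [(hC2_subsingleton (G := G) q).elim y 0, map_zero]

theorem d1'_surjective (h : IsPresentation S r b U V) (q : ℕ) :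
    Function.Surjective (hmap (q + 2) (d1' h)) := fun x =>
  ((ses_left h).exact₃ (q + 1) x).1 ((hC2_subsingleton (G := G) q).elim _ _)

theorem card_ker_subtype (h : IsPresentation S r b U V) (q : ℕ) :
    Nat.card (hmap (q + 2) (LinearMap.ker (eps S r b U)).subtype).ker =
      Nat.card (hmap (q + 2) (d1 h)).ker := by
  refine (Nat.card_congr (Equiv.ofBijective (fun x : (hmap (q + 2) (d1 h)).ker =>
    (⟨hmap (q + 2) (d1' h) x.1, by rw [AddMonoidHom.mem_ker, subtype_d1']; exact x.2⟩ :
      (hmap (q + 2) (LinearMap.ker (eps S r b U)).subtype).ker)) ⟨fun x y e => ?_, fun y => ?_⟩)).symm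
  · exact Subtype.ext (d1'_injective h _ (congrArg Subtype.val e))
  · obtain ⟨x, hx⟩ := d1'_surjective h q y.1
    refine ⟨⟨x, ?_⟩, Subtype.ext hx⟩
    rw [AddMonoidHom.mem_ker, ← subtype_d1', hx]
    exact y.2

theorem ker_eps (h : IsPresentation S r b U V) (q : ℕ) :
    (hmap (q + 2) (eps S r b U)).ker = (hmap (q + 2) (d1 h)).range := by
  ext x
  refine ((ses_right S r b U).exact₂ (q + 2) x).trans ⟨?_, ?_⟩
  · rintro ⟨y, rfl⟩
    obtain ⟨z, rfl⟩ := d1'_surjective h q y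
    exact ⟨z, (subtype_d1' h _ z).symm⟩
  · rintro ⟨z, rfl⟩
    exact ⟨_, subtype_d1' h _ z⟩

theorem ker_δ (q : ℕ) :
    ((ses_right S r b U).δ q).ker = (hmap (q + 1) (eps S r b U)).range := by
  ext x
  exact (ses_right S r b U).exact₃ q x

theorem range_δ (q : ℕ) :
    ((ses_right S r b U).δ q).range = (hmap q (LinearMap.ker (eps S r b U)).subtype).ker := by
  ext x
  exact ((ses_right S r b U).exact₁ q x).symm

/-- The homology of the edges. -/
noncomputable def hC1 (S r b : G) (q : ℕ) : hh G q (C1 S r b) ≃+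
    hl q (La S) × hl q (La r) × hl q (La (r * S)) × hl q (La b) ×
      hl q (⊥ : Submodule (MonoidAlgebra ℤ G) (MonoidAlgebra ℤ G)) :=
  (hprod _ _ q).trans ((AddEquiv.refl _).prodCongr ((hprod _ _ q).trans
    ((AddEquiv.refl _).prodCongr ((hprod _ _ q).trans ((AddEquiv.refl _).prodCongr (hprod _ _ q))))))

/-- The homology of the vertices. -/
noncomputable def hC0 (S r b U : G) (q : ℕ) : hh G q (C0 S r b U) ≃+
    hl q (La S ⊔ La r) × hl q (La S ⊔ La (U⁻¹ * r * U)) × hl q (La b) :=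
  (hprod _ _ q).trans ((AddEquiv.refl _).prodCongr (hprod _ _ q))

theorem hC1_apply (q : ℕ) (x : hh G q (C1 S r b)) : hC1 S r b q x =
    (hmap q (LinearMap.fst _ _ _) x, hmap q (LinearMap.fst _ _ _) (hmap q (LinearMap.snd _ _ _) x),
      hmap q (LinearMap.fst _ _ _) (hmap q (LinearMap.snd _ _ _) (hmap q (LinearMap.snd _ _ _) x)),
      hmap q (LinearMap.fst _ _ _) (hmap q (LinearMap.snd _ _ _) (hmap q (LinearMap.snd _ _ _)
        (hmap q (LinearMap.snd _ _ _) x))),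
      hmap q (LinearMap.snd _ _ _) (hmap q (LinearMap.snd _ _ _) (hmap q (LinearMap.snd _ _ _)
        (hmap q (LinearMap.snd _ _ _) x)))) := rfl

theorem hC0_apply (q : ℕ) (x : hh G q (C0 S r b U)) : hC0 S r b U q x =
    (hmap q (LinearMap.fst _ _ _) x, hmap q (LinearMap.fst _ _ _) (hmap q (LinearMap.snd _ _ _) x),
      hmap q (LinearMap.snd _ _ _) (hmap q (LinearMap.snd _ _ _) x)) := rfl

theorem hC0_d1 (h : IsPresentation S r b U V) (q : ℕ) (x : hh G q (C1 S r b)) :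
    hC0 S r b U q (hmap q (d1 h) x) =
      (-(hm q compat_S_one (hC1 S r b q x).1) - hm q compat_r_one (hC1 S r b q x).2.1 -
        hm q compat_W_one (hC1 S r b q x).2.2.1 -
        hm q (compat_bot (z := 1)) (hC1 S r b q x).2.2.2.2,
      hm q compat_S_two (hC1 S r b q x).1 + hm q compat_r_two (hC1 S r b q x).2.1 +
        hm q (compat_W_two h) (hC1 S r b q x).2.2.1,
      hm q (compat_b h) (hC1 S r b q x).2.2.2.1 +
        hm q (compat_bot (z := 1)) (hC1 S r b q x).2.2.2.2) := by
  rw [hC0_apply, hC1_apply]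
  simp only [hmap_hmap]
  simp only [← AddMonoidHom.neg_apply, ← AddMonoidHom.add_apply, ← AddMonoidHom.sub_apply,
    ← hmap_add, ← hmap_sub, ← hmap_neg]
  rfl

end Bianchi

namespace GHom

variable {G : Type} [Group G]

theorem hm_Ia {L L' : Submodule (MonoidAlgebra ℤ G) (MonoidAlgebra ℤ G)} {z : MonoidAlgebra ℤ G}
    (q : ℕ) (c : Compat L z L') (h : L ≤ Ia G) (h' : L' ≤ Ia G) (hz : aug G z = 1) (x : hl q L) :
    hm q (compat_of_le h') (hm q c x) = hm q (compat_of_le h) x := by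
  rw [hm_hm]
  refine hm_congr q _ _ ?_ x
  rw [mul_one, mem_Ia_iff, map_sub, hz, map_one, sub_self]

theorem nonempty_addEquiv_pow_two_mul_three {A : Type} [AddCommGroup A] (n : ℕ)
    (h6 : ∀ x : A, 6 • x = 0) (hc : Nat.card A = 3 * 2 ^ n) :
    Nonempty (A ≃+ ZMod 3 × (Fin n → ZMod 2)) := by
  have : Finite A := Nat.finite_of_card_ne_zero (by rw [hc]; positivity)
  let A2 : AddSubgroup A := (nsmulAddMonoidHom 2).ker
  let A3 : AddSubgroup A := (nsmulAddMonoidHom 3).ker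
  have h2 : ∀ x : A2, 2 • x = 0 := fun x => Subtype.ext x.2
  have h3 : ∀ x : A3, 3 • x = 0 := fun x => Subtype.ext x.2
  let e : A ≃+ A3 × A2 :=
    { toFun := fun x => (⟨4 • x, by
          change 3 • 4 • x = 0
          rw [smul_smul, show 3 * 4 = 2 * 6 by rfl, mul_smul, h6, smul_zero]⟩, ⟨3 • x, by
          change 2 • 3 • x = 0
          rw [smul_smul]; exact h6 x⟩)
      invFun := fun p => p.1.1 + p.2.1
      left_inv := fun x => by
        change 4 • x + 3 • x = x
        rw [← add_smul, show 4 + 3 = 6 + 1 by rfl, add_smul, h6, zero_add, one_smul]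
      right_inv := fun p => by
        have e1 : 3 • p.1.1 = 0 := p.1.2
        have e2 : 2 • p.2.1 = 0 := p.2.2
        refine Prod.ext (Subtype.ext ?_) (Subtype.ext ?_)
        · change 4 • (p.1.1 + p.2.1) = p.1.1
          rw [smul_add, show 4 = 2 * 2 by rfl, mul_smul 2 2 p.2.1, e2, smul_zero, add_zero,
            show 2 * 2 = 3 + 1 by rfl, add_smul, e1, zero_add, one_smul]
        · change 3 • (p.1.1 + p.2.1) = p.2.1
          rw [smul_add, e1, zero_add, show 3 = 2 + 1 by rfl, add_smul, e2, zero_add, one_smul]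
      map_add' := fun x y => by
        refine Prod.ext (Subtype.ext ?_) (Subtype.ext ?_)
        · exact smul_add 4 x y
        · exact smul_add 3 x y }
  let m2 : Module (ZMod 2) A2 := AddCommGroup.zmodModule h2
  let m3 : Module (ZMod 3) A3 := AddCommGroup.zmodModule h3
  have c2 := Module.natCard_eq_pow_finrank (K := ZMod 2) (V := A2)
  have c3 := Module.natCard_eq_pow_finrank (K := ZMod 3) (V := A3)
  have c := Nat.card_congr e.toEquiv
  rw [Nat.card_prod, hc, c2, c3, Nat.card_zmod, Nat.card_zmod] at c
  have f2 : Module.finrank (ZMod 2) A2 = n := by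
    have := congrArg (fun k => k.factorization 2) c
    simpa [Nat.factorization_mul, Nat.factorization_pow, Nat.Prime.factorization,
      Nat.prime_two, Nat.prime_three] using this.symm
  have f3 : Module.finrank (ZMod 3) A3 = 1 := by
    have := congrArg (fun k => k.factorization 3) c
    simpa [Nat.factorization_mul, Nat.factorization_pow, Nat.Prime.factorization,
      Nat.prime_two, Nat.prime_three] using this.symm
  obtain ⟨l2⟩ : Nonempty (A2 ≃ₗ[ZMod 2] (Fin n → ZMod 2)) :=
    FiniteDimensional.nonempty_linearEquiv_of_finrank_eq (by rw [f2]; simp)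
  obtain ⟨l3⟩ : Nonempty (A3 ≃ₗ[ZMod 3] ZMod 3) :=
    FiniteDimensional.nonempty_linearEquiv_of_finrank_eq (by rw [f3]; simp)
  exact ⟨e.trans (l3.toAddEquiv.prodCongr l2.toAddEquiv)⟩

end GHom

namespace Bianchi

open GHom

variable {G : Type} [Group G] {S r b U V : G}

/-- Characters detecting the finite subgroups. -/
structure Detect (S r b U : G) (χS χr : G →* Multiplicative (ZMod 2))
    (χb : G →* Multiplicative (ZMod 3)) : Prop where
  one : Klein S r χS χr
  two : Klein S (U⁻¹ * r * U) χS χr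
  b_pow : b ^ 3 = 1
  χ_b : χb b = Multiplicative.ofAdd 1

theorem IsPresentation.exists_detect (h : IsPresentation S r b U V) :
    ∃ χS χr χb, Detect S r b U χS χr χb := by
  obtain ⟨χS, S1, S2, S3, S4, S5⟩ := h.lift (H := Multiplicative (ZMod 2))
    (S' := Multiplicative.ofAdd 1) (r' := 1) (b' := 1) (U' := 1) (V' := 1) (by constructor <;> decide)
  obtain ⟨χr, r1, r2, r3, r4, r5⟩ := h.lift (H := Multiplicative (ZMod 2))
    (S' := 1) (r' := Multiplicative.ofAdd 1) (b' := 1) (U' := 1) (V' := 1) (by constructor <;> decide)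
  obtain ⟨χb, b1, b2, b3, b4, b5⟩ := h.lift (H := Multiplicative (ZMod 3))
    (S' := 1) (r' := 1) (b' := Multiplicative.ofAdd 1) (U' := 1) (V' := 1) (by constructor <;> decide)
  refine ⟨χS, χr, χb, ⟨h.rel.S_S, h.rel.r_r, h.rel.r_S.symm, S1, S2, r1, r2⟩,
    ⟨h.rel.S_S, ?_, ?_, S1, ?_, r1, ?_⟩, ?_, b3⟩
  · calc U⁻¹ * r * U * (U⁻¹ * r * U) = U⁻¹ * (r * r) * U := by group
      _ = 1 := by rw [h.rel.r_r]; group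
  · have e : U⁻¹ * r * U * S = V * (r * S) * V⁻¹ := by rw [h.rel.V_W, mul_inv_cancel_right]
    have e' : (U⁻¹ * r * U * S)⁻¹ = U⁻¹ * r * U * S := by
      rw [e, mul_inv_rev, mul_inv_rev, inv_inv, mul_inv_rev, h.rel.S_inv, h.rel.r_inv,
        ← h.rel.r_S]
      simp only [mul_assoc]
    rw [← e', mul_inv_rev, mul_inv_rev, mul_inv_rev, inv_inv, h.rel.S_inv, h.rel.r_inv]
    simp only [mul_assoc]
  · rw [map_mul, map_mul, map_inv, S4, S2]; rfl
  · rw [map_mul, map_mul, map_inv, r4, r2]; rfl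
  · rw [pow_succ, pow_two, h.rel.b_b]

section Degree

variable {χS χr : G →* Multiplicative (ZMod 2)} {χb : G →* Multiplicative (ZMod 3)}

theorem hm_compat_b (h : IsPresentation S r b U V) (t : Detect S r b U χS χr χb) (q : ℕ)
    (x : hl q (La b)) : hm q (compat_b h) x = 0 := by
  refine (injective_iff_map_eq_zero _).1 (La_detect t.b_pow t.χ_b q) _ ?_
  rw [hm_hm]
  refine hm_eq_zero q _ ?_ x
  rw [mul_one, mem_Ia_iff, map_sub, aug_single, map_one, sub_self]

theorem hC0_d1_succ (h : IsPresentation S r b U V) (t : Detect S r b U χS χr χb) (q : ℕ)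
    (x : hh G (q + 1) (C1 S r b)) : hC0 S r b U (q + 1) (hmap (q + 1) (d1 h) x) =
      (-(hm (q + 1) compat_S_one (hC1 S r b (q + 1) x).1) -
        hm (q + 1) compat_r_one (hC1 S r b (q + 1) x).2.1 -
        hm (q + 1) compat_W_one (hC1 S r b (q + 1) x).2.2.1,
      hm (q + 1) compat_S_two (hC1 S r b (q + 1) x).1 +
        hm (q + 1) compat_r_two (hC1 S r b (q + 1) x).2.1 +
        hm (q + 1) (compat_W_two h) (hC1 S r b (q + 1) x).2.2.1, 0) := by
  rw [hC0_d1, hm_compat_b h t, (hl_bot_subsingleton (G := G) q).elim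
    (hC1 S r b (q + 1) x).2.2.2.2 0, map_zero, map_zero, sub_zero, add_zero]

theorem sum_Ia (h : IsPresentation S r b U V) (t : Detect S r b U χS χr χb) (q : ℕ)
    (x : hh G (q + 1) (C1 S r b))
    (hx : (hC0 S r b U (q + 1) (hmap (q + 1) (d1 h) x)).1 = 0) :
    hm (q + 1) (compat_of_le (La_le_Ia S)) (hC1 S r b (q + 1) x).1 +
      hm (q + 1) (compat_of_le (La_le_Ia r)) (hC1 S r b (q + 1) x).2.1 +
      hm (q + 1) (compat_of_le (La_le_Ia (r * S))) (hC1 S r b (q + 1) x).2.2.1 = 0 := by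
  rw [hC0_d1_succ h t] at hx
  have := congrArg (hm (q + 1) (compat_of_le (Klein.le_Ia S r))) hx
  rw [map_sub, map_sub, map_neg, map_zero, hm_Ia _ _ (La_le_Ia _) (Klein.le_Ia S r) (map_one _),
    hm_Ia _ _ (La_le_Ia _) (Klein.le_Ia S r) (map_one _),
    hm_Ia _ _ (La_le_Ia _) (Klein.le_Ia S r) (map_one _)] at this
  rw [← neg_eq_zero, ← this]
  abel

theorem card_ker_d1_high (h : IsPresentation S r b U V) (t : Detect S r b U χS χr χb) (q : ℕ) :
    Nat.card (hmap (q + 3) (d1 h)).ker = Nat.card (hl (q + 3) (La b)) := by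
  have key : ∀ x : hh G (q + 3) (C1 S r b), hmap (q + 3) (d1 h) x = 0 →
      hC1 S r b (q + 3) x = (0, 0, 0, (hC1 S r b (q + 3) x).2.2.2.1, 0) := by
    intro x hx
    obtain ⟨e1, e2, e3⟩ := t.one.detect_triple rfl q _ _ _
      (sum_Ia h t (q + 2) x (by rw [hx, map_zero]; rfl))
    exact Prod.ext e1 (Prod.ext e2 (Prod.ext e3 (Prod.ext rfl
      ((hl_bot_subsingleton (G := G) (q + 2)).elim _ _))))
  refine Nat.card_congr (Equiv.ofBijective
    (fun x : (hmap (q + 3) (d1 h)).ker => (hC1 S r b (q + 3) x.1).2.2.2.1) ⟨fun x y e => ?_,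
      fun y => ?_⟩)
  · refine Subtype.ext ((hC1 S r b (q + 3)).injective ?_)
    rw [key x.1 x.2, key y.1 y.2]
    exact congrArg (fun a => (0, 0, 0, a, 0)) e
  · refine ⟨⟨(hC1 S r b (q + 3)).symm (0, 0, 0, y, 0), ?_⟩, ?_⟩
    · refine (hC0 S r b U (q + 3)).injective ?_
      rw [map_zero, hC0_d1_succ h t (q + 2), AddEquiv.apply_symm_apply]
      simp only [map_zero, neg_zero, sub_zero, add_zero]
      rfl
    · simp only [AddEquiv.apply_symm_apply]

theorem mul_S_pow (t : Detect S r b U χS χr χb) : (r * S) ^ 2 = 1 := by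
  rw [pow_two, mul_assoc, ← mul_assoc S, t.one.comm, mul_assoc r, t.one.s_sq, mul_one, t.one.t_sq]

theorem χS_mul (t : Detect S r b U χS χr χb) : χS (r * S) = Multiplicative.ofAdd 1 := by
  rw [map_mul, t.one.s_t, t.one.s_s, one_mul]

theorem hC1_even (t : Detect S r b U χS χr χb) (k : ℕ) :
    Subsingleton (hh G (2 * k + 2) (C1 S r b)) := by
  have h1 := La_subsingleton t.one.s_pow t.one.s_s k
  have h2 := La_subsingleton t.one.t_pow t.one.t_t k
  have h3 := La_subsingleton (mul_S_pow t) (χS_mul t) k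
  have h4 := La_subsingleton t.b_pow t.χ_b k
  have h5 := hl_bot_subsingleton (G := G) (2 * k + 1)
  exact (hC1 S r b (2 * k + 2)).toEquiv.subsingleton

theorem card_hC1_odd (t : Detect S r b U χS χr χb) (k : ℕ) :
    Nat.card (hh G (2 * k + 1) (C1 S r b)) = 24 := by
  have h5 := hl_bot_subsingleton (G := G) (2 * k)
  rw [Nat.card_congr (hC1 S r b (2 * k + 1)).toEquiv, Nat.card_prod, Nat.card_prod, Nat.card_prod,
    Nat.card_prod, La_card t.one.s_pow t.one.s_s, La_card t.one.t_pow t.one.t_t,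
    La_card (mul_S_pow t) (χS_mul t), La_card t.b_pow t.χ_b, Nat.card_of_subsingleton 0]

theorem card_hC0_odd (t : Detect S r b U χS χr χb) (k : ℕ) :
    Nat.card (hh G (2 * k + 1) (C0 S r b U)) = 3 * 2 ^ (2 * k + 4) := by
  rw [Nat.card_congr (hC0 S r b U (2 * k + 1)).toEquiv, Nat.card_prod, Nat.card_prod,
    (t.one.card_odd_even k).1, (t.two.card_odd_even k).1, La_card t.b_pow t.χ_b]
  ring

theorem card_hC0_even (t : Detect S r b U χS χr χb) (k : ℕ) :
    Nat.card (hh G (2 * k + 2) (C0 S r b U)) = 2 ^ (2 * k + 2) := by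
  have h4 := La_subsingleton t.b_pow t.χ_b k
  rw [Nat.card_congr (hC0 S r b U (2 * k + 2)).toEquiv, Nat.card_prod, Nat.card_prod,
    (t.one.card_odd_even k).2.2.1, (t.two.card_odd_even k).2.2.1, Nat.card_of_subsingleton 0]
  ring

theorem six_nsmul_hC0 (t : Detect S r b U χS χr χb) (q : ℕ)
    (x : hh G (q + 1) (C0 S r b U)) : 6 • x = 0 := by
  refine (hC0 S r b U (q + 1)).injective ?_
  rw [map_nsmul, map_zero]
  refine Prod.ext ?_ (Prod.ext ?_ ?_)
  · change (3 * 2) • (hC0 S r b U (q + 1) x).1 = 0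
    rw [mul_smul, t.one.two_nsmul, smul_zero]
  · change (3 * 2) • (hC0 S r b U (q + 1) x).2.1 = 0
    rw [mul_smul, t.two.two_nsmul, smul_zero]
  · change (2 * 3) • (hC0 S r b U (q + 1) x).2.2 = 0
    rw [mul_smul, La_nsmul t.b_pow t.χ_b, smul_zero]

theorem two_nsmul_hC0_even (t : Detect S r b U χS χr χb) (k : ℕ)
    (x : hh G (2 * k + 2) (C0 S r b U)) : 2 • x = 0 := by
  refine (hC0 S r b U (2 * k + 2)).injective ?_
  rw [map_nsmul, map_zero]
  refine Prod.ext ?_ (Prod.ext ?_ ?_)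
  · exact t.one.two_nsmul _ _
  · exact t.two.two_nsmul _ _
  · exact (La_subsingleton t.b_pow t.χ_b k).elim _ _

theorem homology_odd (h : IsPresentation S r b U V) (k : ℕ) :
    Nonempty (hl (2 * k + 3) (Ia G) ≃+ ZMod 3 × (Fin (2 * k + 3) → ZMod 2)) := by
  obtain ⟨χS, χr, χb, t⟩ := h.exists_detect
  have inj : ((ses_right S r b U).δ (2 * k + 2)).range = ⊥ := by
    have := hC1_even t k
    rw [range_δ, ← AddSubgroup.card_eq_one, card_ker_subtype h (2 * k)]
    exact Nat.card_of_subsingleton 0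
  have surj : Function.Surjective (hmap (2 * k + 3) (eps S r b U)) := fun x => by
    have : x ∈ ((ses_right S r b U).δ (2 * k + 2)).ker := by
      rw [AddMonoidHom.mem_ker, ← AddSubgroup.mem_bot, ← inj]
      exact ⟨x, rfl⟩
    rw [ker_δ] at this
    exact this
  refine nonempty_addEquiv_pow_two_mul_three _ (fun x => ?_) ?_
  · obtain ⟨y, rfl⟩ := surj x
    rw [← map_nsmul, six_nsmul_hC0 t, map_zero]
  · have c1 := card_ker_mul_card_range (hmap (2 * k + 3) (eps S r b U))
    have c2 := card_ker_mul_card_range (hmap (2 * k + 3) (d1 h))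
    have c3 := card_ker_d1_high h t (2 * k)
    have c4 : Nat.card (hl (2 * k + 3) (La b)) = 3 := La_card t.b_pow t.χ_b (k + 1)
    have c5 : Nat.card (hh G (2 * k + 3) (C1 S r b)) = 24 := card_hC1_odd t (k + 1)
    have c6 : Nat.card (hh G (2 * k + 3) (C0 S r b U)) = _ := card_hC0_odd t (k + 1)
    have c7 : Nat.card (hmap (2 * k + 3) (eps S r b U)).range = Nat.card (hl (2 * k + 3) (Ia G)) := by
      rw [AddMonoidHom.range_eq_top.2 surj]
      exact Nat.card_congr AddSubgroup.topEquiv.toEquiv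
    have c8 : Nat.card (hmap (2 * k + 3) (eps S r b U)).ker =
      Nat.card (hmap (2 * k + 3) (d1 h)).range := by rw [ker_eps h (2 * k + 1)]
    rw [c3, c4, c5] at c2
    rw [c8, show Nat.card (hmap (2 * k + 3) (d1 h)).range = 8 by omega, c7, c6] at c1
    have : 2 ^ (2 * (k + 1) + 4) = 8 * 2 ^ (2 * k + 3) := by ring
    omega

theorem homology_even (h : IsPresentation S r b U V) (k : ℕ) :
    Nonempty (hl (2 * k + 4) (Ia G) ≃+ ZMod 3 × (Fin (2 * k + 4) → ZMod 2)) := by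
  obtain ⟨χS, χr, χb, t⟩ := h.exists_detect
  have c0 : Nat.card ((ses_right S r b U).δ (2 * k + 3)).range = 3 := by
    rw [range_δ, card_ker_subtype h (2 * k + 1), card_ker_d1_high h t (2 * k)]
    exact La_card t.b_pow t.χ_b (k + 1)
  have c1 := card_ker_mul_card_range ((ses_right S r b U).δ (2 * k + 3))
  refine nonempty_addEquiv_pow_two_mul_three _ (fun x => ?_) ?_
  · have : 3 • x ∈ ((ses_right S r b U).δ (2 * k + 3)).ker := by
      rw [AddMonoidHom.mem_ker, map_nsmul]
      have := card_nsmul_eq_zero' (x := (⟨(ses_right S r b U).δ (2 * k + 3) x, x, rfl⟩ :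
        ((ses_right S r b U).δ (2 * k + 3)).range))
      rw [c0] at this
      exact congrArg Subtype.val this
    rw [ker_δ] at this
    obtain ⟨y, hy⟩ := this
    rw [show 6 = 2 * 3 by rfl, mul_smul, ← hy, ← map_nsmul]
    rw [show 2 • y = 0 from two_nsmul_hC0_even t (k + 1) y, map_zero]
  · have c2 := card_ker_mul_card_range (hmap (2 * k + 4) (eps S r b U))
    have c6 : Nat.card (hh G (2 * k + 4) (C0 S r b U)) = _ := card_hC0_even t (k + 1)
    have c8 : Nat.card (hmap (2 * k + 4) (eps S r b U)).ker = 1 := by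
      have : Subsingleton (hh G (2 * k + 4) (C1 S r b)) := hC1_even t (k + 1)
      rw [ker_eps h (2 * k + 2), AddSubgroup.card_eq_one]
      refine (AddSubgroup.eq_bot_iff_forall _).2 ?_
      rintro _ ⟨y, rfl⟩
      rw [Subsingleton.elim y 0, map_zero]
    rw [ker_δ, c0] at c1
    rw [c8, one_mul, c6] at c2
    rw [← c1, c2]
    ring

end Degree

end Bianchi

namespace GHom

theorem nonempty_addEquiv_int_prod_ker {H : Type} [AddCommGroup H] (p : H →+ ℤ) (w : H)
    (hw : p w ≠ 0) : Nonempty (H ≃+ ℤ × p.ker) := by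
  obtain ⟨a, ha⟩ := Int.subgroup_cyclic p.range
  rw [← AddSubgroup.zmultiples_eq_closure] at ha
  have hd : ∀ x, a ∣ p x := fun x => Int.mem_zmultiples_iff.1 (ha ▸ ⟨x, rfl⟩)
  obtain ⟨y, hy⟩ : ∃ y, p y = a := by
    have : a ∈ p.range := ha ▸ AddSubgroup.mem_zmultiples a
    exact this
  have ha0 : a ≠ 0 := fun h => hw (by simpa [h] using hd w)
  let q : H →+ ℤ :=
    { toFun := fun x => p x / a
      map_zero' := by rw [map_zero, Int.zero_ediv]
      map_add' := fun x z => by rw [map_add, Int.add_ediv_of_dvd_left (hd x)] }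
  have hq : ∀ x, q x * a = p x := fun x => Int.ediv_mul_cancel (hd x)
  have hqy : q y = 1 := by
    change p y / a = 1
    rw [hy, Int.ediv_self ha0]
  have hk : ∀ k : p.ker, q k = 0 := fun k => by
    change p k / a = 0
    rw [show p k = 0 from k.2, Int.zero_ediv]
  exact ⟨{
    toFun := fun x => (q x, ⟨x - q x • y, by
      rw [AddMonoidHom.mem_ker, map_sub, map_zsmul, hy, smul_eq_mul, hq, sub_self]⟩)
    invFun := fun n => n.1 • y + n.2
    left_inv := fun x => add_sub_cancel _ _
    right_inv := fun n => by
      have : q (n.1 • y + n.2) = n.1 := by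
        rw [map_add, map_zsmul, hqy, hk, smul_eq_mul, mul_one, add_zero]
      refine Prod.ext this (Subtype.ext ?_)
      change n.1 • y + n.2 - q (n.1 • y + n.2) • y = n.2
      rw [this, add_sub_cancel_left]
    map_add' := fun x z => by
      refine Prod.ext (map_add q x z) (Subtype.ext ?_)
      change x + z - q (x + z) • y = x - q x • y + (z - q z • y)
      rw [map_add, add_smul]
      abel }⟩

theorem exists_zmod_hom {A : Type} [AddCommGroup A] (n : ℕ) (x : A) (hx : n • x = 0) :
    ∃ f : ZMod n →+ A, ∀ k : ℕ, f k = k • x := by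
  let g : { f : ℤ →+ A // f n = 0 } := ⟨zmultiplesHom A x, by
    change (n : ℤ) • x = 0
    rw [natCast_zsmul, hx]⟩
  refine ⟨ZMod.lift n g, fun k => ?_⟩
  have := ZMod.lift_coe n g k
  rw [Int.cast_natCast] at this
  refine this.trans ?_
  change (k : ℤ) • x = _
  rw [natCast_zsmul]

theorem nonempty_addEquiv_of_card_eq_24 {A : Type} [AddCommGroup A] (hc : Nat.card A = 24)
    (w x : A) (hw : 4 • w = 0) (hw' : 2 • w ≠ 0) (hx : 2 • x = 0) (hx0 : x ≠ 0)
    (hxw : x ≠ 2 • w) : Nonempty (ZMod 4 × ZMod 3 × ZMod 2 ≃+ A) := by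
  have : Finite A := Nat.finite_of_card_ne_zero (by rw [hc]; decide)
  obtain ⟨t, ht⟩ := exists_prime_addOrderOf_dvd_card' (G := A) 3 (by rw [hc]; decide)
  have ht3 : 3 • t = 0 := by rw [← ht]; exact addOrderOf_nsmul_eq_zero t
  obtain ⟨fw, ew⟩ := exists_zmod_hom 4 w hw
  obtain ⟨ft, et⟩ := exists_zmod_hom 3 t ht3
  obtain ⟨fx, ex⟩ := exists_zmod_hom 2 x hx
  let f : ZMod 4 × ZMod 3 × ZMod 2 →+ A := fw.coprod (ft.coprod fx)
  have inj : Function.Injective f := by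
    rw [injective_iff_map_eq_zero]
    rintro ⟨a, b, c⟩ h
    obtain ⟨a, ha, rfl⟩ : ∃ n : ℕ, n < 4 ∧ (n : ZMod 4) = a :=
      ⟨a.val, a.val_lt, ZMod.natCast_zmod_val a⟩
    obtain ⟨b, hb, rfl⟩ : ∃ n : ℕ, n < 3 ∧ (n : ZMod 3) = b :=
      ⟨b.val, b.val_lt, ZMod.natCast_zmod_val b⟩
    obtain ⟨c, hc, rfl⟩ : ∃ n : ℕ, n < 2 ∧ (n : ZMod 2) = c :=
      ⟨c.val, c.val_lt, ZMod.natCast_zmod_val c⟩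
    change fw a + (ft b + fx c) = 0 at h
    rw [ew, et, ex] at h
    have hb4 : (4 * b) • t = 0 := by
      have e := congrArg (4 • ·) h
      simp only [smul_add, smul_zero] at e
      rwa [smul_comm 4 a w, hw, smul_zero, zero_add, smul_comm 4 c x, show 4 = 2 * 2 by rfl,
        mul_smul 2 2 x, hx, smul_zero, smul_zero, add_zero, smul_smul] at e
    have hb0 : b = 0 := by
      have := ht ▸ addOrderOf_dvd_of_nsmul_eq_zero hb4
      omega
    subst hb0
    rw [zero_smul, zero_add] at h
    have h2 : (2 * a) • w = 0 := by
      have e := congrArg (2 • ·) h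
      simp only [smul_add, smul_zero] at e
      rwa [smul_comm 2 c x, hx, smul_zero, add_zero, smul_smul] at e
    have hor : addOrderOf w = 2 ^ (1 + 1) := addOrderOf_eq_prime_pow hw' hw
    have h4 := hor ▸ addOrderOf_dvd_of_nsmul_eq_zero h2
    have h01 : a = 0 ∨ a = 2 := by omega
    have h02 : c = 0 ∨ c = 1 := by omega
    rcases h01 with rfl | rfl <;> rcases h02 with rfl | rfl
    · rfl
    · rw [zero_smul, zero_add, one_smul] at h
      exact absurd h hx0
    · rw [zero_smul, add_zero] at h
      exact absurd h hw'
    · rw [one_smul] at h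
      refine absurd ?_ hxw
      rw [two_smul] at hx
      exact (eq_neg_of_add_eq_zero_left hx).trans (eq_neg_of_add_eq_zero_left h).symm
  refine ⟨AddEquiv.ofBijective f (inj.bijective_of_nat_card_le ?_)⟩
  rw [hc, Nat.card_prod, Nat.card_prod, Nat.card_zmod, Nat.card_zmod, Nat.card_zmod]

end GHom

namespace GHom

variable {G : Type} [Group G] {s t : G} {χs χt : G →* Multiplicative (ZMod 2)}

theorem Klein.exists_add (k : Klein s t χs χt) (x : hl 1 (La s ⊔ La t)) : ∃ u v,
    x = hm 1 (compat_of_le le_sup_left) u + hm 1 (compat_of_le le_sup_right) v := by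
  let f : hl 1 (La s) × hl 1 (La t) →+ hl 1 (La s ⊔ La t) :=
    (hm 1 (compat_of_le le_sup_left)).coprod (hm 1 (compat_of_le le_sup_right))
  have cs : Nat.card (hl 1 (La s)) = 2 := La_card k.s_pow k.s_s 0
  have ct : Nat.card (hl 1 (La t)) = 2 := La_card k.t_pow k.t_t 0
  have c : Nat.card (hl 1 (La s ⊔ La t)) = 4 := (k.card_odd_even 0).1
  have : Finite (hl 1 (La s ⊔ La t)) := Nat.finite_of_card_ne_zero (by rw [c]; decide)
  have inj : Function.Injective f := by
    rw [injective_iff_map_eq_zero]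
    rintro ⟨u, v⟩ huv
    have e := congrArg (hm 1 (compat_of_le (Klein.le_Ia s t))) huv
    change hm 1 _ (hm 1 _ u + hm 1 _ v) = _ at e
    rw [map_add, map_zero, hm_Ia _ _ (La_le_Ia s) (Klein.le_Ia s t) (map_one _),
      hm_Ia _ _ (La_le_Ia t) (Klein.le_Ia s t) (map_one _)] at e
    have hu := La_detect_pair k.s_pow k.s_s k.s_t 0 u v e
    have hv := La_detect_pair k.t_pow k.t_t k.t_s 0 v u ((add_comm _ _).trans e)
    exact Prod.ext hu hv
  obtain ⟨⟨u, v⟩, rfl⟩ := (inj.bijective_of_nat_card_le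
    (by rw [c, Nat.card_prod, cs, ct])).2 x
  exact ⟨u, v, rfl⟩

theorem Klein.Ia_injective_one (k : Klein s t χs χt) :
    Function.Injective (hm 1 (compat_of_le (Klein.le_Ia s t))) := by
  rw [injective_iff_map_eq_zero]
  intro x e
  obtain ⟨u, v, rfl⟩ := k.exists_add x
  rw [map_add, hm_Ia _ _ (La_le_Ia s) (Klein.le_Ia s t) (map_one _),
    hm_Ia _ _ (La_le_Ia t) (Klein.le_Ia s t) (map_one _)] at e
  have hu := La_detect_pair k.s_pow k.s_s k.s_t 0 u v e
  have hv := La_detect_pair k.t_pow k.t_t k.t_s 0 v u ((add_comm _ _).trans e)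
  rw [hu, hv, map_zero, map_zero, add_zero]

end GHom

namespace Bianchi

open GHom

variable {G : Type} [Group G] {S r b U V : G}

section

variable {χS χr : G →* Multiplicative (ZMod 2)} {χb : G →* Multiplicative (ZMod 3)}

theorem d1_one_eq_zero (h : IsPresentation S r b U V) (t : Detect S r b U χS χr χb)
    (x : hh G 1 (C1 S r b)) (hx : (hC0 S r b U 1 (hmap 1 (d1 h) x)).1 = 0) :
    hmap 1 (d1 h) x = 0 := by
  refine (hC0 S r b U 1).injective ?_
  rw [map_zero]
  refine Prod.ext hx ?_
  rw [hC0_d1_succ h t 0]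
  refine Prod.ext (t.two.Ia_injective_one ?_) rfl
  change hm 1 _ (hm 1 _ _ + hm 1 _ _ + hm 1 _ _) = hm 1 _ 0
  rw [map_zero, map_add, map_add, hm_Ia _ _ (La_le_Ia _) (Klein.le_Ia S _) (map_one _),
    hm_Ia _ _ (La_le_Ia _) (Klein.le_Ia S _) (aug_single _ _ _),
    hm_Ia _ _ (La_le_Ia _) (Klein.le_Ia S _) (aug_single _ _ _)]
  exact sum_Ia h t 0 x hx

theorem card_ker_d1_one (h : IsPresentation S r b U V) (t : Detect S r b U χS χr χb) :
    Nat.card (hmap 1 (d1 h)).ker = 6 := by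
  let f : hh G 1 (C1 S r b) →+ hl 1 (La S ⊔ La r) :=
    ((AddMonoidHom.fst _ _).comp (hC0 S r b U 1).toAddMonoidHom).comp (hmap 1 (d1 h))
  have hk : (hmap 1 (d1 h)).ker = f.ker := by
    ext x
    refine ⟨fun hx => ?_, fun hx => d1_one_eq_zero h t x hx⟩
    change (hC0 S r b U 1 (hmap 1 (d1 h) x)).1 = 0
    rw [show hmap 1 (d1 h) x = 0 from hx, map_zero]
    rfl
  have hs : f.range = ⊤ := by
    rw [AddMonoidHom.range_eq_top]
    intro x
    obtain ⟨u, v, rfl⟩ := t.one.exists_add x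
    refine ⟨(hC1 S r b 1).symm (-u, -v, 0, 0, 0), ?_⟩
    change (hC0 S r b U 1 (hmap 1 (d1 h) _)).1 = _
    rw [hC0_d1_succ h t 0, AddEquiv.apply_symm_apply]
    change -(hm 1 _ (-u)) - hm 1 _ (-v) - hm 1 _ 0 = _
    rw [map_neg, map_neg, map_zero, neg_neg, sub_neg_eq_add, sub_zero]
  have c := card_ker_mul_card_range f
  have c1 : Nat.card (hh G 1 (C1 S r b)) = 24 := card_hC1_odd t 0
  have c2 : Nat.card (hl 1 (La S ⊔ La r)) = 4 := (t.one.card_odd_even 0).1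
  rw [hs, ← hk, c1, AddSubgroup.card_top, c2] at c
  omega

theorem hC1_d2 (q : ℕ) (x : hh G q (C2 G)) :
    hC1 S r b q (hmap q (d2 S r b U V) x) =
      (-(hm q (compat_bot (z := (gr (S * b) - 1) * gr U)) (hprod _ _ q x).1) +
          hm q (compat_bot (z := 1)) (hprod _ _ q x).2,
        hm q (compat_bot (z := gr (S * b) - 1)) (hprod _ _ q x).1,
        -(hm q (compat_bot (z := gr V)) (hprod _ _ q x).2),
        -(hm q (compat_bot (z := 1)) (hprod _ _ q x).2),
        hm q (compat_bot (z := (1 - gr U) * gr S * (1 - gr b))) (hprod _ _ q x).1 +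
          hm q (compat_bot (z := gr V - 1)) (hprod _ _ q x).2) := by
  rw [hC1_apply, hprod_apply]
  simp only [hmap_hmap]
  simp only [← AddMonoidHom.neg_apply, ← AddMonoidHom.add_apply, ← AddMonoidHom.sub_apply,
    ← hmap_add, ← hmap_sub, ← hmap_neg]
  rfl

theorem exists_injective_aug : ∃ f : hl 0 (⊥ : Submodule (MonoidAlgebra ℤ G) (MonoidAlgebra ℤ G)) →+ ℤ,
    f (hu ⊥) = 1 ∧ Function.Injective f := by
  obtain ⟨f, hf⟩ := exists_aug_lift (L := (⊥ : Submodule (MonoidAlgebra ℤ G) (MonoidAlgebra ℤ G))) ℤ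
    (AddMonoidHom.id ℤ) (fun y hy => by rw [(Submodule.mem_bot _).1 hy, map_zero, map_zero])
  refine ⟨f, hf, (injective_iff_map_eq_zero f).2 fun x hx => ?_⟩
  obtain ⟨k, rfl⟩ := hl_zero_eq x
  rw [map_zsmul, hf, AddMonoidHom.id_apply, smul_eq_mul, mul_one] at hx
  rw [hx, zero_smul]

theorem hm_zero_eq_zero {L : Submodule (MonoidAlgebra ℤ G) (MonoidAlgebra ℤ G)}
    {z : MonoidAlgebra ℤ G} (hz : aug G z = 0) {L' : Submodule (MonoidAlgebra ℤ G) (MonoidAlgebra ℤ G)}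
    (c : Compat L z L') (x : hl 0 L) : hm 0 c x = 0 := by
  obtain ⟨k, rfl⟩ := hl_zero_eq x
  rw [map_zsmul, hm_hu, hz, zero_smul, smul_zero]

theorem d2_zero_eq_zero_iff (x : hh G 0 (C2 G)) :
    hmap 0 (d2 S r b U V) x = 0 ↔ (hprod _ _ 0 x).2 = 0 := by
  have e1 : aug G ((gr (S * b) - 1) * gr U) = 0 := by
    rw [map_mul, map_sub, aug_single, map_one, sub_self, zero_mul]
  have e2 : aug G (gr (S * b) - 1) = 0 := by
    rw [map_sub, aug_single, map_one, sub_self]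
  have e3 : aug G ((1 - gr U) * gr S * (1 - gr b)) = 0 := by
    rw [map_mul, map_sub, aug_single, map_one, sub_self, mul_zero]
  rw [← (hC1 S r b 0).map_eq_zero_iff, hC1_d2, hm_zero_eq_zero e1, hm_zero_eq_zero e2,
    hm_zero_eq_zero e3]
  constructor
  · intro hx
    have h1 := congrArg Prod.fst hx
    change -0 + hm 0 _ _ = 0 at h1
    obtain ⟨k, hk⟩ := hl_zero_eq (hprod _ _ 0 x).2
    rw [hk, neg_zero, zero_add, map_zsmul, hm_hu, map_one, one_smul,
      zsmul_hu_eq_zero fun y hy => (mem_Ia_iff y).1 (La_le_Ia S hy)] at h1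
    rw [hk, h1, zero_smul]
  · intro hx
    rw [hx]
    simp only [map_zero, neg_zero, add_zero]
    rfl

end

end Bianchi

namespace GHom

variable {G : Type} [Group G] {M N : Type} [AddCommGroup M] [Module (MonoidAlgebra ℤ G) M]
  [AddCommGroup N] [Module (MonoidAlgebra ℤ G) N]

/-- The chain map induced by a map of coefficients. -/
noncomputable abbrev cmap (q : ℕ) (f : M →ₗ[MonoidAlgebra ℤ G] N) :
    ((Fin q → G) →₀ M) →+ ((Fin q → G) →₀ N) :=
  Finsupp.mapRange.addMonoidHom f.toAddMonoidHom

theorem cmap_single (q : ℕ) (f : M →ₗ[MonoidAlgebra ℤ G] N) (g : Fin q → G) (m : M) :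
    cmap q f (Finsupp.single g m) = Finsupp.single g (f m) :=
  Finsupp.mapRange_single (hf := map_zero f)

theorem hmap_hmk_eq (q : ℕ) (f : M →ₗ[MonoidAlgebra ℤ G] N) (c : hcyc G M q) :
    hmap q f (hmk G M q c) = hmk G N q ⟨cmap q f c, mapRange_mem_hcyc q f c⟩ :=
  hmap_hmk q f _ _ fun _ => rfl

theorem dd_one_single (a b : G) (m : M) : dd G M 1 (Finsupp.single ![a, b] m) =
    Finsupp.single ![b] (gr a⁻¹ • m) - Finsupp.single ![a * b] m + Finsupp.single ![a] m := by
  have e1 : (fun i : Fin 1 => ![a, b] i.succ) = ![b] := by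
    funext i; fin_cases i; rfl
  have e2 : Fin.contractNth (0 : Fin 2) (· * ·) ![a, b] = ![a * b] := by
    funext i; fin_cases i; rfl
  have e3 : Fin.contractNth (1 : Fin 2) (· * ·) ![a, b] = ![a] := by
    funext i; fin_cases i; rfl
  rw [dd_single, Fin.sum_univ_two, e1, e2, e3]
  simp [sub_eq_add_neg, add_assoc]

theorem dd_single_eq_zero (a : G) (m : M) (h : gr a⁻¹ • m = m) :
    dd G M 0 (Finsupp.single ![a] m) = 0 := by
  rw [dd_zero_single]
  change Finsupp.single default (gr a⁻¹ • m - m) = 0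
  rw [h, sub_self, Finsupp.single_zero]

theorem dd_square (a : G) (m : M) (ha : a * a = 1) (h : gr a⁻¹ • m = m) :
    dd G M 1 (Finsupp.single ![a, a] m + Finsupp.single ![1, 1] m) =
      2 • Finsupp.single ![a] m := by
  rw [map_add, dd_one_single, dd_one_single, h, ha, inv_one, gr_one, one_smul, one_mul, two_smul]
  abel

/-- Evaluation of the cup product of two characters on a chain. -/
noncomputable def cup (φ : M →+ ZMod 2) (χ ψ : G →* Multiplicative (ZMod 2)) :
    ((Fin 2 → G) →₀ M) →+ ZMod 2 :=
  Finsupp.liftAddHom fun g =>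
    (AddMonoidHom.mulRight ((χ (g 0)).toAdd * (ψ (g 1)).toAdd)).comp φ

theorem cup_single (φ : M →+ ZMod 2) (χ ψ : G →* Multiplicative (ZMod 2)) (g : Fin 2 → G) (m : M) :
    cup φ χ ψ (Finsupp.single g m) = φ m * ((χ (g 0)).toAdd * (ψ (g 1)).toAdd) := by
  simp [cup]

theorem cup_dd (φ : M →+ ZMod 2) (hφ : ∀ (g : G) m, φ (gr g • m) = φ m)
    (χ ψ : G →* Multiplicative (ZMod 2)) (y : (Fin 3 → G) →₀ M) :
    cup φ χ ψ (dd G M 2 y) = 0 := by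
  suffices (cup φ χ ψ).comp (dd G M 2) = 0 from DFunLike.congr_fun this y
  refine Finsupp.addHom_ext fun g m => ?_
  rw [AddMonoidHom.comp_apply, dd_single, Fin.sum_univ_three]
  simp only [map_add, map_zsmul, cup_single]
  rw [show φ (MonoidAlgebra.single (g 0)⁻¹ (1 : ℤ) • m) = φ m from hφ _ _]
  rw [show Fin.contractNth (0 : Fin 3) (· * ·) g 0 = g 0 * g 1 from rfl,
    show Fin.contractNth (0 : Fin 3) (· * ·) g 1 = g 2 from rfl,
    show Fin.contractNth (1 : Fin 3) (· * ·) g 0 = g 0 from rfl,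
    show Fin.contractNth (1 : Fin 3) (· * ·) g 1 = g 1 * g 2 from rfl,
    show Fin.contractNth (2 : Fin 3) (· * ·) g 0 = g 0 from rfl,
    show Fin.contractNth (2 : Fin 3) (· * ·) g 1 = g 1 from rfl,
    show (Fin.succ 0 : Fin 3) = 1 from rfl, show (Fin.succ 1 : Fin 3) = 2 from rfl]
  simp only [map_mul, toAdd_mul, Fin.val_zero, Fin.val_one, Fin.val_two]
  simp
  have two : (2 : ZMod 2) = 0 := rfl
  ring_nf
  simp only [two, mul_zero, add_zero]

end GHom

namespace Bianchi

open GHom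

variable {G : Type} [Group G] {S r b U V : G}

section

variable {χS χr : G →* Multiplicative (ZMod 2)} {χb : G →* Multiplicative (ZMod 3)}

theorem gr_inv_smul_mk {a : G} (ha : a * a = 1)
    {L : Submodule (MonoidAlgebra ℤ G) (MonoidAlgebra ℤ G)} (hL : 1 - gr a ∈ L) :
    gr a⁻¹ • (Submodule.Quotient.mk 1 : MonoidAlgebra ℤ G ⧸ L) = Submodule.Quotient.mk 1 := by
  rw [inv_eq_of_mul_eq_one_left ha, ← Submodule.Quotient.mk_smul, smul_eq_mul, mul_one, eq_comm,
    Submodule.Quotient.eq]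
  exact hL

theorem eps_two_injective (h : IsPresentation S r b U V) (t : Detect S r b U χS χr χb) :
    Function.Injective (hmap 2 (eps S r b U)) := by
  rw [injective_iff_map_eq_zero]
  intro x hx
  have : x ∈ (hmap 2 (eps S r b U)).ker := hx
  rw [ker_eps h 0] at this
  obtain ⟨y, rfl⟩ := this
  rw [(hC1_even t 0).elim y 0, map_zero]

/-- The sum of the three bar classes of the edges of order two. -/
noncomputable def edgeCycle (S r b : G) : (Fin 1 → G) →₀ C1 S r b :=
  Finsupp.single ![S] (Submodule.Quotient.mk 1, 0) +
    Finsupp.single ![r] (0, Submodule.Quotient.mk 1, 0) +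
    Finsupp.single ![r * S] (0, 0, Submodule.Quotient.mk 1, 0)

/-- A chain bounding twice the edge cycle. -/
noncomputable def edgeChain (S r b : G) : (Fin 2 → G) →₀ C1 S r b :=
  (Finsupp.single ![S, S] (Submodule.Quotient.mk 1, 0) +
      Finsupp.single ![1, 1] (Submodule.Quotient.mk 1, 0)) +
    (Finsupp.single ![r, r] (0, Submodule.Quotient.mk 1, 0) +
      Finsupp.single ![1, 1] (0, Submodule.Quotient.mk 1, 0)) +
    (Finsupp.single ![r * S, r * S] (0, 0, Submodule.Quotient.mk 1, 0) +
      Finsupp.single ![1, 1] (0, 0, Submodule.Quotient.mk 1, 0))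

variable (S r b) in
theorem smul_edge (hS : S * S = 1) (hr : r * r = 1) (hW : r * S * (r * S) = 1) :
    gr S⁻¹ • ((Submodule.Quotient.mk 1, 0) : C1 S r b) = (Submodule.Quotient.mk 1, 0) ∧
    gr r⁻¹ • ((0, Submodule.Quotient.mk 1, 0) : C1 S r b) = (0, Submodule.Quotient.mk 1, 0) ∧
    gr (r * S)⁻¹ • ((0, 0, Submodule.Quotient.mk 1, 0) : C1 S r b) =
      (0, 0, Submodule.Quotient.mk 1, 0) := by
  refine ⟨?_, ?_, ?_⟩ <;> simp only [Prod.smul_mk, smul_zero]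
  · rw [gr_inv_smul_mk hS (mem_La S)]
  · rw [gr_inv_smul_mk hr (mem_La r)]
  · rw [gr_inv_smul_mk hW (mem_La (r * S))]

theorem edgeCycle_mem (hS : S * S = 1) (hr : r * r = 1) (hW : r * S * (r * S) = 1) :
    edgeCycle S r b ∈ hcyc G (C1 S r b) 1 := by
  obtain ⟨h1, h2, h3⟩ := smul_edge S r b hS hr hW
  rw [mem_hcyc_succ, edgeCycle, map_add, map_add, dd_single_eq_zero _ _ h1,
    dd_single_eq_zero _ _ h2, dd_single_eq_zero _ _ h3, add_zero, add_zero]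

theorem dd_edgeChain (hS : S * S = 1) (hr : r * r = 1) (hW : r * S * (r * S) = 1) :
    dd G (C1 S r b) 1 (edgeChain S r b) = 2 • edgeCycle S r b := by
  obtain ⟨h1, h2, h3⟩ := smul_edge S r b hS hr hW
  rw [edgeCycle, edgeChain, map_add, map_add, dd_square _ _ hS h1, dd_square _ _ hr h2,
    dd_square _ _ hW h3, smul_add, smul_add]

theorem fst_d1_edge (h : IsPresentation S r b U V) :
    (LinearMap.fst _ _ _ ∘ₗ d1 h) (Submodule.Quotient.mk 1, 0) = -Submodule.Quotient.mk 1 ∧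
    (LinearMap.fst _ _ _ ∘ₗ d1 h) (0, Submodule.Quotient.mk 1, 0) = -Submodule.Quotient.mk 1 ∧
    (LinearMap.fst _ _ _ ∘ₗ d1 h) (0, 0, Submodule.Quotient.mk 1, 0) =
      -Submodule.Quotient.mk 1 := by
  refine ⟨?_, ?_, ?_⟩ <;>
    simp [d1_apply, qm_mk, LinearMap.comp_apply]

theorem hC0_fst (q : ℕ) (x : hh G q (C0 S r b U)) :
    (hC0 S r b U q x).1 = hmap q (LinearMap.fst _ _ _) x := rfl

theorem d1_edgeCycle (h : IsPresentation S r b U V) (t : Detect S r b U χS χr χb)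
    (hc : edgeCycle S r b ∈ hcyc G (C1 S r b) 1) :
    hmap 1 (d1 h) (hmk G (C1 S r b) 1 ⟨edgeCycle S r b, hc⟩) = 0 := by
  refine d1_one_eq_zero h t _ ?_
  rw [hC0_fst]
  obtain ⟨h1, h2, h3⟩ := fst_d1_edge h
  rw [hmap_hmap, hmap_hmk_eq, hmk_eq_zero]
  refine ⟨Finsupp.single ![r, S] (-Submodule.Quotient.mk 1) +
    (Finsupp.single ![r * S, r * S] (-Submodule.Quotient.mk 1) +
      Finsupp.single ![1, 1] (-Submodule.Quotient.mk 1)), ?_⟩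
  rw [map_add, dd_square, dd_one_single, smul_neg, gr_inv_smul_mk t.one.t_sq
    (Submodule.mem_sup_right (mem_La r))]
  · change _ = cmap 1 _ (edgeCycle S r b)
    rw [edgeCycle, map_add, map_add, cmap_single, cmap_single, cmap_single, h1, h2, h3, two_smul]
    abel
  · rw [← pow_two, mul_S_pow t]
  · rw [smul_neg, gr_inv_smul_mk (by rw [← pow_two, mul_S_pow t]) (mul_mem_sup S r)]

theorem exists_order_four (h : IsPresentation S r b U V) (t : Detect S r b U χS χr χb) :
    ∃ w : hl 2 (Ia G), 4 • w = 0 ∧ 2 • w ≠ 0 := by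
  have hW : r * S * (r * S) = 1 := by rw [← pow_two, mul_S_pow t]
  have hc := edgeCycle_mem (b := b) t.one.s_sq t.one.t_sq hW
  have h0 := d1_edgeCycle h t hc
  rw [hmap_hmk_eq, hmk_eq_zero] at h0
  obtain ⟨e, he⟩ := h0
  change dd G (C0 S r b U) 1 e = cmap 1 (d1 h) (edgeCycle S r b) at he
  have hw : cmap 2 (eps S r b U) e ∈ hcyc G (MonoidAlgebra ℤ G ⧸ Ia G) 2 := by
    rw [mem_hcyc_succ, dd_mapRange, he]
    refine Finsupp.ext fun g => ?_
    exact eps_d1 h _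
  have hz : 2 • e - cmap 2 (d1 h) (edgeChain S r b) ∈ hcyc G (C0 S r b U) 2 := by
    rw [mem_hcyc_succ, map_sub, map_nsmul, he, dd_mapRange,
      dd_edgeChain t.one.s_sq t.one.t_sq hW, map_nsmul, sub_self]
  have e2 : 2 • hmk G (MonoidAlgebra ℤ G ⧸ Ia G) 2 ⟨_, hw⟩ =
      hmap 2 (eps S r b U) (hmk G (C0 S r b U) 2 ⟨_, hz⟩) := by
    rw [hmap_hmk_eq, ← map_nsmul]
    refine congrArg (hmk G _ 2) (Subtype.ext ?_)
    change 2 • cmap 2 (eps S r b U) e = cmap 2 (eps S r b U) (2 • e - cmap 2 (d1 h) (edgeChain S r b))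
    rw [map_sub, map_nsmul, eq_comm, sub_eq_self]
    exact Finsupp.ext fun g => eps_d1 h _
  refine ⟨hmk G _ 2 ⟨_, hw⟩, ?_, ?_⟩
  · rw [show 4 = 2 * 2 by rfl, mul_smul, e2, ← map_nsmul]
    rw [show 2 • hmk G (C0 S r b U) 2 ⟨_, hz⟩ = 0 from two_nsmul_hC0_even t 0 _, map_zero]
  · rw [e2]
    intro h0
    have h1 := (injective_iff_map_eq_zero _).1 (eps_two_injective h t) _ h0
    rw [hmk_eq_zero] at h1
    obtain ⟨y, hy⟩ := h1
    obtain ⟨f, hf⟩ := exists_aug_lift (L := La S ⊔ La r) (ZMod 2) (Int.castAddHom _)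
      (fun y hy => by rw [(mem_Ia_iff y).1 (Klein.le_Ia S r hy), map_zero])
    let φ : C0 S r b U →+ ZMod 2 := (f.comp (h0mk G _)).comp (AddMonoidHom.fst _ _)
    have hφ : ∀ (g : G) m, φ (gr g • m) = φ m := fun g m => congrArg f (h0mk_smul g m.1)
    have hd : ∀ m : C1 S r b, (LinearMap.fst _ _ _ ∘ₗ d1 h) m = -Submodule.Quotient.mk 1 →
        φ (d1 h m) = 1 := by
      intro m hm
      change f (h0mk G _ ((LinearMap.fst _ _ _ ∘ₗ d1 h) m)) = 1
      rw [hm, map_neg, map_neg]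
      change -f (hu _) = 1
      rw [hf]
      decide
    obtain ⟨h1, h2, h3⟩ := fst_d1_edge h
    have := cup_dd φ hφ χS χr y
    rw [hy] at this
    change cup φ χS χr (2 • e - cmap 2 (d1 h) (edgeChain S r b)) = 0 at this
    rw [map_sub, map_nsmul, edgeChain] at this
    simp only [map_add, cmap_single, cup_single, hd _ h1, hd _ h2, hd _ h3] at this
    simp [t.one.s_s, t.one.s_t, t.one.t_s, t.one.t_t] at this
    rw [show (2 : ZMod 2) = 0 from rfl, zero_mul] at this
    exact absurd this (by decide)

end

end Bianchi

namespace Bianchi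

open GHom

variable {G : Type} [Group G] {S r b U V : G}

section

variable {χS χr : G →* Multiplicative (ZMod 2)} {χb : G →* Multiplicative (ZMod 3)}

/-- The composite connecting map to the coinvariants of the faces. -/
noncomputable def bottom (h : IsPresentation S r b U V) : hl 2 (Ia G) →+ hh G 0 (C2 G) :=
  ((ses_left h).δ 0).comp ((ses_right S r b U).δ 1)

theorem card_ker_bottom (h : IsPresentation S r b U V) (t : Detect S r b U χS χr χb) :
    Nat.card (bottom h).ker = 24 := by
  let f : (bottom h).ker →+ hh G 1 (LinearMap.ker (eps S r b U)) :=
    ((ses_right S r b U).δ 1).comp (bottom h).ker.subtype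
  have hle : ((ses_right S r b U).δ 1).ker ≤ (bottom h).ker := fun x hx => by
    change (ses_left h).δ 0 ((ses_right S r b U).δ 1 x) = 0
    rw [show (ses_right S r b U).δ 1 x = 0 from hx, map_zero]
  have c1 : Nat.card f.ker = 4 := by
    have e1 : Nat.card f.ker = Nat.card ((ses_right S r b U).δ 1).ker :=
      Nat.card_congr (AddSubgroup.addSubgroupOfEquivOfLe hle).toEquiv
    rw [e1, ker_δ, ← Nat.card_congr (AddMonoidHom.ofInjective (eps_two_injective h t)).toEquiv]
    exact card_hC0_even t 0
  have c2 : Nat.card f.range = 6 := by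
    have e : f.range = (hmap 1 (d1 h)).ker.map (hmap 1 (d1' h)) := by
      ext y
      constructor
      · rintro ⟨⟨x, hx⟩, rfl⟩
        obtain ⟨z, hz⟩ := ((ses_left h).exact₃ 0 ((ses_right S r b U).δ 1 x)).1 hx
        refine ⟨z, ?_, hz⟩
        change hmap 1 (d1 h) z = 0
        rw [← subtype_d1', hz]
        exact ((ses_right S r b U).exact₁ 1).apply_apply_eq_zero x
      · rintro ⟨z, hz, rfl⟩
        have hz' : hmap 1 (d1 h) z = 0 := hz
        rw [← subtype_d1'] at hz'
        obtain ⟨x, hx⟩ := ((ses_right S r b U).exact₁ 1 _).1 hz'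
        refine ⟨⟨x, ?_⟩, hx⟩
        change (ses_left h).δ 0 ((ses_right S r b U).δ 1 x) = 0
        rw [hx]
        exact ((ses_left h).exact₃ 0).apply_apply_eq_zero z
    rw [e, ← Nat.card_congr ((hmap 1 (d1 h)).ker.equivMapOfInjective _ (d1'_injective h 0)).toEquiv]
    exact card_ker_d1_one h t
  have := card_ker_mul_card_range f
  rw [c1, c2] at this
  exact this.symm

theorem exists_bottom_int (h : IsPresentation S r b U V) (t : Detect S r b U χS χr χb) :
    ∃ p : hl 2 (Ia G) →+ ℤ, p.ker = (bottom h).ker ∧ ∃ w, p w ≠ 0 := by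
  obtain ⟨f, hf, hi⟩ := exists_injective_aug (G := G)
  let p : hl 2 (Ia G) →+ ℤ :=
    (f.comp ((AddMonoidHom.fst _ _).comp (hprod _ _ 0).toAddMonoidHom)).comp (bottom h)
  refine ⟨p, ?_, ?_⟩
  · ext x
    have h2 : (hprod _ _ 0 (bottom h x)).2 = 0 := by
      rw [← d2_zero_eq_zero_iff (S := S) (r := r) (b := b) (U := U) (V := V)]
      exact ((ses_left h).exact₁ 0).apply_apply_eq_zero _
    constructor
    · intro hx
      have h1 : (hprod _ _ 0 (bottom h x)).1 = 0 := hi (by rw [map_zero]; exact hx)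
      exact (hprod _ _ 0).injective (by rw [map_zero]; exact Prod.ext h1 h2)
    · intro hx
      change f (hprod _ _ 0 (bottom h x)).1 = 0
      rw [show bottom h x = 0 from hx, map_zero]
      exact map_zero f
  · have hy : hmap 0 (d2 S r b U V) ((hprod _ _ 0).symm (hu ⊥, 0)) = 0 := by
      rw [d2_zero_eq_zero_iff, AddEquiv.apply_symm_apply]
    obtain ⟨β, hβ⟩ := ((ses_left h).exact₁ 0 _).1 hy
    have h6 : hmap 1 (LinearMap.ker (eps S r b U)).subtype (6 • β) = 0 := by
      rw [map_nsmul]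
      exact six_nsmul_hC0 t 0 _
    obtain ⟨w, hw⟩ := ((ses_right S r b U).exact₁ 1 _).1 h6
    refine ⟨w, ?_⟩
    have e : bottom h w = 6 • (hprod _ _ 0).symm (hu ⊥, 0) := by
      change (ses_left h).δ 0 ((ses_right S r b U).δ 1 w) = _
      rw [hw, map_nsmul, hβ]
    change f (hprod _ _ 0 (bottom h w)).1 ≠ 0
    rw [e, map_nsmul, AddEquiv.apply_symm_apply, Prod.smul_fst, map_nsmul, hf]
    decide

end

theorem homology_two (h : IsPresentation S r b U V) :
    Nonempty (hl 2 (Ia G) ≃+ ℤ × ZMod 4 × ZMod 3 × ZMod 2) := by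
  obtain ⟨χS, χr, χb, t⟩ := h.exists_detect
  obtain ⟨p, hp, v, hv⟩ := exists_bottom_int h t
  obtain ⟨e⟩ := nonempty_addEquiv_int_prod_ker p v hv
  obtain ⟨w, h4, h2⟩ := exists_order_four h t
  have hc : Nat.card p.ker = 24 := by rw [hp, card_ker_bottom h t]
  have tors : ∀ (n : ℕ) (x : hl 2 (Ia G)), n ≠ 0 → n • x = 0 → x ∈ p.ker := fun n x hn hx => by
    have := congrArg p hx
    rw [map_nsmul, map_zero, nsmul_eq_mul] at this
    exact (mul_eq_zero.1 this).resolve_left (by exact_mod_cast hn)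
  obtain ⟨y, hy0, hyw⟩ : ∃ y, hmap 2 (eps S r b U) y ≠ 0 ∧ hmap 2 (eps S r b U) y ≠ 2 • w := by
    by_contra! hcon
    have c : Nat.card (hh G 2 (C0 S r b U)) = 4 := card_hC0_even t 0
    have := Nat.card_le_card_of_injective
      (fun y => (⟨hmap 2 (eps S r b U) y, by
        by_cases h0 : hmap 2 (eps S r b U) y = 0
        · exact Or.inl h0
        · exact Or.inr (hcon y h0)⟩ : ({0, 2 • w} : Set (hl 2 (Ia G)))))
      fun a a' haa => eps_two_injective h t (congrArg Subtype.val haa)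
    have h2 := Set.ncard_insert_le (0 : hl 2 (Ia G)) {2 • w}
    rw [Set.ncard_singleton] at h2
    rw [c] at this
    exact absurd (this.trans h2) (by decide)
  have hy2 : 2 • hmap 2 (eps S r b U) y = 0 := by
    rw [← map_nsmul]
    rw [show 2 • y = 0 from two_nsmul_hC0_even t 0 y, map_zero]
  obtain ⟨e'⟩ := nonempty_addEquiv_of_card_eq_24 hc ⟨w, tors 4 w (by decide) h4⟩
    ⟨_, tors 2 _ (by decide) hy2⟩ (Subtype.ext h4) (fun e0 => h2 (congrArg Subtype.val e0))
    (Subtype.ext hy2) (fun e0 => hy0 (congrArg Subtype.val e0))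
    (fun e0 => hyw (congrArg Subtype.val e0))
  exact ⟨e.trans ((AddEquiv.refl ℤ).prodCongr e'.symm)⟩

end Bianchi

namespace GHom

variable {G : Type} [Group G]

theorem mem_hcyc_one (c : (Fin 1 → G) →₀ ℤ) : c ∈ hcyc G ℤ 1 := by
  rw [mem_hcyc_succ]
  suffices dd G ℤ 0 = 0 from DFunLike.congr_fun this c
  refine Finsupp.addHom_ext fun g n => ?_
  rw [dd_zero_single, triv_single_smul, sub_self, Finsupp.single_zero]
  rfl

variable (G) in
/-- The class of a group element in the first homology. -/
noncomputable def cls : G →* Multiplicative (hh G 1 ℤ) :=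
  MonoidHom.mk' (fun g => Multiplicative.ofAdd (hmk G ℤ 1 ⟨Finsupp.single ![g] 1, mem_hcyc_one _⟩))
    fun a b => by
      rw [← ofAdd_add, ← map_add]
      refine congrArg Multiplicative.ofAdd (sub_eq_zero.1 ?_)
      rw [← map_sub, hmk_eq_zero]
      refine ⟨-Finsupp.single ![a, b] 1, ?_⟩
      rw [map_neg, dd_one_single]
      change -(Finsupp.single ![b] (MonoidAlgebra.single a⁻¹ (1 : ℤ) • (1 : ℤ)) - _ + _) =
        Finsupp.single ![a * b] (1 : ℤ) - (Finsupp.single ![a] 1 + Finsupp.single ![b] 1)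
      rw [triv_single_smul]
      abel

theorem cls_surjective : Function.Surjective (cls G) := by
  intro x
  obtain ⟨⟨c, hc⟩, hx⟩ := hmk_surjective 1 x.toAdd
  suffices ∃ g, cls G g = Multiplicative.ofAdd (hmk G ℤ 1 ⟨c, mem_hcyc_one c⟩) by
    obtain ⟨g, hg⟩ := this
    exact ⟨g, hg.trans (congrArg Multiplicative.ofAdd hx)⟩
  clear hx
  induction c using Finsupp.induction_linear with
  | zero => exact ⟨1, (map_one _).trans (congrArg Multiplicative.ofAdd (map_zero (hmk G ℤ 1)).symm)⟩
  | add f g hf hg =>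
    obtain ⟨a, ha⟩ := hf (mem_hcyc_one _)
    obtain ⟨b, hb⟩ := hg (mem_hcyc_one _)
    refine ⟨a * b, ?_⟩
    rw [map_mul, ha, hb, ← ofAdd_add, ← map_add]
    rfl
  | single g n =>
    refine ⟨g 0 ^ n, ?_⟩
    rw [map_zpow]
    refine congrArg Multiplicative.ofAdd ((map_zsmul (hmk G ℤ 1) n _).symm.trans
      (congrArg (hmk G ℤ 1) (Subtype.ext ?_)))
    change n • Finsupp.single ![g 0] (1 : ℤ) = Finsupp.single g n
    rw [Finsupp.smul_single, smul_eq_mul, mul_one]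
    congr 1
    funext i
    fin_cases i
    rfl

theorem exists_hom_of_character {T : Type} [AddCommGroup T] (χ : G →* Multiplicative T) :
    ∃ φ : hh G 1 ℤ →+ T, ∀ g, φ (cls G g).toAdd = (χ g).toAdd := by
  let Φ : ((Fin 1 → G) →₀ ℤ) →+ T :=
    Finsupp.liftAddHom fun g => zmultiplesHom T (χ (g 0)).toAdd
  have hΦ : ∀ g n, Φ (Finsupp.single g n) = n • (χ (g 0)).toAdd := fun g n => by
    simp [Φ]
  have hd : ∀ y, Φ (dd G ℤ 1 y) = 0 := fun y => by
    suffices Φ.comp (dd G ℤ 1) = 0 from DFunLike.congr_fun this y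
    refine Finsupp.addHom_ext fun g n => ?_
    have hg : g = ![g 0, g 1] := by
      funext i; fin_cases i <;> rfl
    rw [AddMonoidHom.comp_apply, hg, dd_one_single, map_add, map_sub, hΦ, hΦ, hΦ]
    rw [show gr (g 0)⁻¹ • n = n from triv_single_smul G _ _]
    change n • (χ (g 1)).toAdd - n • (χ (g 0 * g 1)).toAdd + n • (χ (g 0)).toAdd = 0
    rw [map_mul, toAdd_mul, smul_add]
    abel
  have hk : (hmk G ℤ 1).ker ≤ (Φ.comp (hcyc G ℤ 1).subtype).ker := fun c hc => by
    obtain ⟨y, hy⟩ := (hmk_eq_zero 1 c).1 hc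
    change Φ c = 0
    rw [← hy, hd]
  let e := QuotientAddGroup.quotientKerEquivOfSurjective (hmk G ℤ 1) (hmk_surjective 1)
  refine ⟨(QuotientAddGroup.lift _ _ hk).comp e.symm.toAddMonoidHom, fun g => ?_⟩
  have : e.symm (cls G g).toAdd =
      QuotientAddGroup.mk (⟨Finsupp.single ![g] 1, mem_hcyc_one _⟩ : hcyc G ℤ 1) := by
    rw [AddEquiv.symm_apply_eq]
    rfl
  change QuotientAddGroup.lift _ _ hk (e.symm (cls G g).toAdd) = _
  rw [this]
  change Φ (Finsupp.single ![g] 1) = _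
  rw [hΦ, one_smul]
  rfl

/-- The augmentation quotient is the trivial module. -/
theorem hl_Ia_equiv (q : ℕ) : Nonempty (hl q (Ia G) ≃+ hh G q ℤ) := by
  let f : (MonoidAlgebra ℤ G ⧸ Ia G) →ₗ[MonoidAlgebra ℤ G] ℤ :=
    (Ia G).liftQ (LinearMap.toSpanSingleton (MonoidAlgebra ℤ G) ℤ 1) fun x hx => by
      rw [LinearMap.mem_ker, LinearMap.toSpanSingleton_apply, triv_smul, (mem_Ia_iff x).1 hx,
        zero_mul]
  have hf : ∀ x, f (Submodule.Quotient.mk x) = aug G x := fun x => by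
    change x • (1 : ℤ) = _
    rw [triv_smul, mul_one]
  have hb : Function.Bijective f := by
    refine ⟨(injective_iff_map_eq_zero f).2 fun x hx => ?_, fun n => ?_⟩
    · obtain ⟨y, rfl⟩ := Submodule.Quotient.mk_surjective _ x
      rw [hf] at hx
      exact (Submodule.Quotient.mk_eq_zero _).2 ((mem_Ia_iff y).2 hx)
    · exact ⟨Submodule.Quotient.mk (MonoidAlgebra.single 1 n), by rw [hf, aug_single]⟩
  let e := LinearEquiv.ofBijective f hb
  refine ⟨{
    toFun := hmap q e.toLinearMap
    invFun := hmap q e.symm.toLinearMap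
    left_inv := fun x => ?_
    right_inv := fun x => ?_
    map_add' := map_add _ }⟩
  · rw [hmap_hmap, LinearEquiv.symm_comp, hmap_id_apply]
  · rw [hmap_hmap, LinearEquiv.comp_symm, hmap_id_apply]

end GHom

namespace Bianchi

open GHom

variable {G : Type} [Group G] {S r b U V : G}

theorem homology_one (h : IsPresentation S r b U V) :
    Nonempty (hh G 1 ℤ ≃+ (Fin 2 → ℤ) × ZMod 3 × (Fin 2 → ZMod 2)) := by
  obtain ⟨χ, χS, χr, χb, χU, χV⟩ := h.lift
    (H := Multiplicative ((Fin 2 → ℤ) × ZMod 3 × (Fin 2 → ZMod 2)))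
    (S' := Multiplicative.ofAdd (0, 0, ![1, 0])) (r' := Multiplicative.ofAdd (0, 0, ![0, 1]))
    (b' := Multiplicative.ofAdd (0, 1, 0)) (U' := Multiplicative.ofAdd (![1, 0], 0, 0))
    (V' := Multiplicative.ofAdd (![0, 1], 0, 0)) (by
      constructor
      · decide
      · decide
      · decide
      · exact mul_comm _ _
      · exact mul_comm _ _
      · exact mul_comm _ _
      · rw [inv_mul_cancel_comm, mul_comm])
  obtain ⟨φ, hφ⟩ := exists_hom_of_character χ
  have tors : ∀ (g : G) (n : ℕ), g ^ n = 1 → n • (cls G g).toAdd = 0 := fun g n hg => by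
    rw [← toAdd_pow, ← map_pow, hg, map_one, toAdd_one]
  obtain ⟨fS, eS⟩ := exists_zmod_hom 2 _ (tors S 2 (by rw [pow_two, h.rel.S_S]))
  obtain ⟨fr, er⟩ := exists_zmod_hom 2 _ (tors r 2 (by rw [pow_two, h.rel.r_r]))
  obtain ⟨fb, eb⟩ := exists_zmod_hom 3 _ (tors b 3 (by rw [pow_succ, pow_two, h.rel.b_b]))
  let ψ : (Fin 2 → ℤ) × ZMod 3 × (Fin 2 → ZMod 2) →+ hh G 1 ℤ :=
    AddMonoidHom.coprod
      ((zmultiplesHom _ (cls G U).toAdd).comp (Pi.evalAddMonoidHom (fun _ : Fin 2 => ℤ) 0) +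
        (zmultiplesHom _ (cls G V).toAdd).comp (Pi.evalAddMonoidHom (fun _ : Fin 2 => ℤ) 1))
      (fb.coprod (fS.comp (Pi.evalAddMonoidHom (fun _ : Fin 2 => ZMod 2) 0) +
        fr.comp (Pi.evalAddMonoidHom (fun _ : Fin 2 => ZMod 2) 1)))
  have hψ : ∀ f x y, ψ (f, x, y) = (f 0 • (cls G U).toAdd + f 1 • (cls G V).toAdd) +
      (fb x + (fS (y 0) + fr (y 1))) := fun _ _ _ => rfl
  have e1S : fS 1 = (cls G S).toAdd := by simpa using eS 1
  have e1r : fr 1 = (cls G r).toAdd := by simpa using er 1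
  have e1b : fb 1 = (cls G b).toAdd := by simpa using eb 1
  have comp : (AddMonoidHom.toMultiplicative ψ).comp χ = cls G := by
    refine MonoidHom.eq_of_eqOn_dense h.closure ?_
    rintro g (rfl | rfl | rfl | rfl | rfl)
    all_goals
      refine Multiplicative.toAdd.injective ?_
      change ψ (χ _).toAdd = _
    · rw [χS, toAdd_ofAdd, hψ]; simp [e1S]
    · rw [χr, toAdd_ofAdd, hψ]; simp [e1r]
    · rw [χb, toAdd_ofAdd, hψ]; simp [e1b]
    · rw [χU, toAdd_ofAdd, hψ]; simp
    · rw [χV, toAdd_ofAdd, hψ]; simp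
  refine ⟨AddEquiv.ofBijective φ ⟨(injective_iff_map_eq_zero φ).2 fun x hx => ?_, fun y => ?_⟩⟩
  · obtain ⟨g, hg⟩ := cls_surjective (Multiplicative.ofAdd x)
    have e : ψ (χ g).toAdd = (cls G g).toAdd := congrArg Multiplicative.toAdd
      (DFunLike.congr_fun comp g)
    rw [← hφ, hg, toAdd_ofAdd, hx, map_zero] at e
    exact e.symm
  · obtain ⟨f, x, y⟩ := y
    refine ⟨f 0 • (cls G U).toAdd + f 1 • (cls G V).toAdd + x.val • (cls G b).toAdd +
      (y 0).val • (cls G S).toAdd + (y 1).val • (cls G r).toAdd, ?_⟩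
    simp only [map_add, map_zsmul, map_nsmul, hφ, χS, χr, χb, χU, χV, toAdd_ofAdd]
    refine Prod.ext ?_ (Prod.ext ?_ ?_)
    · funext i
      fin_cases i <;> simp
    · simp
    · funext i
      fin_cases i <;> simp

end Bianchi

/-- The integral homology of `PSL₂(𝒪₋₅)`, where `𝒪₋₅` is the ring of integers of `ℚ(√-5)`. -/
theorem homology_PSL2_O5 (K : Type) [Field K] [NumberField K]
    (hdeg : Module.finrank ℚ K = 2) (hK : ∃ α : K, α ^ 2 = -5)
    (q : ℕ) (hq : 1 ≤ q) :
    (q = 1 → Nonempty (GroupHomology ℤ (PSL2 (NumberField.RingOfIntegers K)) ℤ q ≃+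
      ((Fin 2 → ℤ) × ZMod 3 × (Fin 2 → ZMod 2)))) ∧
    (q = 2 → Nonempty (GroupHomology ℤ (PSL2 (NumberField.RingOfIntegers K)) ℤ q ≃+
      (ℤ × ZMod 4 × ZMod 3 × ZMod 2))) ∧
    (3 ≤ q → Nonempty (GroupHomology ℤ (PSL2 (NumberField.RingOfIntegers K)) ℤ q ≃+
      (ZMod 3 × (Fin q → ZMod 2)))) := by
  obtain ⟨α, hα⟩ := hK
  obtain ⟨S, r, b, U, V, h⟩ := Bianchi.exists_isPresentation K hdeg hα
  obtain ⟨e⟩ := GHom.hh_triv_equiv (PSL2 (NumberField.RingOfIntegers K)) q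
  obtain ⟨e'⟩ := GHom.hl_Ia_equiv (G := PSL2 (NumberField.RingOfIntegers K)) q
  refine ⟨?_, ?_, fun hq3 => ?_⟩
  · rintro rfl
    exact (Bianchi.homology_one h).map e.trans
  · rintro rfl
    exact (Bianchi.homology_two h).map (e.trans e'.symm).trans
  · suffices Nonempty (GHom.hl q (GHom.Ia (PSL2 (NumberField.RingOfIntegers K))) ≃+
        ZMod 3 × (Fin q → ZMod 2)) from this.map (e.trans e'.symm).trans
    rcases Nat.even_or_odd' (q - 3) with ⟨k, hk | hk⟩
    · obtain rfl : q = 2 * k + 3 := by omega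
      exact Bianchi.homology_odd h k
    · obtain rfl : q = 2 * k + 4 := by omega
      exact Bianchi.homology_even h k
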